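/- Let 0 < p, q < ∞ with p ≠ q and let β ∈ {1,2}. For each n, let D^n_{p,β} = vol_{β,n}(B^n_{p,β})^{−1/N} · B^n_{p,β} and D^n_{q,β} = vol_{β,n}(B^n_{q,β})^{−1/N} · B^n_{q,β} be the volume-normalized balls, where N = βn(n−1)/2 + n is the real dimension of H_n(F_β). Then for every t > 0: if t < e^{1/(2p) − 1/(2q)} (2p/(p+q))^{1/q}, then vol_{β,n}(D^n_{p,β} ∩ t·D^n_{q,β}) → 0 as n → ∞; and if t > e^{1/(2p) − 1/(2q)} (2p/(p+q))^{1/q}, then vol_{β,n}(D^n_{p,β} ∩ t·D^n_{q,β}) → 1 as n → ∞. -/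

import Mathlib

open MeasureTheory Filter ENNReal Matrix
open scoped RealInnerProductSpace Pointwise

set_option maxHeartbeats 1000000
set_option autoImplicit false
set_option synthInstance.maxHeartbeats 1000000

noncomputable section

instance rclikeStarModule (𝕜 : Type) [RCLike 𝕜] : StarModule ℝ 𝕜 :=
  ⟨fun r a => by
    simp [Algebra.smul_def, StarMul.star_mul, RCLike.star_def, RCLike.conj_ofReal, mul_comm]⟩

instance matrixMeasurableSpace {𝕜 : Type} [MeasurableSpace 𝕜] (n : ℕ) :
    MeasurableSpace (Matrix (Fin n) (Fin n) 𝕜) :=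
  inferInstanceAs (MeasurableSpace (Fin n → Fin n → 𝕜))

/-- The space `H_n(F_β)` of self-adjoint `n × n` matrices over `𝕜 = F_β`. -/
abbrev HMat (𝕜 : Type) [RCLike 𝕜] (n : ℕ) := selfAdjoint (Matrix (Fin n) (Fin n) 𝕜)

/-- The real eigenvalues (with multiplicity, in some order) of a self-adjoint matrix. -/
def eigs {𝕜 : Type} [RCLike 𝕜] {n : ℕ} (A : HMat 𝕜 n) : Fin n → ℝ :=
  Matrix.IsHermitian.eigenvalues A.prop

/-- The matrix unit ball `B^n_{p,β} = {A : Σ_j |λ_j(A)|^p ≤ 1}`. -/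
def matBall (𝕜 : Type) [RCLike 𝕜] (n : ℕ) (p : ℝ) : Set (HMat 𝕜 n) :=
  {A | ∑ j, |eigs A j| ^ p ≤ 1}

/-- The volume-normalized matrix ball
`D^n_{p,β} = vol(B^n_{p,β})^{-1/N} • B^n_{p,β}`, where `N = β n(n-1)/2 + n`. -/
def matDBall (𝕜 : Type) [RCLike 𝕜] [MeasurableSpace 𝕜] (n : ℕ) (β : ℕ) (p : ℝ)
    (vol : Measure (HMat 𝕜 n)) : Set (HMat 𝕜 n) :=
  ((vol (matBall 𝕜 n p)).toReal ^ (-(1 : ℝ) / ((β * (n * (n - 1) / 2) + n : ℕ) : ℝ))) •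
    matBall 𝕜 n p

/-- The uniform probability measure on the angle interval `(0, 2π]`. -/
def unifAngle : Measure ℝ :=
  ENNReal.ofReal (2 * Real.pi)⁻¹ • (volume.restrict (Set.Ioc 0 (2 * Real.pi)))

instance unifAngle_isProbabilityMeasure : IsProbabilityMeasure unifAngle := by
  constructor
  have h := Real.two_pi_pos
  simp only [unifAngle, Measure.smul_apply, Measure.restrict_apply MeasurableSet.univ,
    Set.univ_inter, Real.volume_Ioc, sub_zero, smul_eq_mul]
  rw [← ENNReal.ofReal_mul (by positivity), inv_mul_cancel₀ h.ne', ENNReal.ofReal_one]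

lemma integral_unifAngle (f : ℝ → ℝ) :
    ∫ ψ, f ψ ∂unifAngle = (2 * Real.pi)⁻¹ * ∫ ψ in (0 : ℝ)..(2 * Real.pi), f ψ := by
  have h := Real.two_pi_pos
  rw [unifAngle, integral_smul_measure, intervalIntegral.integral_of_le h.le,
    ENNReal.toReal_ofReal (by positivity), smul_eq_mul]

lemma integrable_unifAngle {f : ℝ → ℝ}
    (hf : IntervalIntegrable f volume 0 (2 * Real.pi)) : Integrable f unifAngle := by
  have h := Real.two_pi_pos
  rw [unifAngle]
  exact ((intervalIntegrable_iff_integrableOn_Ioc_of_le h.le).1 hf).smul_measure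
    ENNReal.ofReal_ne_top

lemma unifAngle_absolutelyContinuous : unifAngle ≪ volume :=
  (Measure.smul_absolutelyContinuous).trans Measure.restrict_le_self.absolutelyContinuous

lemma integrable_log_norm_sub_circleMap (a : ℂ) :
    Integrable (fun ψ => Real.log ‖a - circleMap 0 1 ψ‖) unifAngle := by
  have := circleIntegrable_log_norm_sub_const (a := a) (c := 0) 1
  apply integrable_unifAngle
  simp only [CircleIntegrable] at this
  simpa only [norm_sub_rev] using this

lemma integral_log_norm_sub_circleMap {a : ℂ} (ha : 1 ≤ ‖a‖) :
    ∫ ψ, Real.log ‖a - circleMap 0 1 ψ‖ ∂unifAngle = Real.log ‖a‖ := by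
  have := circleAverage_log_norm_sub_const_eq_posLog (a := a)
  rw [Real.circleAverage_def] at this
  rw [integral_unifAngle]
  simp only [norm_sub_rev a]
  rw [← Real.posLog_eq_log (by rwa [abs_norm]), ← this, smul_eq_mul]

/-- Every complex number is the image of a number of norm at least one under a Joukowski map. -/
lemma exists_joukowski (w : ℂ) {t : ℝ} (ht : 0 < t) :
    ∃ ζ : ℂ, 1 ≤ ‖ζ‖ ∧ w = (t / 2) * (ζ + ζ⁻¹) := by
  obtain ⟨s, hs⟩ := IsAlgClosed.exists_pow_nat_eq (w ^ 2 - t ^ 2) (n := 2) (by norm_num)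
  have ht' : (t : ℂ) ≠ 0 := by exact_mod_cast ht.ne'
  have key : ((w + s) / t) * ((w - s) / t) = 1 := by
    field_simp
    linear_combination -hs
  have hinv : ((w + s) / t)⁻¹ = (w - s) / t := inv_eq_of_mul_eq_one_right key
  have hinv' : ((w - s) / t)⁻¹ = (w + s) / t := inv_eq_of_mul_eq_one_left key
  rcases le_total 1 ‖(w + s) / t‖ with h | h
  · refine ⟨(w + s) / t, h, ?_⟩
    rw [hinv]; field_simp; ring
  · refine ⟨(w - s) / t, ?_, ?_⟩
    · rw [← hinv, norm_inv]
      have : 0 < ‖(w + s) / t‖ := by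
        rw [norm_pos_iff]; rintro h0; rw [h0, zero_mul] at key; exact zero_ne_one key
      exact (one_le_inv₀ this).2 h
    · rw [hinv']; field_simp; ring

lemma arcosh_joukowski {w ζ : ℂ} {t : ℝ} (ht : 0 < t) (hζ : 1 ≤ ‖ζ‖)
    (h : w = (t / 2) * (ζ + ζ⁻¹)) :
    Real.arcosh ((‖w - t‖ + ‖w + t‖) / (2 * t)) = Real.log ‖ζ‖ := by
  have hζ0 : ζ ≠ 0 := by rintro rfl; simp at hζ; linarith
  have hz : 0 < ‖ζ‖ := by linarith
  have h1 : w - t = (t / 2) * (ζ - 1) ^ 2 / ζ := by rw [h]; field_simp; ring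
  have h2 : w + t = (t / 2) * (ζ + 1) ^ 2 / ζ := by rw [h]; field_simp; ring
  have hp : ‖ζ + 1‖ ^ 2 + ‖ζ - 1‖ ^ 2 = 2 * (‖ζ‖ ^ 2 + 1) := by
    have := parallelogram_law_with_norm ℝ ζ 1
    simp only [norm_one] at this
    nlinarith
  have htn : ‖(t : ℂ) / 2‖ = t / 2 := by
    rw [norm_div, Complex.norm_real, Real.norm_of_nonneg ht.le]; simp
  have : (‖w - t‖ + ‖w + t‖) / (2 * t) = Real.cosh (Real.log ‖ζ‖) := by
    rw [h1, h2, Real.cosh_log hz, norm_div, norm_div, norm_mul, norm_mul, norm_pow, norm_pow, htn]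
    field_simp
    linarith
  rw [this, Real.arcosh_cosh (Real.log_nonneg hζ)]

lemma ae_log_norm_sub_cos {w ζ : ℂ} {t : ℝ} (ht : 0 < t) (hζ : 1 ≤ ‖ζ‖)
    (h : w = (t / 2) * (ζ + ζ⁻¹)) :
    (fun ψ : ℝ => Real.log ‖w - ((t * Real.cos ψ : ℝ) : ℂ)‖) =ᵐ[unifAngle]
      fun ψ => Real.log (t / 2) - Real.log ‖ζ‖ + Real.log ‖ζ - circleMap 0 1 ψ‖
        + Real.log ‖(starRingEnd ℂ) ζ - circleMap 0 1 ψ‖ := by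
  have hζ0 : ζ ≠ 0 := by rintro rfl; simp at hζ; linarith
  have hz : 0 < ‖ζ‖ := by linarith
  have hae : ∀ a : ℂ, ∀ᵐ ψ ∂unifAngle, a - circleMap 0 1 ψ ≠ 0 := by
    intro a
    have h0 : ∀ᵐ ψ ∂(volume : Measure ℝ), a - circleMap 0 1 ψ ≠ 0 := by
      have := ((Set.countable_singleton a).preimage_circleMap 0 (one_ne_zero)).measure_zero volume
      rw [ae_iff]
      convert this using 2
      ext ψ
      simp only [Set.mem_ofPred_eq, not_not, Set.mem_preimage, Set.mem_singleton_iff, sub_eq_zero]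
      exact eq_comm
    exact unifAngle_absolutelyContinuous.ae_le h0
  filter_upwards [hae ζ, hae ((starRingEnd ℂ) ζ)] with ψ h1 h2
  have hc : (starRingEnd ℂ) (circleMap 0 1 ψ) = (circleMap 0 1 ψ)⁻¹ := by
    simp [circleMap, ← Complex.exp_conj, ← Complex.exp_neg]
  have hne : circleMap 0 1 ψ ≠ 0 := by simp [circleMap]
  have hcos : ((t * Real.cos ψ : ℝ) : ℂ) = (t / 2) * (circleMap 0 1 ψ + (circleMap 0 1 ψ)⁻¹) := by
    simp [circleMap, Complex.cos, ← Complex.exp_neg]; ring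
  have e1 : w - ((t * Real.cos ψ : ℝ) : ℂ) = (t / 2 : ℝ) * (ζ - circleMap 0 1 ψ) *
      (starRingEnd ℂ) ((starRingEnd ℂ) ζ - circleMap 0 1 ψ) / ζ := by
    rw [hcos, h, map_sub, Complex.conj_conj, hc]
    push_cast
    field_simp
    ring
  rw [e1, norm_div, norm_mul, norm_mul, RCLike.norm_conj, Complex.norm_real,
    Real.norm_of_nonneg (by positivity : 0 ≤ t / 2)]
  rw [Real.log_div (by positivity) hz.ne', Real.log_mul (by positivity) (by positivity),
    Real.log_mul (by positivity) (by positivity)]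
  ring

lemma integrable_log_norm_sub_cos (w : ℂ) {t : ℝ} (ht : 0 < t) :
    Integrable (fun ψ : ℝ => Real.log ‖w - ((t * Real.cos ψ : ℝ) : ℂ)‖) unifAngle := by
  obtain ⟨ζ, hζ, h⟩ := exists_joukowski w ht
  refine Integrable.congr ?_ (ae_log_norm_sub_cos ht hζ h).symm
  exact (((integrable_const _).add (integrable_log_norm_sub_circleMap _))).add
    (integrable_log_norm_sub_circleMap _)

/-- The logarithmic potential of the arcsine law on `[-t, t]`. -/
lemma integral_log_norm_sub_cos (w : ℂ) {t : ℝ} (ht : 0 < t) :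
    ∫ ψ, Real.log ‖w - ((t * Real.cos ψ : ℝ) : ℂ)‖ ∂unifAngle =
      Real.log (t / 2) + Real.arcosh ((‖w - t‖ + ‖w + t‖) / (2 * t)) := by
  obtain ⟨ζ, hζ, h⟩ := exists_joukowski w ht
  have hi : Integrable (fun ψ => Real.log (t / 2) - Real.log ‖ζ‖ +
      Real.log ‖ζ - circleMap 0 1 ψ‖) unifAngle :=
    (integrable_const _).add (integrable_log_norm_sub_circleMap _)
  rw [integral_congr_ae (ae_log_norm_sub_cos ht hζ h), arcosh_joukowski ht hζ h,
    integral_add hi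
      (integrable_log_norm_sub_circleMap _), integral_add (integrable_const _)
      (integrable_log_norm_sub_circleMap _), integral_log_norm_sub_circleMap hζ,
      integral_log_norm_sub_circleMap (by rwa [RCLike.norm_conj]), RCLike.norm_conj]
  simp

lemma one_le_joukowski_arg (w : ℂ) {t : ℝ} (ht : 0 < t) :
    1 ≤ (‖w - t‖ + ‖w + t‖) / (2 * t) := by
  rw [le_div_iff₀ (by positivity), one_mul]
  have := norm_sub_le (w + t) (w - t)
  have h2 : w + t - (w - t) = ((2 * t : ℝ) : ℂ) := by push_cast; ring
  rw [h2, Complex.norm_real, Real.norm_of_nonneg (by positivity)] at this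
  linarith

lemma log_half_le_integral_log_norm_sub_cos (w : ℂ) {t : ℝ} (ht : 0 < t) :
    Real.log (t / 2) ≤ ∫ ψ, Real.log ‖w - ((t * Real.cos ψ : ℝ) : ℂ)‖ ∂unifAngle := by
  rw [integral_log_norm_sub_cos w ht]
  linarith [Real.arcosh_nonneg (one_le_joukowski_arg w ht)]

/-- Index pairs strictly below the diagonal. -/
abbrev LowerIdx (n : ℕ) := {ij : Fin n × Fin n // ij.2 < ij.1}

/-- Real diagonals together with strictly lower triangular parts. -/
abbrev HermCoord (𝕜 : Type) (n : ℕ) := (Fin n → ℝ) × (LowerIdx n → 𝕜)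

section Algebra

variable {𝕜 : Type} [RCLike 𝕜] {n : ℕ}

/-- The real diagonal matrix, with entries in `𝕜`. -/
def realDiag : (Fin n → ℝ) →ₗ[ℝ] Matrix (Fin n) (Fin n) 𝕜 where
  toFun d := diagonal fun i => (d i : 𝕜)
  map_add' d e := by simp [← diagonal_add]
  map_smul' r d := by ext i j; simp [diagonal_apply, Algebra.smul_def]

/-- The strictly lower triangular matrix with given entries. -/
def lowMat : (LowerIdx n → 𝕜) →ₗ[ℝ] Matrix (Fin n) (Fin n) 𝕜 where
  toFun x := of fun i j => if h : j < i then x ⟨(i, j), h⟩ else 0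
  map_add' x y := by ext i j; by_cases h : j < i <;> simp [h]
  map_smul' r x := by ext i j; by_cases h : j < i <;> simp [h]

/-- The skew-adjoint matrix with zero diagonal and given strictly lower triangular part. -/
def skewMat : (LowerIdx n → 𝕜) →ₗ[ℝ] Matrix (Fin n) (Fin n) 𝕜 where
  toFun x := lowMat x - (lowMat x)ᴴ
  map_add' x y := by simp only [map_add, conjTranspose_add]; abel
  map_smul' r x := by
    simp only [map_smul, conjTranspose_smul, star_trivial, RingHom.id_apply, smul_sub]

/-- The self-adjoint matrix with given diagonal and strictly lower triangular part. -/
def hermMat : HermCoord 𝕜 n →ₗ[ℝ] Matrix (Fin n) (Fin n) 𝕜 where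
  toFun a := realDiag a.1 + (lowMat a.2 + (lowMat a.2)ᴴ)
  map_add' x y := by simp only [Prod.fst_add, Prod.snd_add, map_add, conjTranspose_add]; abel
  map_smul' r x := by
    simp only [Prod.smul_fst, Prod.smul_snd, map_smul, conjTranspose_smul, star_trivial,
      RingHom.id_apply, smul_add]

/-- The diagonal and the strictly lower triangular part of a matrix. -/
def matCoord : Matrix (Fin n) (Fin n) 𝕜 →ₗ[ℝ] HermCoord 𝕜 n where
  toFun A := (fun i => RCLike.re (A i i), fun ij => A ij.1.1 ij.1.2)
  map_add' A B := by ext <;> simp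
  map_smul' r A := by ext <;> simp [RCLike.smul_re]

lemma lowMat_apply (x : LowerIdx n → 𝕜) (i j : Fin n) :
    lowMat x i j = if h : j < i then x ⟨(i, j), h⟩ else 0 := rfl

lemma hermMat_isHermitian (a : HermCoord 𝕜 n) : (hermMat a).IsHermitian := by
  have h1 : (realDiag a.1 : Matrix (Fin n) (Fin n) 𝕜).IsHermitian := by
    simp [realDiag, IsHermitian, diagonal_conjTranspose, Pi.star_def]
  exact h1.add (by rw [IsHermitian, conjTranspose_add, conjTranspose_conjTranspose, add_comm])

lemma skewMat_conjTranspose (x : LowerIdx n → 𝕜) : (skewMat x)ᴴ = -skewMat x := by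
  simp [skewMat]

lemma hermMat_apply_self (a : HermCoord 𝕜 n) (i : Fin n) : hermMat a i i = (a.1 i : 𝕜) := by
  simp [hermMat, realDiag, lowMat_apply, conjTranspose_apply]

lemma hermMat_apply_lower (a : HermCoord 𝕜 n) (ij : LowerIdx n) :
    hermMat a ij.1.1 ij.1.2 = a.2 ij := by
  have h := ij.2
  simp [hermMat, realDiag, lowMat_apply, conjTranspose_apply, h, h.ne', h.not_gt]

lemma matCoord_hermMat (a : HermCoord 𝕜 n) : matCoord (hermMat a) = a := by
  ext i
  · simp [matCoord, hermMat_apply_self]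
  · simp [matCoord, hermMat_apply_lower]

lemma hermMat_matCoord {A : Matrix (Fin n) (Fin n) 𝕜} (hA : A.IsHermitian) :
    hermMat (matCoord A) = A := by
  ext i j
  rcases lt_trichotomy j i with h | rfl | h
  · rw [hermMat_apply_lower (matCoord A) ⟨(i, j), h⟩]; rfl
  · rw [hermMat_apply_self]; exact hA.coe_re_apply_self j
  · rw [← (hermMat_isHermitian (matCoord A)).apply i j, ← hA.apply i j]
    rw [hermMat_apply_lower (matCoord A) ⟨(j, i), h⟩]; rfl

open scoped ComplexOrder in
lemma isUnit_one_sub_skew {X : Matrix (Fin n) (Fin n) 𝕜} (hX : Xᴴ = -X) : IsUnit (1 - X) := by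
  have h1 : (1 + Xᴴ * X).PosDef := PosDef.one.add_posSemidef (posSemidef_conjTranspose_mul_self X)
  have h2 : (1 : Matrix (Fin n) (Fin n) 𝕜) + Xᴴ * X = (1 + X) * (1 - X) := by
    rw [hX]; noncomm_ring
  rw [h2] at h1
  have := h1.isUnit
  rw [isUnit_iff_isUnit_det, det_mul] at this
  rw [isUnit_iff_isUnit_det]
  exact isUnit_of_mul_isUnit_right this

/-- The inverse matrix `(1 - X)⁻¹`, `X` the skew-adjoint matrix with given lower part. -/
def cayInv (x : LowerIdx n → 𝕜) : Matrix (Fin n) (Fin n) 𝕜 := (1 - skewMat x)⁻¹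

/-- The Cayley transform `(1 + X) (1 - X)⁻¹`. -/
def cayley (x : LowerIdx n → 𝕜) : Matrix (Fin n) (Fin n) 𝕜 := (1 + skewMat x) * cayInv x

lemma isUnit_one_sub_skewMat (x : LowerIdx n → 𝕜) : IsUnit (1 - skewMat x).det :=
  (isUnit_iff_isUnit_det _).1 (isUnit_one_sub_skew (skewMat_conjTranspose x))

lemma cayInv_mul (x : LowerIdx n → 𝕜) : cayInv x * (1 - skewMat x) = 1 :=
  nonsing_inv_mul _ (isUnit_one_sub_skewMat x)

lemma mul_cayInv (x : LowerIdx n → 𝕜) : (1 - skewMat x) * cayInv x = 1 :=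
  mul_nonsing_inv _ (isUnit_one_sub_skewMat x)

lemma mul_cayInv_conjTranspose (x : LowerIdx n → 𝕜) : (1 + skewMat x) * (cayInv x)ᴴ = 1 := by
  have := congrArg conjTranspose (cayInv_mul x)
  rwa [conjTranspose_mul, conjTranspose_sub, conjTranspose_one, skewMat_conjTranspose,
    sub_neg_eq_add] at this

lemma cayley_eq (x : LowerIdx n → 𝕜) : cayley x = 2 * cayInv x - 1 := by
  have := mul_cayInv x
  rw [sub_mul, one_mul] at this
  have h : skewMat x * cayInv x = cayInv x - 1 := by rw [← this]; abel
  rw [cayley, add_mul, one_mul, two_mul, h]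
  abel

lemma cayley_mul_cayInv_conjTranspose (x : LowerIdx n → 𝕜) :
    cayley x * (cayInv x)ᴴ = cayInv x := by
  have hc : cayInv x * (1 + skewMat x) = (1 + skewMat x) * cayInv x := by
    have h1 := mul_cayInv x
    have h2 := cayInv_mul x
    rw [sub_mul, one_mul] at h1
    rw [mul_sub, mul_one] at h2
    rw [add_mul, mul_add, one_mul, mul_one]
    rw [← h2] at h1
    have h3 := sub_right_injective h1
    rw [h3]
  rw [cayley, ← hc, Matrix.mul_assoc, mul_cayInv_conjTranspose, Matrix.mul_one]

lemma cayley_mul_conjTranspose (x : LowerIdx n → 𝕜) : cayley x * (cayley x)ᴴ = 1 := by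
  have h : (cayley x)ᴴ = (cayInv x)ᴴ * (1 - skewMat x) := by
    rw [cayley, conjTranspose_mul, conjTranspose_add, skewMat_conjTranspose, conjTranspose_one,
      sub_eq_add_neg]
  rw [h, ← Matrix.mul_assoc, cayley_mul_cayInv_conjTranspose, cayInv_mul]

lemma cayley_mem_unitaryGroup (x : LowerIdx n → 𝕜) : cayley x ∈ unitaryGroup (Fin n) 𝕜 :=
  mem_unitaryGroup_iff.2 (cayley_mul_conjTranspose x)

/-- Coordinates of `U diag(d) Uᴴ`, with `U` the Cayley transform. -/
def diagConj (a : HermCoord 𝕜 n) : HermCoord 𝕜 n :=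
  matCoord (cayley a.2 * realDiag a.1 * (cayley a.2)ᴴ)

/-- Conjugation by a matrix, in coordinates. -/
def conjCoord (u : Matrix (Fin n) (Fin n) 𝕜) : HermCoord 𝕜 n →ₗ[ℝ] HermCoord 𝕜 n where
  toFun a := matCoord (u * hermMat a * uᴴ)
  map_add' a b := by simp [mul_add, add_mul]
  map_smul' r a := by simp

/-- The derivative of the Cayley transform, in coordinates. -/
def cayDeriv (x : LowerIdx n → 𝕜) : (LowerIdx n → 𝕜) →ₗ[ℝ] (LowerIdx n → 𝕜) where
  toFun y ij := ((2 : ℝ) • ((cayInv x)ᴴ * skewMat y * cayInv x)) ij.1.1 ij.1.2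
  map_add' a b := by ext; simp [mul_add, add_mul]
  map_smul' r a := by
    ext
    simp only [map_smul, mul_smul_comm, smul_mul_assoc, smul_comm (2 : ℝ) r]
    rfl

/-- The commutator with a diagonal matrix, in coordinates. -/
def adDiag (𝕜 : Type) [RCLike 𝕜] {n : ℕ} (d : Fin n → ℝ) :
    (LowerIdx n → 𝕜) →ₗ[ℝ] (LowerIdx n → 𝕜) :=
  LinearMap.pi fun ij => ((d ij.1.2 - d ij.1.1) • LinearMap.id) ∘ₗ LinearMap.proj ij

lemma det_adDiag (d : Fin n → ℝ) :
    LinearMap.det (adDiag 𝕜 d) =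
      ∏ ij : LowerIdx n, (d ij.1.2 - d ij.1.1) ^ Module.finrank ℝ 𝕜 := by
  rw [adDiag, LinearMap.det_pi]
  simp

lemma realDiag_commutator (d e : Fin n → ℝ) {W : Matrix (Fin n) (Fin n) 𝕜} (hW : Wᴴ = -W) :
    W * realDiag d - realDiag d * W + realDiag e =
      hermMat (e, adDiag 𝕜 d fun ij => W ij.1.1 ij.1.2) := by
  have hH : (W * realDiag d - realDiag d * W + realDiag e).IsHermitian := by
    have h1 : ∀ d : Fin n → ℝ, (realDiag d : Matrix (Fin n) (Fin n) 𝕜)ᴴ = realDiag d := by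
      intro d
      simp [realDiag, diagonal_conjTranspose, Pi.star_def]
    rw [IsHermitian, conjTranspose_add, conjTranspose_sub, conjTranspose_mul, conjTranspose_mul,
      h1, h1, hW]
    noncomm_ring
  rw [← hermMat_matCoord hH]
  congr 1
  ext i
  · simp [matCoord, realDiag, mul_comm]
  · have := i.2.ne'
    simp [matCoord, adDiag, realDiag, this, sub_mul, Algebra.smul_def, mul_comm]

end Algebra

section AbstractDerivative

variable {R E F G : Type*} [NormedRing R] [NormedAlgebra ℝ R] [CompleteSpace R]
  [FiniteDimensional ℝ R] [NormedAddCommGroup E] [NormedSpace ℝ E] [FiniteDimensional ℝ E]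
  [NormedAddCommGroup F] [NormedSpace ℝ F] [FiniteDimensional ℝ F]
  [NormedAddCommGroup G] [NormedSpace ℝ G]

lemma hasStrictFDerivAt_inverse_conj (S : E →ₗ[ℝ] R) (D : F →ₗ[ℝ] R) (st : R →ₗ[ℝ] R)
    (K : R →ₗ[ℝ] G) (a : F × E) {c : R} (h1 : c * (1 - S a.2) = 1) (h2 : (1 - S a.2) * c = 1) :
    ∃ L : F × E →L[ℝ] G,
      HasStrictFDerivAt (fun a : F × E => K ((2 * Ring.inverse (1 - S a.2) - 1) * D a.1 *
        st (2 * Ring.inverse (1 - S a.2) - 1))) L a ∧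
      ∀ v, L v = K ((2 * (c * S v.2 * c)) * D a.1 * st (2 * c - 1) +
        (2 * c - 1) * D v.1 * st (2 * c - 1) + (2 * c - 1) * D a.1 * st (2 * (c * S v.2 * c))) := by
  set S' := S.toContinuousLinearMap
  set D' := D.toContinuousLinearMap
  set st' := st.toContinuousLinearMap
  set K' := K.toContinuousLinearMap
  let w : Rˣ := ⟨1 - S a.2, c, h2, h1⟩
  have hinv : HasStrictFDerivAt (Ring.inverse : R → R) _ (1 - S' a.2) :=
    hasStrictFDerivAt_ringInverse (𝕜 := ℝ) w
  have hS : HasStrictFDerivAt (fun a : F × E => 1 - S' a.2) _ a :=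
    (S'.hasStrictFDerivAt.comp a hasStrictFDerivAt_snd).const_sub 1
  have hu : HasStrictFDerivAt (fun a : F × E => 2 * Ring.inverse (1 - S' a.2) - 1) _ a :=
    ((hinv.comp a hS).const_mul 2).sub_const 1
  have hD : HasStrictFDerivAt (fun a : F × E => D' a.1) _ a :=
    D'.hasStrictFDerivAt.comp a hasStrictFDerivAt_fst
  have hst : HasStrictFDerivAt (fun a : F × E => st' (2 * Ring.inverse (1 - S' a.2) - 1)) _ a :=
    st'.hasStrictFDerivAt.comp a hu
  have hall := K'.hasStrictFDerivAt.comp a ((hu.mul' hD).mul' hst)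
  refine ⟨_, hall, ?_⟩
  intro v
  have hi : Ring.inverse (1 - S a.2) = c := Ring.inverse_unit w
  have hw : ((w⁻¹ : Rˣ) : R) = c := rfl
  simp only [S', D', st', K', hw]
  simp [hi, mul_assoc]
  abel

end AbstractDerivative

section Derivative

variable {𝕜 : Type} [RCLike 𝕜] {n : ℕ}

lemma cayDeriv_skew (x y : LowerIdx n → 𝕜) :
    ((2 : ℝ) • ((cayInv x)ᴴ * skewMat y * cayInv x))ᴴ =
      -((2 : ℝ) • ((cayInv x)ᴴ * skewMat y * cayInv x)) := by
  rw [conjTranspose_smul, conjTranspose_mul, conjTranspose_mul, conjTranspose_conjTranspose,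
    skewMat_conjTranspose]
  simp [Matrix.mul_assoc]

lemma diagConj_deriv_identity (a v : HermCoord 𝕜 n) :
    (2 * (cayInv a.2 * skewMat v.2 * cayInv a.2)) * realDiag a.1 * (cayley a.2)ᴴ +
      cayley a.2 * realDiag v.1 * (cayley a.2)ᴴ + cayley a.2 * realDiag a.1 *
        (2 * (cayInv a.2 * skewMat v.2 * cayInv a.2))ᴴ =
    cayley a.2 * hermMat (v.1, adDiag 𝕜 a.1 (cayDeriv a.2 v.2)) * (cayley a.2)ᴴ := by
  set W := (2 : ℝ) • ((cayInv a.2)ᴴ * skewMat v.2 * cayInv a.2) with hWdef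
  have hW : Wᴴ = -W := cayDeriv_skew a.2 v.2
  have h1 : 2 * (cayInv a.2 * skewMat v.2 * cayInv a.2) = cayley a.2 * W := by
    nth_rw 1 [← cayley_mul_cayInv_conjTranspose a.2]
    rw [hWdef, mul_smul_comm, two_smul, two_mul]
    simp only [Matrix.mul_assoc]
  have h2 : hermMat (v.1, adDiag 𝕜 a.1 (cayDeriv a.2 v.2)) =
      W * realDiag a.1 - realDiag a.1 * W + realDiag v.1 :=
    (realDiag_commutator a.1 v.1 hW).symm
  rw [h1, h2, conjTranspose_mul, hW]
  noncomm_ring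

attribute [local instance] Matrix.linftyOpNormedRing Matrix.linftyOpNormedAlgebra in
lemma hasStrictFDerivAt_diagConj (a : HermCoord 𝕜 n) :
    ∃ L : HermCoord 𝕜 n →L[ℝ] HermCoord 𝕜 n, HasStrictFDerivAt diagConj L a ∧
      (L : HermCoord 𝕜 n →ₗ[ℝ] HermCoord 𝕜 n) = conjCoord (cayley a.2) ∘ₗ
        (LinearMap.prodMap LinearMap.id (adDiag 𝕜 a.1)) ∘ₗ
        (LinearMap.prodMap LinearMap.id (cayDeriv a.2)) := by
  let st : Matrix (Fin n) (Fin n) 𝕜 →ₗ[ℝ] Matrix (Fin n) (Fin n) 𝕜 :=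
    { toFun := fun A => Aᴴ
      map_add' := conjTranspose_add
      map_smul' := fun r A => by simp [conjTranspose_smul] }
  obtain ⟨L, hL, hL'⟩ := hasStrictFDerivAt_inverse_conj (skewMat : (LowerIdx n → 𝕜) →ₗ[ℝ] _)
    (realDiag : _ →ₗ[ℝ] Matrix (Fin n) (Fin n) 𝕜) st matCoord a (cayInv_mul a.2) (mul_cayInv a.2)
  refine ⟨L, ?_, ?_⟩
  · have hfun : (diagConj : HermCoord 𝕜 n → HermCoord 𝕜 n) = fun a : HermCoord 𝕜 n =>
        matCoord ((2 * Ring.inverse (1 - skewMat a.2) - 1) * realDiag a.1 *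
          st (2 * Ring.inverse (1 - skewMat a.2) - 1)) := by
      ext1 b
      rw [← nonsing_inv_eq_ringInverse]
      change _ = matCoord ((2 * cayInv b.2 - 1) * realDiag b.1 * (2 * cayInv b.2 - 1)ᴴ)
      rw [← cayley_eq]
      rfl
    rw [hfun]
    exact hL
  · refine LinearMap.ext fun v => ?_
    rw [ContinuousLinearMap.coe_coe, hL' v, ← cayley_eq]
    exact congrArg matCoord (diagConj_deriv_identity a v)

/-- The angular part of the Jacobian determinant of `diagConj`. -/
def cayJac (x : LowerIdx n → 𝕜) : ℝ :=
  |LinearMap.det (conjCoord (cayley x)) * LinearMap.det (cayDeriv x)|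

/-- The product of the distances between the points. -/
def vand {n : ℕ} (d : Fin n → ℝ) : ℝ := ∏ ij : LowerIdx n, |d ij.1.2 - d ij.1.1|

lemma abs_det_fderiv_diagConj (a : HermCoord 𝕜 n) :
    |(fderiv ℝ diagConj a).det| = vand a.1 ^ Module.finrank ℝ 𝕜 * cayJac a.2 := by
  obtain ⟨L, hL, hL'⟩ := hasStrictFDerivAt_diagConj a
  rw [hL.hasFDerivAt.fderiv, ContinuousLinearMap.det, hL', LinearMap.det_comp, LinearMap.det_comp,
    LinearMap.det_prodMap, LinearMap.det_prodMap, LinearMap.det_id, det_adDiag, cayJac, vand,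
    Finset.prod_pow, one_mul, one_mul, ← Finset.abs_prod]
  simp only [abs_mul, abs_pow]
  ring

lemma cayley_zero : cayley (0 : LowerIdx n → 𝕜) = 1 := by simp [cayley, cayInv]

lemma cayJac_zero_ne_zero : cayJac (0 : LowerIdx n → 𝕜) ≠ 0 := by
  have h1 : conjCoord (cayley (0 : LowerIdx n → 𝕜)) = LinearMap.id := by
    refine LinearMap.ext fun a => ?_
    simp [conjCoord, cayley_zero, matCoord_hermMat]
  have h2 : cayDeriv (0 : LowerIdx n → 𝕜) = (2 : ℝ) • LinearMap.id := by
    refine LinearMap.ext fun y => funext fun ij => ?_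
    have h := ij.2
    simp [cayDeriv, cayInv, skewMat, lowMat_apply, h, h.not_gt]
  rw [cayJac, h1, h2]
  simp

lemma vand_pos {d : Fin n → ℝ} (hd : StrictMono d) : 0 < vand d :=
  Finset.prod_pos fun ij _ => abs_pos.2 (sub_ne_zero.2 (hd ij.2).ne)

lemma strictMono_natCast : StrictMono fun i : Fin n => (i : ℝ) := fun _ _ h => Nat.cast_lt.2 h

lemma continuous_diagConj : Continuous (diagConj : HermCoord 𝕜 n → HermCoord 𝕜 n) :=
  continuous_iff_continuousAt.2 fun a =>
    (hasStrictFDerivAt_diagConj a).choose_spec.1.continuousAt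

lemma measurable_cayJac [MeasurableSpace 𝕜] [BorelSpace 𝕜] :
    Measurable (cayJac : (LowerIdx n → 𝕜) → ℝ) := by
  have h1 : Measurable fun x : LowerIdx n → 𝕜 =>
      |(fderiv ℝ (diagConj : HermCoord 𝕜 n → HermCoord 𝕜 n) ((fun i : Fin n => (i : ℝ)), x)).det| := by
    refine Measurable.abs ?_
    refine (ContinuousLinearMap.continuous_det.measurable.comp (measurable_fderiv ℝ _)).comp ?_
    exact measurable_const.prodMk measurable_id
  have hv := (vand_pos (strictMono_natCast (n := n))).ne'
  have h2 : (cayJac : (LowerIdx n → 𝕜) → ℝ) = fun x =>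
      (vand (fun i : Fin n => (i : ℝ)) ^ Module.finrank ℝ 𝕜)⁻¹ *
      |(fderiv ℝ (diagConj : HermCoord 𝕜 n → HermCoord 𝕜 n) ((fun i : Fin n => (i : ℝ)), x)).det| := by
    ext x
    rw [abs_det_fderiv_diagConj]
    field_simp
  rw [h2]
  exact h1.const_mul _

end Derivative

section Spectra

variable {𝕜 : Type} [RCLike 𝕜] {n : ℕ}

lemma map_eq_of_diag_conj_eq {V U : Matrix (Fin n) (Fin n) 𝕜} (hV : V ∈ unitaryGroup (Fin n) 𝕜)
    (hU : U ∈ unitaryGroup (Fin n) 𝕜) {d e : Fin n → ℝ}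
    (h : V * realDiag d * Vᴴ = U * realDiag e * Uᴴ) :
    Multiset.map d Finset.univ.val = Multiset.map e Finset.univ.val := by
  have key : ∀ (V : Matrix (Fin n) (Fin n) 𝕜) (_ : V ∈ unitaryGroup (Fin n) 𝕜) (d : Fin n → ℝ),
      (V * realDiag d * Vᴴ).charpoly.roots =
        Multiset.map (RCLike.ofReal : ℝ → 𝕜) (Multiset.map d Finset.univ.val) := by
    intro V hV d
    have hV' : Vᴴ * V = 1 := mem_unitaryGroup_iff'.1 hV
    rw [charpoly_mul_comm, ← Matrix.mul_assoc, hV', Matrix.one_mul, Multiset.map_map]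
    change (diagonal fun i => ((d i : ℝ) : 𝕜)).charpoly.roots = _
    rw [charpoly_diagonal, Polynomial.roots_prod _ _
      (by simp [Finset.prod_ne_zero_iff, Polynomial.X_sub_C_ne_zero])]
    simp [Multiset.bind_singleton]
  have h2 := congrArg (fun M : Matrix (Fin n) (Fin n) 𝕜 => M.charpoly.roots) h
  simp only [key V hV, key U hU] at h2
  exact Multiset.map_injective RCLike.ofReal_injective h2

lemma eq_of_diag_conj_eq {V U : Matrix (Fin n) (Fin n) 𝕜} (hV : V ∈ unitaryGroup (Fin n) 𝕜)
    (hU : U ∈ unitaryGroup (Fin n) 𝕜) {d e : Fin n → ℝ} (hd : StrictMono d) (he : StrictMono e)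
    (h : V * realDiag d * Vᴴ = U * realDiag e * Uᴴ) : d = e := by
  have h1 := map_eq_of_diag_conj_eq hV hU h
  refine (StrictMono.range_inj hd he).1 ?_
  ext y
  have := congrArg (fun s => y ∈ s) h1
  simpa using this

lemma diag_conj_congr {V U : Matrix (Fin n) (Fin n) 𝕜} (hV : V ∈ unitaryGroup (Fin n) 𝕜)
    (hU : U ∈ unitaryGroup (Fin n) 𝕜) {d : Fin n → ℝ} (hd : Function.Injective d)
    (h : V * realDiag d * Vᴴ = U * realDiag d * Uᴴ) (e : Fin n → ℝ) :
    V * realDiag e * Vᴴ = U * realDiag e * Uᴴ := by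
  have hV1 : Vᴴ * V = 1 := mem_unitaryGroup_iff'.1 hV
  have hU1 : Uᴴ * U = 1 := mem_unitaryGroup_iff'.1 hU
  have hU2 : U * Uᴴ = 1 := mem_unitaryGroup_iff.1 hU
  have hV2 : V * Vᴴ = 1 := mem_unitaryGroup_iff.1 hV
  have h1 : (Uᴴ * V) * realDiag d = realDiag d * (Uᴴ * V) := by
    calc (Uᴴ * V) * realDiag d = Uᴴ * (V * realDiag d * Vᴴ) * V := by
          simp only [Matrix.mul_assoc, hV1, Matrix.mul_one]
      _ = (Uᴴ * U) * realDiag d * (Uᴴ * V) := by rw [h]; simp only [Matrix.mul_assoc]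
      _ = _ := by rw [hU1, Matrix.one_mul]
  have h2 : (Uᴴ * V) * realDiag e = realDiag e * (Uᴴ * V) := by
    ext i j
    have h3 := congrFun (congrFun h1 i) j
    simp only [realDiag, LinearMap.coe_mk, AddHom.coe_mk, mul_diagonal, diagonal_mul] at h3 ⊢
    by_cases hij : i = j
    · rw [hij, mul_comm]
    · have h4 : (Uᴴ * V) i j = 0 := by
        have h5 : (Uᴴ * V) i j * ((d j - d i : ℝ) : 𝕜) = 0 := by
          push_cast
          rw [mul_sub, h3]; ring
        rcases mul_eq_zero.1 h5 with h6 | h6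
        · exact h6
        · exact absurd (hd (by have := RCLike.ofReal_eq_zero.1 h6; linarith)) hij
      rw [h4]; simp
  calc V * realDiag e * Vᴴ = U * ((Uᴴ * V) * realDiag e) * Vᴴ := by
        simp only [← Matrix.mul_assoc, hU2, Matrix.one_mul]
    _ = U * realDiag e * Uᴴ * (V * Vᴴ) := by rw [h2]; simp only [Matrix.mul_assoc]
    _ = _ := by rw [hV2, Matrix.mul_one]

lemma hermMat_conjCoord (u : Matrix (Fin n) (Fin n) 𝕜) (a : HermCoord 𝕜 n) :
    hermMat (conjCoord u a) = u * hermMat a * uᴴ :=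
  hermMat_matCoord (isHermitian_mul_mul_conjTranspose u (hermMat_isHermitian a))

lemma realDiag_isHermitian (d : Fin n → ℝ) :
    (realDiag d : Matrix (Fin n) (Fin n) 𝕜).IsHermitian := by
  simp [realDiag, IsHermitian, diagonal_conjTranspose, Pi.star_def]

lemma hermMat_diagConj (a : HermCoord 𝕜 n) :
    hermMat (diagConj a) = cayley a.2 * realDiag a.1 * (cayley a.2)ᴴ :=
  hermMat_matCoord (isHermitian_mul_mul_conjTranspose _ (realDiag_isHermitian a.1))

lemma hermMat_injective : Function.Injective (hermMat : HermCoord 𝕜 n → _) := fun a b h => by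
  rw [← matCoord_hermMat a, h, matCoord_hermMat]

/-- Coordinates of the self-adjoint matrices that have the entries of some `d ∈ E` as
eigenvalues. -/
def specSet (𝕜 : Type) [RCLike 𝕜] {n : ℕ} (E : Set (Fin n → ℝ)) : Set (HermCoord 𝕜 n) :=
  {a | ∃ d ∈ E, ∃ V ∈ unitaryGroup (Fin n) 𝕜, hermMat a = V * realDiag d * Vᴴ}

lemma diag_conj_perm {V : Matrix (Fin n) (Fin n) 𝕜} (hV : V ∈ unitaryGroup (Fin n) 𝕜)
    (d : Fin n → ℝ) (σ : Equiv.Perm (Fin n)) :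
    ∃ U ∈ unitaryGroup (Fin n) 𝕜, V * realDiag d * Vᴴ = U * realDiag (d ∘ σ) * Uᴴ := by
  have key : ∀ d : Fin n → ℝ, V * realDiag d * Vᴴ =
      V.submatrix id σ * realDiag (d ∘ σ) * (V.submatrix id σ)ᴴ := by
    intro d
    ext i j
    rw [mul_apply, mul_apply]
    simp only [realDiag, LinearMap.coe_mk, AddHom.coe_mk, mul_diagonal,
      conjTranspose_apply, submatrix_apply, id, Function.comp]
    exact (Equiv.sum_comp σ fun k => V i k * (d k : 𝕜) * star (V j k)).symm
  refine ⟨V.submatrix id σ, ?_, key d⟩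
  have h1 : (realDiag (fun _ => 1) : Matrix (Fin n) (Fin n) 𝕜) = 1 := by
    simp [realDiag]
  have := key fun _ => 1
  rw [show ((fun _ => 1 : Fin n → ℝ) ∘ σ) = fun _ => 1 from rfl, h1, Matrix.mul_one,
    Matrix.mul_one] at this
  rw [mem_unitaryGroup_iff]
  exact this.symm.trans (mem_unitaryGroup_iff.1 hV)

/-- The squared Hilbert-Schmidt norm of a self-adjoint matrix, in coordinates. -/
def hsSq (a : HermCoord 𝕜 n) : ℝ := ∑ i, ∑ j, ‖hermMat a i j‖ ^ 2

lemma hsSq_eq_trace (a : HermCoord 𝕜 n) : ((hsSq a : ℝ) : 𝕜) = (hermMat a * hermMat a).trace := by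
  simp only [hsSq, trace, diag_apply, mul_apply]
  push_cast
  refine Finset.sum_congr rfl fun i _ => Finset.sum_congr rfl fun j _ => ?_
  rw [← (hermMat_isHermitian a).apply j i, ← RCLike.mul_conj]
  rfl

lemma hsSq_conj {V : Matrix (Fin n) (Fin n) 𝕜} (hV : V ∈ unitaryGroup (Fin n) 𝕜)
    {a b : HermCoord 𝕜 n} (h : hermMat a = V * hermMat b * Vᴴ) : hsSq a = hsSq b := by
  apply RCLike.ofReal_injective (K := 𝕜)
  have hV1 : Vᴴ * V = 1 := mem_unitaryGroup_iff'.1 hV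
  rw [hsSq_eq_trace, hsSq_eq_trace, h]
  calc (V * hermMat b * Vᴴ * (V * hermMat b * Vᴴ)).trace
      = (V * (hermMat b * (Vᴴ * V) * hermMat b) * Vᴴ).trace := by simp only [Matrix.mul_assoc]
    _ = _ := by rw [hV1, Matrix.mul_one, Matrix.trace_mul_comm, ← Matrix.mul_assoc, hV1,
        Matrix.one_mul]

lemma hsSq_of_diag {V : Matrix (Fin n) (Fin n) 𝕜} (hV : V ∈ unitaryGroup (Fin n) 𝕜)
    {a : HermCoord 𝕜 n} {d : Fin n → ℝ} (h : hermMat a = V * realDiag d * Vᴴ) :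
    hsSq a = ∑ i, d i ^ 2 := by
  have h0 : (realDiag d : Matrix (Fin n) (Fin n) 𝕜) = hermMat (d, 0) := by simp [hermMat]
  rw [h0] at h
  rw [hsSq_conj hV h, hsSq]
  refine Finset.sum_congr rfl fun i _ => ?_
  rw [Finset.sum_eq_single i]
  · rw [hermMat_apply_self]; simp
  · intro j _ hj
    rw [← h0]; simp [realDiag, hj.symm]
  · simp

lemma continuous_hermMat : Continuous (hermMat : HermCoord 𝕜 n → Matrix (Fin n) (Fin n) 𝕜) :=
  continuous_matrix fun i j =>
    ((Matrix.entryLinearMap ℝ 𝕜 i j) ∘ₗ hermMat).continuous_of_finiteDimensional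

lemma continuous_hsSq : Continuous (hsSq : HermCoord 𝕜 n → ℝ) := by
  unfold hsSq
  refine continuous_finsetSum _ fun i _ => continuous_finsetSum _ fun j _ => ?_
  exact ((continuous_hermMat.matrix_elem i j).norm).pow 2

lemma norm_le_sqrt_hsSq (a : HermCoord 𝕜 n) : ‖a‖ ≤ Real.sqrt (hsSq a) := by
  have key : ∀ i j, ‖hermMat a i j‖ ≤ Real.sqrt (hsSq a) := by
    intro i j
    apply Real.le_sqrt_of_sq_le
    rw [hsSq]
    refine le_trans ?_ (Finset.single_le_sum (f := fun i => ∑ j, ‖hermMat a i j‖ ^ 2)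
      (fun i _ => by positivity) (Finset.mem_univ i))
    exact Finset.single_le_sum (f := fun j => ‖hermMat a i j‖ ^ 2)
      (fun i _ => by positivity) (Finset.mem_univ j)
  rw [norm_prod_le_iff, pi_norm_le_iff_of_nonneg (by positivity),
    pi_norm_le_iff_of_nonneg (by positivity)]
  constructor
  · intro i
    have := key i i
    rwa [hermMat_apply_self, RCLike.norm_ofReal] at this
  · intro ij
    have := key ij.1.1 ij.1.2
    rwa [hermMat_apply_lower] at this

end Spectra

/-- The determinant of the Hankel matrix of the traces of powers of `M`. -/
def momDet {R : Type} [CommRing R] {n : ℕ} (M : Matrix (Fin n) (Fin n) R) : R :=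
  (of fun i j : Fin n => (M ^ (i + j : ℕ)).trace).det

lemma momDet_map {R S : Type} [CommRing R] [CommRing S] {n : ℕ} (f : R →+* S)
    (M : Matrix (Fin n) (Fin n) R) : momDet (f.mapMatrix M) = f (momDet M) := by
  rw [momDet, momDet, RingHom.map_det]
  congr 1
  ext i j
  simp only [of_apply, RingHom.mapMatrix_apply, map_apply]
  rw [← RingHom.mapMatrix_apply, ← map_pow, RingHom.mapMatrix_apply]
  simp [trace]

section Ties

variable {𝕜 : Type} [RCLike 𝕜] {n : ℕ}

lemma momDet_smul {R : Type} [CommRing R] (c : R) (M : Matrix (Fin n) (Fin n) R) :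
    momDet (c • M) = (∏ i : Fin n, c ^ (i : ℕ)) * ((∏ i : Fin n, c ^ (i : ℕ)) * momDet M) := by
  rw [momDet, momDet, ← det_mul_column, ← det_mul_row]
  congr 1
  ext i j
  simp only [of_apply, smul_pow, trace_smul, smul_eq_mul]
  rw [pow_add]
  ring

lemma momDet_diag_conj {V : Matrix (Fin n) (Fin n) 𝕜} (hV : V ∈ unitaryGroup (Fin n) 𝕜)
    (d : Fin n → ℝ) :
    momDet (V * realDiag d * Vᴴ) = (vandermonde fun i => (d i : 𝕜)).det ^ 2 := by
  have hV1 : Vᴴ * V = 1 := mem_unitaryGroup_iff'.1 hV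
  have hV2 : V * Vᴴ = 1 := mem_unitaryGroup_iff.1 hV
  have hpow : ∀ k : ℕ, (V * realDiag d * Vᴴ) ^ k = V * realDiag d ^ k * Vᴴ := by
    intro k
    induction k with
    | zero => simp [hV2]
    | succ k ih =>
      rw [pow_succ, ih, pow_succ]
      calc V * realDiag d ^ k * Vᴴ * (V * realDiag d * Vᴴ)
          = V * realDiag d ^ k * (Vᴴ * V) * realDiag d * Vᴴ := by simp only [Matrix.mul_assoc]
        _ = _ := by rw [hV1]; simp only [Matrix.mul_assoc, Matrix.mul_one]
  rw [momDet, sq]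
  nth_rw 1 [← det_transpose (vandermonde _)]
  rw [← det_mul]
  congr 1
  ext i j
  rw [vandermonde_transpose_mul_vandermonde, of_apply, hpow, Matrix.trace_mul_comm,
    ← Matrix.mul_assoc, hV1, Matrix.one_mul]
  simp [realDiag, diagonal_pow, trace]

lemma finite_momDet_eq_zero (A B : Matrix (Fin n) (Fin n) 𝕜) (hB : momDet B ≠ 0) :
    {s : ℝ | momDet (A + s • B) = 0}.Finite := by
  let M : Matrix (Fin n) (Fin n) (Polynomial 𝕜) :=
    B.map Polynomial.C + (Polynomial.X : Polynomial 𝕜) • A.map Polynomial.C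
  have heval : ∀ u : 𝕜, (momDet M).eval u = momDet (B + u • A) := by
    intro u
    rw [← Polynomial.coe_evalRingHom, ← momDet_map]
    congr 1
    ext i j
    simp [M]
    exact mul_comm _ _
  have hne : momDet M ≠ 0 := by
    intro h0
    apply hB
    have := heval 0
    rw [h0] at this
    simpa using this.symm
  have hfin : {u : 𝕜 | (momDet M).IsRoot u}.Finite := Polynomial.finite_setOfPred_isRoot hne
  have hinj : Set.InjOn (fun s : ℝ => ((s⁻¹ : ℝ) : 𝕜)) (Set.univ) := by
    intro s _ t _ h
    exact inv_injective (RCLike.ofReal_injective h)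
  refine ((hfin.preimage (hinj.mono (Set.subset_univ _))).insert 0).subset ?_
  intro s hs
  by_cases h0 : s = 0
  · exact Or.inl h0
  · refine Or.inr ?_
    have hs0 : (s : 𝕜) ≠ 0 := by exact_mod_cast h0
    have h1 : A + s • B = (s : 𝕜) • (B + ((s⁻¹ : ℝ) : 𝕜) • A) := by
      rw [smul_add, smul_smul]
      push_cast
      rw [mul_inv_cancel₀ hs0, one_smul, add_comm, RCLike.real_smul_eq_coe_smul (K := 𝕜)]
    have h2 : momDet (A + s • B) = 0 := hs
    rw [h1, momDet_smul] at h2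
    have h3 : (∏ i : Fin n, (s : 𝕜) ^ (i : ℕ)) ≠ 0 :=
      Finset.prod_ne_zero_iff.2 fun i _ => pow_ne_zero _ hs0
    have h4 : momDet (B + ((s⁻¹ : ℝ) : 𝕜) • A) = 0 := by simpa [h3] using h2
    change Polynomial.eval _ _ = 0
    rw [heval]
    exact h4

lemma measure_zero_of_countable_lines {E : Type*} [NormedAddCommGroup E] [NormedSpace ℝ E]
    [MeasurableSpace E] [BorelSpace E] [SecondCountableTopology E] (μ : Measure E)
    [SFinite μ] [μ.IsAddRightInvariant] {B : Set E} (hB : MeasurableSet B) (e : E)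
    (h : ∀ a, {s : ℝ | a + s • e ∈ B}.Countable) : μ B = 0 := by
  have hm : MeasurableSet ((fun z : ℝ × E => z.2 + z.1 • e) ⁻¹' B) :=
    (by fun_prop : Measurable fun z : ℝ × E => z.2 + z.1 • e) hB
  set ν := (volume : Measure ℝ).restrict (Set.Icc 0 1)
  have h1 := Measure.prod_apply (μ := ν) (ν := μ) hm
  have h2 := Measure.prod_apply_symm (μ := ν) (ν := μ) hm
  have h3 : ∀ s : ℝ, μ (Prod.mk s ⁻¹' ((fun z : ℝ × E => z.2 + z.1 • e) ⁻¹' B)) = μ B := by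
    intro s
    exact measure_preimage_add_right μ (s • e) B
  have h4 : ∀ a : E, ν ((fun s => (s, a)) ⁻¹' ((fun z : ℝ × E => z.2 + z.1 • e) ⁻¹' B)) = 0 := by
    intro a
    exact nonpos_iff_eq_zero.1 ((Measure.restrict_apply_le _ _).trans
      ((h a).measure_zero volume).le)
  rw [h1] at h2
  simp only [h3, h4, lintegral_zero, lintegral_const] at h2
  have h5 : ν Set.univ = 1 := by simp [ν]
  rwa [h5, mul_one] at h2

lemma measure_specSet_not_injective [MeasurableSpace 𝕜] [BorelSpace 𝕜]
    (μ : Measure (HermCoord 𝕜 n)) [μ.IsAddHaarMeasure] :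
    μ (specSet 𝕜 {d : Fin n → ℝ | ¬ Function.Injective d}) = 0 := by
  have hcont : Continuous fun a : HermCoord 𝕜 n => momDet (hermMat a) := by
    unfold momDet
    refine Continuous.matrix_det (continuous_matrix fun i j => ?_)
    exact (continuous_hermMat.pow _).matrix_trace
  refine measure_mono_null (t := {a | momDet (hermMat a) = 0}) ?_ ?_
  · rintro a ⟨d, hd, V, hV, h⟩
    rw [Set.mem_ofPred_eq, h, momDet_diag_conj hV, sq_eq_zero_iff]
    have : ¬ (vandermonde fun i => (d i : 𝕜)).det ≠ 0 := by
      rw [det_vandermonde_ne_zero_iff]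
      intro hinj
      exact hd fun i j hij => hinj (by simp [hij])
    exact not_not.1 this
  · refine measure_zero_of_countable_lines μ (isClosed_singleton.preimage hcont).measurableSet
      ((fun i : Fin n => (i : ℝ)), 0) fun a => ?_
    have h0 : momDet (hermMat (((fun i : Fin n => (i : ℝ)), 0) : HermCoord 𝕜 n)) ≠ 0 := by
      have h1 : hermMat (((fun i : Fin n => (i : ℝ)), 0) : HermCoord 𝕜 n) =
          1 * realDiag (fun i : Fin n => (i : ℝ)) * 1ᴴ := by simp [hermMat]
      rw [h1, momDet_diag_conj (one_mem _)]
      refine pow_ne_zero _ (det_vandermonde_ne_zero_iff.2 ?_)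
      intro i j h
      exact Fin.ext (by simpa using h)
    refine ((finite_momDet_eq_zero (hermMat a) _ h0).subset ?_).countable
    intro s hs
    have hs' : momDet (hermMat (a + s • (((fun i : Fin n => (i : ℝ)), 0) : HermCoord 𝕜 n))) = 0 := hs
    rwa [map_add, map_smul] at hs'

end Ties

section Haar

variable {𝕜 : Type} [RCLike 𝕜] {n : ℕ}

instance compactSpace_unitaryGroup : CompactSpace (unitaryGroup (Fin n) 𝕜) := by
  apply isCompact_iff_compactSpace (s := (unitaryGroup (Fin n) 𝕜 : Set (Matrix (Fin n) (Fin n) 𝕜))).1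
  have h1 : IsCompact (Set.pi Set.univ fun _ : Fin n => Set.pi Set.univ fun _ : Fin n =>
      Metric.closedBall (0 : 𝕜) 1) :=
    isCompact_univ_pi fun _ => isCompact_univ_pi fun _ => isCompact_closedBall _ _
  refine IsCompact.of_isClosed_subset (X := Matrix (Fin n) (Fin n) 𝕜) h1 ?_ ?_
  · have h2 : {A : Matrix (Fin n) (Fin n) 𝕜 | A * star A = 1} = (unitaryGroup (Fin n) 𝕜 : Set _) := by
      ext A
      exact mem_unitaryGroup_iff.symm
    rw [← h2]
    exact isClosed_eq (continuous_id.mul continuous_star) continuous_const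
  · intro A hA i _ j _
    simpa using entry_norm_bound_of_unitary hA i j

lemma conjCoord_comp (u v : Matrix (Fin n) (Fin n) 𝕜) (a : HermCoord 𝕜 n) :
    conjCoord u (conjCoord v a) = conjCoord (u * v) a := by
  apply hermMat_injective
  simp only [hermMat_conjCoord, conjTranspose_mul, Matrix.mul_assoc]

lemma continuous_matCoord :
    Continuous (matCoord : Matrix (Fin n) (Fin n) 𝕜 → HermCoord 𝕜 n) := by
  refine Continuous.prodMk (continuous_pi fun i => ?_) (continuous_pi fun ij => ?_)
  · exact RCLike.continuous_re.comp (continuous_id.matrix_elem i i)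
  · exact continuous_id.matrix_elem _ _

variable [MeasurableSpace 𝕜] [BorelSpace 𝕜]

instance matrix_borelSpace : BorelSpace (Matrix (Fin n) (Fin n) 𝕜) :=
  inferInstanceAs (BorelSpace (Fin n → Fin n → 𝕜))

instance matrix_secondCountableTopology : SecondCountableTopology (Matrix (Fin n) (Fin n) 𝕜) :=
  inferInstanceAs (SecondCountableTopology (Fin n → Fin n → 𝕜))

lemma measurable_hermMat : Measurable (hermMat : HermCoord 𝕜 n → Matrix (Fin n) (Fin n) 𝕜) :=
  continuous_hermMat.measurable

/-- The measure `volume ⊗ Haar` on coordinates. -/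
def coordMeasure (𝕜 : Type) [RCLike 𝕜] [MeasurableSpace 𝕜] [BorelSpace 𝕜] (n : ℕ) :
    Measure (HermCoord 𝕜 n) :=
  (volume : Measure (Fin n → ℝ)).prod Measure.addHaar

instance coordMeasure_isAddHaarMeasure : (coordMeasure 𝕜 n).IsAddHaarMeasure := by
  unfold coordMeasure; exact Measure.prod.instIsAddHaarMeasure _ _

lemma coordMeasure_conj {V : Matrix (Fin n) (Fin n) 𝕜} (hV : V ∈ unitaryGroup (Fin n) 𝕜)
    (S : Set (HermCoord 𝕜 n)) : coordMeasure 𝕜 n (conjCoord V ⁻¹' S) = coordMeasure 𝕜 n S := by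
  set μ := coordMeasure 𝕜 n
  have hV1 : Vᴴ * V = 1 := mem_unitaryGroup_iff'.1 hV
  have hV2 : V * Vᴴ = 1 := mem_unitaryGroup_iff.1 hV
  have hone : ∀ a : HermCoord 𝕜 n, conjCoord 1 a = a := fun a => by
    apply hermMat_injective; simp [hermMat_conjCoord]
  set B : Set (HermCoord 𝕜 n) := {a | hsSq a ≤ 1} with hBdef
  have hpre : conjCoord V ⁻¹' B = B := by
    ext a
    simp only [hBdef, Set.mem_preimage, Set.mem_ofPred_eq, hsSq_conj hV (hermMat_conjCoord V a)]
  have hBbdd : Bornology.IsBounded B := by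
    refine (Metric.isBounded_closedBall (x := (0 : HermCoord 𝕜 n)) (r := 1)).subset ?_
    intro a ha
    rw [mem_closedBall_zero_iff]
    exact (norm_le_sqrt_hsSq a).trans (Real.sqrt_le_one.2 ha)
  have hBtop : μ B ≠ ⊤ := hBbdd.measure_lt_top.ne
  have hB0 : μ B ≠ 0 := by
    have ho : IsOpen {a : HermCoord 𝕜 n | hsSq a < 1} := isOpen_lt continuous_hsSq continuous_const
    have hne : ({a : HermCoord 𝕜 n | hsSq a < 1}).Nonempty := ⟨0, by simp [hsSq]⟩
    have := (ho.measure_pos μ hne).trans_le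
      (measure_mono (t := B) fun a (ha : hsSq a < 1) => ha.le)
    exact this.ne'
  have hdet : LinearMap.det (conjCoord V) ≠ 0 := by
    intro h0
    have h1 : LinearMap.det (conjCoord Vᴴ ∘ₗ conjCoord V) = 1 := by
      have : conjCoord Vᴴ ∘ₗ conjCoord V = LinearMap.id := by
        refine LinearMap.ext fun a => ?_
        rw [LinearMap.comp_apply, conjCoord_comp, hV1, hone]; rfl
      rw [this, LinearMap.det_id]
    rw [LinearMap.det_comp, h0, mul_zero] at h1
    exact zero_ne_one h1
  have hs := fun S => Measure.addHaar_preimage_linearMap μ hdet S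
  have h1 : ENNReal.ofReal |(LinearMap.det (conjCoord V))⁻¹| = 1 := by
    have := hs B
    rw [hpre] at this
    exact (ENNReal.mul_left_inj hB0 hBtop).1 (by rw [← this, one_mul])
  rw [hs S, h1, one_mul]

lemma measure_specSet_lt_top (μ : Measure (HermCoord 𝕜 n)) [μ.IsAddHaarMeasure] {r : ℝ}
    {E : Set (Fin n → ℝ)} (hE : ∀ d ∈ E, ∑ i, d i ^ 2 ≤ r) : μ (specSet 𝕜 E) < ⊤ := by
  refine Bornology.IsBounded.measure_lt_top ?_
  refine (Metric.isBounded_closedBall (x := (0 : HermCoord 𝕜 n)) (r := Real.sqrt r)).subset ?_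
  rintro a ⟨d, hd, V, hV, h⟩
  rw [mem_closedBall_zero_iff]
  refine (norm_le_sqrt_hsSq a).trans (Real.sqrt_le_sqrt ?_)
  rw [hsSq_of_diag hV h]
  exact hE d hd

end Haar

section Weyl

variable {𝕜 : Type} [RCLike 𝕜] {n : ℕ}

/-- The Weyl chamber of strictly increasing vectors. -/
def chamber (n : ℕ) : Set (Fin n → ℝ) := {d | StrictMono d}

lemma isOpen_chamber : IsOpen (chamber n) := by
  have h : chamber n = ⋂ i : Fin n, ⋂ j : Fin n, ⋂ _ : i < j, {d | d i < d j} := by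
    ext d; simp [chamber, StrictMono]
  rw [h]
  exact isOpen_iInter_of_finite fun i => isOpen_iInter_of_finite fun j =>
    isOpen_iInter_of_finite fun _ => isOpen_lt (continuous_apply i) (continuous_apply j)

lemma natCast_mem_chamber : (fun i : Fin n => (i : ℝ)) ∈ chamber n := strictMono_natCast

lemma exists_equiv_hasStrictFDerivAt_diagConj :
    ∃ L : HermCoord 𝕜 n ≃L[ℝ] HermCoord 𝕜 n, HasStrictFDerivAt diagConj
      (L : HermCoord 𝕜 n →L[ℝ] HermCoord 𝕜 n) ((fun i : Fin n => (i : ℝ)), 0) := by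
  obtain ⟨L, hL, -⟩ := hasStrictFDerivAt_diagConj (𝕜 := 𝕜) ((fun i : Fin n => (i : ℝ)), 0)
  have hdet : L.det ≠ 0 := by
    have h := abs_det_fderiv_diagConj (𝕜 := 𝕜) ((fun i : Fin n => (i : ℝ)), 0)
    rw [hL.hasFDerivAt.fderiv] at h
    have h2 : 0 < vand (fun i : Fin n => (i : ℝ)) := vand_pos strictMono_natCast
    have h3 : vand (fun i : Fin n => (i : ℝ)) ^ Module.finrank ℝ 𝕜 *
      cayJac (0 : LowerIdx n → 𝕜) ≠ 0 := mul_ne_zero (pow_pos h2 _).ne' cayJac_zero_ne_zero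
    rw [← h] at h3
    exact abs_ne_zero.1 h3
  exact ⟨L.toContinuousLinearEquivOfDetNeZero hdet, by simpa using hL⟩

lemma exists_isOpen_injOn_diagConj :
    ∃ O : Set (LowerIdx n → 𝕜), IsOpen O ∧ 0 ∈ O ∧
      Set.InjOn (fun x => diagConj ((fun i : Fin n => (i : ℝ)), x)) O := by
  obtain ⟨L, hL⟩ := exists_equiv_hasStrictFDerivAt_diagConj (𝕜 := 𝕜) (n := n)
  let e := hL.toOpenPartialHomeomorph diagConj
  refine ⟨(fun x => ((fun i : Fin n => (i : ℝ)), x)) ⁻¹' e.source,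
    e.open_source.preimage (by fun_prop), hL.mem_toOpenPartialHomeomorph_source, ?_⟩
  intro x hx y hy h
  have := e.injOn hx hy h
  exact (Prod.ext_iff.1 this).2

lemma image_diagConj_mem_nhds {O : Set (LowerIdx n → 𝕜)} (hO : IsOpen O) (h0 : 0 ∈ O) :
    diagConj '' (chamber n ×ˢ O) ∈
      nhds (diagConj (𝕜 := 𝕜) ((fun i : Fin n => (i : ℝ)), 0)) := by
  obtain ⟨L, hL⟩ := exists_equiv_hasStrictFDerivAt_diagConj (𝕜 := 𝕜) (n := n)
  rw [← hL.map_nhds_eq_of_equiv]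
  exact image_mem_map ((isOpen_chamber.prod hO).mem_nhds ⟨natCast_mem_chamber, h0⟩)

lemma injOn_diagConj {O : Set (LowerIdx n → 𝕜)}
    (hO : Set.InjOn (fun x => diagConj ((fun i : Fin n => (i : ℝ)), x)) O) :
    Set.InjOn (diagConj : HermCoord 𝕜 n → HermCoord 𝕜 n) (chamber n ×ˢ O) := by
  rintro ⟨d, x⟩ ⟨hd, hx⟩ ⟨e, y⟩ ⟨he, hy⟩ h
  have h1 := congrArg hermMat h
  rw [hermMat_diagConj, hermMat_diagConj] at h1
  have hde : d = e := eq_of_diag_conj_eq (cayley_mem_unitaryGroup x) (cayley_mem_unitaryGroup y)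
    hd he h1
  subst hde
  have h2 := diag_conj_congr (cayley_mem_unitaryGroup x) (cayley_mem_unitaryGroup y)
    hd.injective h1 (fun i : Fin n => (i : ℝ))
  have h3 : x = y := hO hx hy (hermMat_injective (by
    rw [hermMat_diagConj, hermMat_diagConj]; exact h2))
  rw [h3]

variable [MeasurableSpace 𝕜] [BorelSpace 𝕜]

lemma measurableSet_image_diagConj {O : Set (LowerIdx n → 𝕜)} (hOo : IsOpen O)
    (hO : Set.InjOn (fun x => diagConj ((fun i : Fin n => (i : ℝ)), x)) O)
    {E : Set (Fin n → ℝ)} (hE : MeasurableSet E) (hEW : E ⊆ chamber n) :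
    MeasurableSet (diagConj '' (E ×ˢ O) : Set (HermCoord 𝕜 n)) :=
  (hE.prod hOo.measurableSet).image_of_continuousOn_injOn continuous_diagConj.continuousOn
    ((injOn_diagConj hO).mono (Set.prod_mono hEW subset_rfl))

lemma measure_image_diagConj {O : Set (LowerIdx n → 𝕜)} (hOo : IsOpen O)
    (hO : Set.InjOn (fun x => diagConj ((fun i : Fin n => (i : ℝ)), x)) O)
    {E : Set (Fin n → ℝ)} (hE : MeasurableSet E) (hEW : E ⊆ chamber n) :
    coordMeasure 𝕜 n (diagConj '' (E ×ˢ O)) =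
      (∫⁻ d in E, ENNReal.ofReal (vand d ^ Module.finrank ℝ 𝕜)) *
        ∫⁻ x in O, ENNReal.ofReal (cayJac x) ∂Measure.addHaar := by
  have h := lintegral_abs_det_fderiv_eq_addHaar_image (coordMeasure 𝕜 n)
    (hE.prod hOo.measurableSet) (f := diagConj)
    (f' := fun a => fderiv ℝ diagConj a)
    (fun a _ => by
      obtain ⟨L, hL, -⟩ := hasStrictFDerivAt_diagConj (𝕜 := 𝕜) a
      exact hL.hasFDerivAt.differentiableAt.hasFDerivAt.hasFDerivWithinAt)
    ((injOn_diagConj hO).mono (Set.prod_mono hEW subset_rfl))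
  rw [← h]
  have hv : Continuous fun d : Fin n → ℝ => vand d ^ Module.finrank ℝ 𝕜 := by
    unfold vand; fun_prop
  have hfin : ∀ a : HermCoord 𝕜 n, ENNReal.ofReal |(fderiv ℝ diagConj a).det| =
      ENNReal.ofReal (vand a.1 ^ Module.finrank ℝ 𝕜) * ENNReal.ofReal (cayJac a.2) := fun a => by
    rw [abs_det_fderiv_diagConj, ENNReal.ofReal_mul]
    exact pow_nonneg (Finset.prod_nonneg fun _ _ => abs_nonneg _) _
  simp_rw [hfin]
  rw [coordMeasure, ← Measure.prod_restrict]
  exact lintegral_prod_mul (f := fun d : Fin n → ℝ => ENNReal.ofReal (vand d ^ Module.finrank ℝ 𝕜))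
    (g := fun x : LowerIdx n → 𝕜 => ENNReal.ofReal (cayJac x))
    hv.measurable.ennreal_ofReal.aemeasurable measurable_cayJac.ennreal_ofReal.aemeasurable

/-- The unitaries whose inverse has the same action on diagonal matrices as an element of a
given slice. -/
def sliceSet (O : Set (LowerIdx n → 𝕜)) : Set (unitaryGroup (Fin n) 𝕜) :=
  {V | ∃ x ∈ O, (V⁻¹).1 * realDiag (fun i : Fin n => (i : ℝ)) * ((V⁻¹).1)ᴴ =
    cayley x * realDiag (fun i : Fin n => (i : ℝ)) * (cayley x)ᴴ}

lemma haar_slice {O : Set (LowerIdx n → 𝕜)} {E : Set (Fin n → ℝ)} (hEW : E ⊆ chamber n)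
    (η : Measure (unitaryGroup (Fin n) 𝕜)) [η.IsMulLeftInvariant] (a : HermCoord 𝕜 n) :
    η {V | conjCoord (V⁻¹).1 a ∈ diagConj '' (E ×ˢ O)} =
      (specSet 𝕜 E).indicator (fun _ => η (sliceSet O)) a := by
  classical
  by_cases ha : a ∈ specSet 𝕜 E
  · rw [Set.indicator_of_mem ha]
    obtain ⟨d, hd, V0, hV0, h0⟩ := ha
    rw [← measure_preimage_mul η (⟨V0, hV0⟩ : unitaryGroup (Fin n) 𝕜)⁻¹ (sliceSet O)]
    congr 1
    ext V
    have hVi : (V⁻¹).1 * V0 ∈ unitaryGroup (Fin n) 𝕜 := mul_mem (V⁻¹).2 hV0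
    have hco : (((⟨V0, hV0⟩ : unitaryGroup (Fin n) 𝕜)⁻¹ * V)⁻¹).1 = (V⁻¹).1 * V0 := by
      rw [_root_.mul_inv_rev, inv_inv]; rfl
    rw [Set.mem_preimage, sliceSet, Set.mem_ofPred_eq, Set.mem_ofPred_eq, hco]
    constructor
    · rintro ⟨⟨e, x⟩, ⟨he, hx⟩, hex⟩
      have h1 := congrArg hermMat hex
      rw [hermMat_diagConj, hermMat_conjCoord, h0] at h1
      have h2 : ((V⁻¹).1 * V0) * realDiag d * ((V⁻¹).1 * V0)ᴴ =
          cayley x * realDiag e * (cayley x)ᴴ := by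
        rw [h1, conjTranspose_mul]; simp only [Matrix.mul_assoc]
      have hde : d = e := eq_of_diag_conj_eq hVi (cayley_mem_unitaryGroup x) (hEW hd) (hEW he) h2
      subst hde
      exact ⟨x, hx, diag_conj_congr hVi (cayley_mem_unitaryGroup x) (hEW hd).injective h2 _⟩
    · rintro ⟨x, hx, hex⟩
      refine ⟨(d, x), ⟨hd, hx⟩, hermMat_injective ?_⟩
      rw [hermMat_diagConj, hermMat_conjCoord, h0]
      have h3 := diag_conj_congr hVi (cayley_mem_unitaryGroup x)
        strictMono_natCast.injective hex d
      rw [← h3, conjTranspose_mul]; simp only [Matrix.mul_assoc]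
  · rw [Set.indicator_of_notMem ha]
    convert measure_empty (μ := η)
    rw [Set.eq_empty_iff_forall_notMem]
    rintro V ⟨⟨e, x⟩, ⟨he, hx⟩, hex⟩
    apply ha
    refine ⟨e, he, V.1 * cayley x, mul_mem V.2 (cayley_mem_unitaryGroup x), ?_⟩
    have h1 := congrArg hermMat hex
    rw [hermMat_diagConj, hermMat_conjCoord] at h1
    have hVV : V.1 * (V⁻¹).1 = 1 := by
      rw [← Submonoid.coe_mul, mul_inv_cancel]; rfl
    have hVV' : ((V⁻¹).1)ᴴ * (V.1)ᴴ = 1 := by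
      rw [← conjTranspose_mul, hVV, conjTranspose_one]
    calc hermMat a = (V.1 * (V⁻¹).1) * hermMat a * (((V⁻¹).1)ᴴ * (V.1)ᴴ) := by
          rw [hVV, hVV', Matrix.one_mul, Matrix.mul_one]
      _ = V.1 * ((V⁻¹).1 * hermMat a * ((V⁻¹).1)ᴴ) * (V.1)ᴴ := by simp only [Matrix.mul_assoc]
      _ = _ := by rw [← h1, conjTranspose_mul]; simp only [Matrix.mul_assoc]

lemma measurable_conjCoord_inv :
    Measurable fun z : unitaryGroup (Fin n) 𝕜 × HermCoord 𝕜 n => conjCoord (z.1⁻¹).1 z.2 := by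
  have h : Continuous fun z : unitaryGroup (Fin n) 𝕜 × HermCoord 𝕜 n =>
      matCoord ((z.1⁻¹).1 * hermMat z.2 * ((z.1⁻¹).1)ᴴ) := by
    have h1 : Continuous fun z : unitaryGroup (Fin n) 𝕜 × HermCoord 𝕜 n => (z.1⁻¹).1 :=
      continuous_subtype_val.comp (continuous_inv.comp continuous_fst)
    exact continuous_matCoord.comp
      ((h1.mul (continuous_hermMat.comp continuous_snd)).mul h1.matrix_conjTranspose)
  exact h.measurable

end Weyl

section WeylChamber

variable {𝕜 : Type} [RCLike 𝕜] {n : ℕ} [MeasurableSpace 𝕜] [BorelSpace 𝕜]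

/-- The density of the eigenvalues of a self-adjoint matrix. -/
def vandDens (β : ℕ) {n : ℕ} (d : Fin n → ℝ) : ℝ≥0∞ := ENNReal.ofReal (vand d ^ β)

lemma continuous_vand : Continuous (vand : (Fin n → ℝ) → ℝ) := by
  unfold vand; fun_prop

lemma measurable_vandDens (β : ℕ) : Measurable (vandDens β : (Fin n → ℝ) → ℝ≥0∞) :=
  (continuous_vand.pow β).measurable.ennreal_ofReal

lemma haar_mul_measure_image {O : Set (LowerIdx n → 𝕜)} (hOo : IsOpen O)
    (hO : Set.InjOn (fun x => diagConj ((fun i : Fin n => (i : ℝ)), x)) O)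
    {E : Set (Fin n → ℝ)} (hE : MeasurableSet E) (hEW : E ⊆ chamber n)
    (η : Measure (unitaryGroup (Fin n) 𝕜)) [IsFiniteMeasure η] [η.IsMulLeftInvariant] :
    (Measurable fun a : HermCoord 𝕜 n =>
      (specSet 𝕜 E).indicator (fun _ => η (sliceSet O)) a) ∧
    η Set.univ * coordMeasure 𝕜 n (diagConj '' (E ×ˢ O)) =
      ∫⁻ a, (specSet 𝕜 E).indicator (fun _ => η (sliceSet O)) a ∂coordMeasure 𝕜 n := by
  have hT := measurableSet_image_diagConj hOo hO hE hEW
  have hR : MeasurableSet {z : unitaryGroup (Fin n) 𝕜 × HermCoord 𝕜 n |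
      conjCoord (z.1⁻¹).1 z.2 ∈ diagConj '' (E ×ˢ O)} := measurable_conjCoord_inv hT
  have h1 := Measure.prod_apply (μ := η) (ν := coordMeasure 𝕜 n) hR
  have h2 := Measure.prod_apply_symm (μ := η) (ν := coordMeasure 𝕜 n) hR
  have h3 : ∀ a : HermCoord 𝕜 n, η ((fun V => (V, a)) ⁻¹'
      {z : unitaryGroup (Fin n) 𝕜 × HermCoord 𝕜 n |
        conjCoord (z.1⁻¹).1 z.2 ∈ diagConj '' (E ×ˢ O)}) =
      (specSet 𝕜 E).indicator (fun _ => η (sliceSet O)) a := fun a => haar_slice hEW η a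
  have h4 : ∀ V : unitaryGroup (Fin n) 𝕜, coordMeasure 𝕜 n (Prod.mk V ⁻¹'
      {z : unitaryGroup (Fin n) 𝕜 × HermCoord 𝕜 n |
        conjCoord (z.1⁻¹).1 z.2 ∈ diagConj '' (E ×ˢ O)}) =
      coordMeasure 𝕜 n (diagConj '' (E ×ˢ O)) := fun V =>
    coordMeasure_conj (V⁻¹).2 _
  constructor
  · simp_rw [← h3]
    exact measurable_measure_prodMk_right hR
  · simp_rw [h4] at h1
    simp_rw [h3] at h2
    rw [← h2, h1, lintegral_const, mul_comm]

/-- Weyl integration formula on the chamber, up to the constant. -/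
lemma exists_measure_specSet_chamber (𝕜 : Type) [RCLike 𝕜] [MeasurableSpace 𝕜] [BorelSpace 𝕜]
    (n : ℕ) :
    ∃ C : ℝ≥0∞, C ≠ 0 ∧ C ≠ ⊤ ∧ ∀ E : Set (Fin n → ℝ), MeasurableSet E → E ⊆ chamber n →
      MeasurableSet (specSet 𝕜 E) ∧
      coordMeasure 𝕜 n (specSet 𝕜 E) = C * ∫⁻ d in E, vandDens (Module.finrank ℝ 𝕜) d := by
  obtain ⟨O, hOo, h0, hO⟩ := exists_isOpen_injOn_diagConj (𝕜 := 𝕜) (n := n)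
  let η : Measure (unitaryGroup (Fin n) 𝕜) := Measure.haar
  set J : ℝ≥0∞ := ∫⁻ x in O, ENNReal.ofReal (cayJac x) ∂Measure.addHaar with hJ
  set κ := η (sliceSet O) with hκ
  have hWm : MeasurableSet (chamber n) := isOpen_chamber.measurableSet
  have hηtop : η Set.univ ≠ ⊤ := measure_ne_top _ _
  have hη0 : η Set.univ ≠ 0 := by
    exact (isOpen_univ.measure_pos η Set.univ_nonempty).ne'
  have hκtop : κ ≠ ⊤ := measure_ne_top _ _
  have hTW : coordMeasure 𝕜 n (diagConj '' (chamber n ×ˢ O)) ≠ 0 :=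
    (Measure.measure_pos_of_mem_nhds _ (image_diagConj_mem_nhds hOo h0)).ne'
  have hκ0 : κ ≠ 0 := by
    intro h
    have := (haar_mul_measure_image hOo hO hWm subset_rfl η).2
    rw [← hκ, h] at this
    simp only [Set.indicator_zero, lintegral_zero, mul_eq_zero] at this
    exact this.elim hη0 hTW
  have hJ0 : J ≠ 0 := by
    intro h
    rw [measure_image_diagConj hOo hO hWm subset_rfl, ← hJ, h, mul_zero] at hTW
    exact hTW rfl
  have key : ∀ E : Set (Fin n → ℝ), MeasurableSet E → E ⊆ chamber n →
      MeasurableSet (specSet 𝕜 E) ∧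
      coordMeasure 𝕜 n (specSet 𝕜 E) =
        (η Set.univ * J / κ) * ∫⁻ d in E, vandDens (Module.finrank ℝ 𝕜) d := by
    intro E hE hEW
    obtain ⟨hm, hI⟩ := haar_mul_measure_image hOo hO hE hEW η
    have hms : MeasurableSet (specSet 𝕜 E) := by
      have h : specSet 𝕜 E = {a | (specSet 𝕜 E).indicator (fun _ => η (sliceSet O)) a ≠ 0} := by
        ext a
        simp only [Set.mem_ofPred_eq, ne_eq, Set.indicator_apply_eq_zero, not_forall]
        exact ⟨fun h => ⟨h, hκ0⟩, fun h => h.1⟩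
      rw [h]
      exact hm (measurableSet_singleton (0 : ℝ≥0∞)).compl
    refine ⟨hms, ?_⟩
    rw [lintegral_indicator_const hms, measure_image_diagConj hOo hO hE hEW, ← hκ, ← hJ] at hI
    have h5 : coordMeasure 𝕜 n (specSet 𝕜 E) =
        κ * coordMeasure 𝕜 n (specSet 𝕜 E) / κ := by
      rw [mul_comm, ENNReal.mul_div_cancel_right hκ0 hκtop]
    rw [h5, ← hI]
    simp only [vandDens, div_eq_mul_inv]
    ring
  refine ⟨η Set.univ * J / κ, ?_, ?_, key⟩
  · exact (ENNReal.div_pos (mul_ne_zero hη0 hJ0) hκtop).ne'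
  · intro hC
    set r : ℝ := ∑ i : Fin n, (i : ℝ) ^ 2 + 1
    set E0 : Set (Fin n → ℝ) := chamber n ∩ {d | ∑ i, d i ^ 2 < r}
    have hE0 : IsOpen E0 := isOpen_chamber.inter (isOpen_lt (by fun_prop) continuous_const)
    obtain ⟨-, hk⟩ := key E0 hE0.measurableSet Set.inter_subset_left
    have hfin : coordMeasure 𝕜 n (specSet 𝕜 E0) < ⊤ :=
      measure_specSet_lt_top _ (r := r) fun d hd => le_of_lt hd.2
    have hpos : ∫⁻ d in E0, vandDens (Module.finrank ℝ 𝕜) d ≠ 0 := by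
      rw [← pos_iff_ne_zero, setLIntegral_pos_iff (measurable_vandDens _)]
      have hsub : E0 ⊆ Function.support (vandDens (Module.finrank ℝ 𝕜)) ∩ E0 := fun d hd =>
        ⟨by simpa [vandDens] using pow_pos (vand_pos hd.1) _, hd⟩
      refine lt_of_lt_of_le (hE0.measure_pos volume ⟨_, natCast_mem_chamber, ?_⟩)
        (measure_mono hsub)
      exact lt_add_one (∑ i : Fin n, (i : ℝ) ^ 2)
    rw [hk, hC, ENNReal.top_mul hpos] at hfin
    exact lt_irrefl _ hfin

end WeylChamber

section Symmetrization

lemma vand_eq_prod_ite {n : ℕ} (d : Fin n → ℝ) :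
    vand d = ∏ j, ∏ i, if j < i then |d j - d i| else 1 := by
  rw [vand, ← Finset.prod_subtype (p := fun ij : Fin n × Fin n => ij.2 < ij.1)
    (Finset.univ.filter fun ij : Fin n × Fin n => ij.2 < ij.1) (by simp)
    (fun ij => |d ij.2 - d ij.1|), Finset.prod_filter, Fintype.prod_prod_type, Finset.prod_comm]

lemma vand_nonneg {n : ℕ} (d : Fin n → ℝ) : 0 ≤ vand d :=
  Finset.prod_nonneg fun _ _ => abs_nonneg _

lemma vand_cons {n : ℕ} (x : ℝ) (y : Fin n → ℝ) :
    vand (Fin.cons x y : Fin (n + 1) → ℝ) = (∏ j, |x - y j|) * vand y := by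
  rw [vand_eq_prod_ite, vand_eq_prod_ite, Fin.prod_univ_succ]
  congr 1
  · rw [Fin.prod_univ_succ]; simp
  · refine Finset.prod_congr rfl fun j _ => ?_
    rw [Fin.prod_univ_succ]; simp

lemma vand_eq_abs_det {n : ℕ} (d : Fin n → ℝ) : vand d = |(vandermonde d).det| := by
  rw [vand_eq_prod_ite, det_vandermonde, Finset.abs_prod]
  refine Finset.prod_congr rfl fun j _ => ?_
  rw [Finset.abs_prod, ← Finset.prod_filter]
  refine Finset.prod_congr ?_ fun i _ => abs_sub_comm _ _
  ext i; simp

lemma vand_comp_perm {n : ℕ} (d : Fin n → ℝ) (σ : Equiv.Perm (Fin n)) :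
    vand (d ∘ σ) = vand d := by
  have h : vandermonde (d ∘ σ) = (vandermonde d).submatrix σ id := by
    ext i j; simp [vandermonde]
  rw [vand_eq_abs_det, vand_eq_abs_det, h, det_permute, abs_mul]
  rcases Int.units_eq_one_or (Equiv.Perm.sign σ) with h | h <;> simp [h]

lemma vand_eq_zero {n : ℕ} {d : Fin n → ℝ} (hd : ¬ Function.Injective d) : vand d = 0 := by
  rw [vand_eq_abs_det, abs_eq_zero]
  by_contra h
  exact hd (det_vandermonde_ne_zero_iff.1 h)

lemma measurePreserving_comp_perm {n : ℕ} (σ : Equiv.Perm (Fin n)) :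
    MeasurePreserving (fun d : Fin n → ℝ => d ∘ σ) volume volume := by
  have h := volume_measurePreserving_piCongrLeft (fun _ : Fin n => ℝ) σ.symm
  convert h using 1
  ext d i
  obtain ⟨j, rfl⟩ := σ.symm.surjective i
  rw [MeasurableEquiv.coe_piCongrLeft, Equiv.piCongrLeft_apply_apply]
  simp

lemma exists_perm_strictMono {n : ℕ} {d : Fin n → ℝ} (hd : Function.Injective d) :
    ∃ σ : Equiv.Perm (Fin n), d ∘ σ ∈ chamber n :=
  ⟨Tuple.sort d, (Tuple.monotone_sort d).strictMono_of_injective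
    (hd.comp (Tuple.sort d).injective)⟩

lemma sum_indicator_chamber {n : ℕ} {d : Fin n → ℝ} (hd : Function.Injective d) :
    ∑ σ : Equiv.Perm (Fin n), (chamber n).indicator (fun _ => (1 : ℝ≥0∞)) (d ∘ σ) = 1 := by
  obtain ⟨σ, hσ⟩ := exists_perm_strictMono hd
  rw [Finset.sum_eq_single σ, Set.indicator_of_mem hσ]
  · intro τ _ hτ
    refine Set.indicator_of_notMem (fun h => hτ ?_) _
    have h1 : d ∘ τ = d ∘ σ := by
      refine (StrictMono.range_inj h hσ).1 ?_
      rw [Set.range_comp, Set.range_comp, τ.surjective.range_eq, σ.surjective.range_eq]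
    exact Equiv.ext fun i => hd (congrFun h1 i)
  · simp

lemma lintegral_eq_factorial_mul_chamber {n : ℕ} {F : Set (Fin n → ℝ)} (hF : MeasurableSet F)
    (hperm : ∀ d, ∀ σ : Equiv.Perm (Fin n), d ∘ σ ∈ F ↔ d ∈ F) {β : ℕ} (hβ : β ≠ 0) :
    ∫⁻ d in F, vandDens β d = n.factorial * ∫⁻ d in F ∩ chamber n, vandDens β d := by
  have hW : MeasurableSet (chamber n) := isOpen_chamber.measurableSet
  set g : (Fin n → ℝ) → ℝ≥0∞ := (F ∩ chamber n).indicator (vandDens β) with hg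
  have hgm : Measurable g := (measurable_vandDens β).indicator (hF.inter hW)
  have h1 : ∀ d, F.indicator (vandDens β) d = ∑ σ : Equiv.Perm (Fin n), g (d ∘ σ) := by
    intro d
    have h2 : ∀ σ : Equiv.Perm (Fin n), g (d ∘ σ) = F.indicator (vandDens β) d *
        (chamber n).indicator (fun _ => (1 : ℝ≥0∞)) (d ∘ σ) := by
      intro σ
      have h3 : vandDens β (d ∘ σ) = vandDens β d := by rw [vandDens, vandDens, vand_comp_perm]
      by_cases hd : d ∈ F <;> by_cases hs : d ∘ σ ∈ chamber n <;>
        simp [hg, Set.indicator, hperm, hd, hs, h3]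
    simp_rw [h2, ← Finset.mul_sum]
    by_cases hd : Function.Injective d
    · rw [sum_indicator_chamber hd, mul_one]
    · have : F.indicator (vandDens β) d = 0 := by
        simp [Set.indicator, vandDens, vand_eq_zero hd, hβ]
      rw [this, zero_mul]
  rw [← lintegral_indicator hF, ← lintegral_indicator (hF.inter hW)]
  simp_rw [h1]
  rw [lintegral_finsetSum (f := fun (σ : Equiv.Perm (Fin n)) (d : Fin n → ℝ) => g (d ∘ σ)) _
    fun σ _ => hgm.comp (measurePreserving_comp_perm σ).measurable]
  simp_rw [fun σ : Equiv.Perm (Fin n) => (measurePreserving_comp_perm σ).lintegral_comp hgm]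
  simp [Fintype.card_perm]
  rfl

variable (𝕜 : Type) [RCLike 𝕜] [MeasurableSpace 𝕜] [BorelSpace 𝕜]

/-- Weyl integration formula in coordinates, up to the constant. -/
lemma exists_measure_specSet (n : ℕ) :
    ∃ C : ℝ≥0∞, C ≠ 0 ∧ C ≠ ⊤ ∧ ∀ F : Set (Fin n → ℝ), MeasurableSet F →
      (∀ d, ∀ σ : Equiv.Perm (Fin n), d ∘ σ ∈ F ↔ d ∈ F) →
      coordMeasure 𝕜 n (specSet 𝕜 F) = C * ∫⁻ d in F, vandDens (Module.finrank ℝ 𝕜) d := by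
  obtain ⟨C, hC0, hCt, hC⟩ := exists_measure_specSet_chamber 𝕜 n
  have hf0 : (n.factorial : ℝ≥0∞) ≠ 0 := by exact_mod_cast n.factorial_ne_zero
  have hft : (n.factorial : ℝ≥0∞) ≠ ⊤ := ENNReal.natCast_ne_top _
  refine ⟨C / n.factorial, (ENNReal.div_pos hC0 hft).ne', ENNReal.div_ne_top hCt hf0, ?_⟩
  intro F hF hperm
  have hW : MeasurableSet (chamber n) := isOpen_chamber.measurableSet
  have hβ : Module.finrank ℝ 𝕜 ≠ 0 := (Module.finrank_pos).ne'
  rw [lintegral_eq_factorial_mul_chamber hF hperm hβ, ← mul_assoc,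
    ENNReal.div_mul_cancel hf0 hft, ← (hC _ (hF.inter hW) Set.inter_subset_right).2]
  apply le_antisymm
  · have hsub : specSet 𝕜 F ⊆ specSet 𝕜 (F ∩ chamber n) ∪
        specSet 𝕜 {d : Fin n → ℝ | ¬ Function.Injective d} := by
      rintro a ⟨d, hd, V, hV, h⟩
      by_cases hi : Function.Injective d
      · left
        obtain ⟨σ, hσ⟩ := exists_perm_strictMono hi
        obtain ⟨U, hU, hUV⟩ := diag_conj_perm hV d σ
        exact ⟨d ∘ σ, ⟨(hperm d σ).2 hd, hσ⟩, U, hU, h.trans hUV⟩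
      · exact Or.inr ⟨d, hi, V, hV, h⟩
    refine (measure_mono hsub).trans ((measure_union_le _ _).trans ?_)
    rw [measure_specSet_not_injective, add_zero]
  · refine measure_mono ?_
    rintro a ⟨d, hd, V, hV, h⟩
    exact ⟨d, hd.1, V, hV, h⟩

lemma exists_perm_of_map_eq {n : ℕ} {d e : Fin n → ℝ}
    (h : Multiset.map e Finset.univ.val = Multiset.map d Finset.univ.val) :
    ∃ σ : Equiv.Perm (Fin n), e ∘ σ = d := by
  classical
  have hc : ∀ y : ℝ, Nonempty ({i // d i = y} ≃ {i // e i = y}) := by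
    intro y
    rw [← Fintype.card_eq]
    have h1 := congrArg (Multiset.count y) h
    rw [Multiset.count_map, Multiset.count_map] at h1
    rw [Fintype.card_subtype, Fintype.card_subtype, Finset.card_def, Finset.card_def,
      Finset.filter_val, Finset.filter_val]
    simpa [eq_comm] using h1.symm
  refine ⟨Equiv.ofFiberEquiv fun y => (hc y).some, funext fun i => ?_⟩
  exact Equiv.ofFiberEquiv_map _ i

lemma mem_specSet_iff_eigs {𝕜 : Type} [RCLike 𝕜] {n : ℕ} {F : Set (Fin n → ℝ)}
    (hperm : ∀ d, ∀ σ : Equiv.Perm (Fin n), d ∘ σ ∈ F ↔ d ∈ F) (A : HMat 𝕜 n) :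
    matCoord A.1 ∈ specSet 𝕜 F ↔ eigs A ∈ F := by
  have hA : A.1.IsHermitian := A.2
  set U := (hA.eigenvectorUnitary)
  have h1 : A.1 = U.1 * realDiag (eigs A) * (U.1)ᴴ := by
    have := hA.spectral_theorem
    rw [Unitary.conjStarAlgAut_apply] at this
    exact this
  rw [specSet, Set.mem_ofPred_eq, hermMat_matCoord hA]
  constructor
  · rintro ⟨d, hd, V, hV, h⟩
    have h2 := map_eq_of_diag_conj_eq U.2 hV (h1.symm.trans h)
    obtain ⟨σ, hσ⟩ := exists_perm_of_map_eq h2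
    exact (hperm _ σ).1 (hσ ▸ hd)
  · intro h
    exact ⟨_, h, U.1, U.2, h1⟩

end Symmetrization

section Transfer

variable {𝕜 : Type} [RCLike 𝕜] {n : ℕ}

/-- The coordinates of a self-adjoint matrix. -/
def hermCoordEquiv (𝕜 : Type) [RCLike 𝕜] (n : ℕ) : HMat 𝕜 n ≃ₗ[ℝ] HermCoord 𝕜 n where
  toFun A := matCoord A.1
  map_add' A B := by rw [AddSubgroup.coe_add, map_add]
  map_smul' r A := by rw [selfAdjoint.val_smul, map_smul]; rfl
  invFun a := ⟨hermMat a, hermMat_isHermitian a⟩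
  left_inv A := Subtype.ext (hermMat_matCoord A.2)
  right_inv a := matCoord_hermMat a

variable [MeasurableSpace 𝕜] [BorelSpace 𝕜]

lemma measurable_hermCoordEquiv : Measurable (hermCoordEquiv 𝕜 n) :=
  continuous_matCoord.measurable.comp measurable_subtype_coe

lemma measurable_hermCoordEquiv_symm : Measurable (hermCoordEquiv 𝕜 n).symm :=
  measurable_hermMat.subtype_mk

/-- Weyl integration formula for the image of Lebesgue measure under a linear isomorphism. -/
lemma exists_map_volume_eigs (β : ℕ) (hβ : Module.finrank ℝ 𝕜 = β) {N : ℕ}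
    (T : EuclideanSpace ℝ (Fin N) ≃ₗ[ℝ] HMat 𝕜 n) :
    ∃ C : ℝ≥0∞, C ≠ 0 ∧ C ≠ ⊤ ∧ ∀ F : Set (Fin n → ℝ), MeasurableSet F →
      (∀ d, ∀ σ : Equiv.Perm (Fin n), d ∘ σ ∈ F ↔ d ∈ F) →
      Measure.map T volume {A | eigs A ∈ F} = C * ∫⁻ d in F, vandDens β d := by
  subst hβ
  let Ψ : EuclideanSpace ℝ (Fin N) ≃L[ℝ] HermCoord 𝕜 n :=
    (T.trans (hermCoordEquiv 𝕜 n)).toContinuousLinearEquiv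
  let ΨM := Ψ.toHomeomorph.toMeasurableEquiv
  let TM : EuclideanSpace ℝ (Fin N) ≃ᵐ HMat 𝕜 n := ΨM.trans
    ⟨(hermCoordEquiv 𝕜 n).symm.toEquiv, measurable_hermCoordEquiv_symm, measurable_hermCoordEquiv⟩
  have hTM : ∀ x, TM x = T x := fun x => (hermCoordEquiv 𝕜 n).symm_apply_apply (T x)
  have hTM' : (T : EuclideanSpace ℝ (Fin N) → HMat 𝕜 n) = TM := funext fun x => (hTM x).symm
  obtain ⟨C, hC0, hCt, hC⟩ := exists_measure_specSet 𝕜 n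
  have hH : (Measure.map Ψ (volume : Measure (EuclideanSpace ℝ (Fin N)))).IsAddHaarMeasure :=
    Ψ.isAddHaarMeasure_map _
  set μ' := Measure.map Ψ (volume : Measure (EuclideanSpace ℝ (Fin N))) with hμ'
  set c : ℝ≥0∞ := (Measure.addHaarScalarFactor μ' (coordMeasure 𝕜 n) : ℝ≥0∞)
  have hc0 : c ≠ 0 := by
    simpa [c] using (Measure.addHaarScalarFactor_pos_of_isAddHaarMeasure μ' (coordMeasure 𝕜 n)).ne'
  have hct : c ≠ ⊤ := ENNReal.coe_ne_top
  have hc : μ' = c • coordMeasure 𝕜 n :=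
    Measure.isAddLeftInvariant_eq_smul μ' (coordMeasure 𝕜 n)
  refine ⟨c * C, mul_ne_zero hc0 hC0, ENNReal.mul_ne_top hct hCt, fun F hF hperm => ?_⟩
  rw [hTM', TM.map_apply, mul_assoc, ← hC F hF hperm, ← smul_eq_mul, ← Measure.smul_apply, ← hc]
  have h1 : μ' = Measure.map ΨM volume := rfl
  rw [h1, ΨM.map_apply]
  congr 1
  ext x
  rw [Set.mem_preimage, Set.mem_preimage, Set.mem_ofPred_eq, ← mem_specSet_iff_eigs hperm, hTM]
  rfl

end Transfer

section GasMeasure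

/-- The measure with density `∏_{i<j} |x_i - x_j|^β`. -/
def gas (β n : ℕ) : Measure (Fin n → ℝ) := volume.withDensity (vandDens β)

/-- The dimension of the space of self-adjoint matrices. -/
def gasDim (β n : ℕ) : ℕ := β * (n * (n - 1) / 2) + n

/-- The `ℓ^p` ball, in terms of the `p`-th powers. -/
def lpBall (n : ℕ) (p ρ : ℝ) : Set (Fin n → ℝ) := {x | ∑ i, |x i| ^ p ≤ ρ}

lemma continuous_lpSum {n : ℕ} {p : ℝ} (hp : 0 < p) :
    Continuous fun x : Fin n → ℝ => ∑ i, |x i| ^ p :=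
  continuous_finsetSum _ fun i _ =>
    ((continuous_apply i).abs).rpow_const fun _ => Or.inr hp.le

lemma isClosed_lpBall {n : ℕ} {p : ℝ} (hp : 0 < p) (ρ : ℝ) : IsClosed (lpBall n p ρ) :=
  isClosed_le (continuous_lpSum hp) continuous_const

lemma measurableSet_lpBall {n : ℕ} {p : ℝ} (hp : 0 < p) (ρ : ℝ) : MeasurableSet (lpBall n p ρ) :=
  (isClosed_lpBall hp ρ).measurableSet

lemma abs_rpow_le_of_mem_lpBall {n : ℕ} {p ρ : ℝ} {x : Fin n → ℝ} (hx : x ∈ lpBall n p ρ)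
    (i : Fin n) : |x i| ^ p ≤ ρ :=
  (Finset.single_le_sum (f := fun i => |x i| ^ p)
    (fun i _ => Real.rpow_nonneg (abs_nonneg _) _) (Finset.mem_univ i)).trans hx

lemma card_lowerIdx (n : ℕ) : Fintype.card (LowerIdx n) = n * (n - 1) / 2 := by
  rw [Fintype.card_subtype, ← Finset.sum_range_id, Finset.card_eq_sum_ones, Finset.sum_filter,
    Fintype.sum_prod_type, ← Fin.sum_univ_eq_sum_range (fun i => i) n]
  refine Finset.sum_congr rfl fun i _ => ?_
  rw [← Finset.sum_filter, ← Finset.card_eq_sum_ones]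
  have : (Finset.univ.filter fun j : Fin n => j < i) = Finset.Iio i := by ext; simp
  simp [this]

lemma vand_smul {n : ℕ} {c : ℝ} (hc : 0 ≤ c) (d : Fin n → ℝ) :
    vand (c • d) = c ^ (n * (n - 1) / 2) * vand d := by
  have h : ∀ ij : LowerIdx n, |(c • d) ij.1.2 - (c • d) ij.1.1| = c * |d ij.1.2 - d ij.1.1| := by
    intro ij
    rw [Pi.smul_apply, Pi.smul_apply, smul_eq_mul, smul_eq_mul, ← mul_sub, abs_mul,
      abs_of_nonneg hc]
  unfold vand
  simp_rw [h]
  rw [Finset.prod_mul_distrib, Finset.prod_const, Finset.card_univ, card_lowerIdx]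

lemma vandDens_smul {n : ℕ} (β : ℕ) {c : ℝ} (hc : 0 ≤ c) (d : Fin n → ℝ) :
    vandDens β (c • d) = ENNReal.ofReal (c ^ (β * (n * (n - 1) / 2))) * vandDens β d := by
  rw [vandDens, vand_smul hc, mul_pow, ← pow_mul, mul_comm _ β,
    ENNReal.ofReal_mul (pow_nonneg hc _)]
  rfl

lemma gas_apply {n : ℕ} (β : ℕ) {F : Set (Fin n → ℝ)} (hF : MeasurableSet F) :
    gas β n F = ∫⁻ d in F, vandDens β d := withDensity_apply _ hF

lemma gas_preimage_smul {n : ℕ} (β : ℕ) {c : ℝ} (hc : 0 < c) {F : Set (Fin n → ℝ)}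
    (hF : MeasurableSet F) :
    gas β n F = ENNReal.ofReal (c ^ gasDim β n) * gas β n ((fun x => c • x) ⁻¹' F) := by
  have hm : Measurable fun x : Fin n → ℝ => c • x := measurable_const_smul c
  have h1 := Measure.map_addHaar_smul (volume : Measure (Fin n → ℝ)) hc.ne'
  have h2 : (volume : Measure (Fin n → ℝ)) = ENNReal.ofReal (c ^ n) •
      Measure.map (fun x => c • x) (volume : Measure (Fin n → ℝ)) := by
    rw [h1, smul_smul, Module.finrank_fin_fun, abs_of_pos (by positivity),
      ← ENNReal.ofReal_mul (by positivity), mul_inv_cancel₀ (by positivity), ENNReal.ofReal_one,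
      one_smul]
  rw [gas_apply β hF, gas_apply β (hm hF)]
  conv_lhs => rw [h2]
  rw [Measure.restrict_smul, lintegral_smul_measure, Measure.restrict_map hm hF,
    lintegral_map (measurable_vandDens β) hm]
  simp_rw [vandDens_smul β hc.le]
  rw [lintegral_const_mul _ (measurable_vandDens β), smul_eq_mul, ← mul_assoc,
    ← ENNReal.ofReal_mul (by positivity), ← pow_add, gasDim, add_comm n]

lemma preimage_smul_lpBall {n : ℕ} {p c : ℝ} (hc : 0 < c) (ρ : ℝ) :
    (fun x => c • x) ⁻¹' lpBall n p (c ^ p * ρ) = lpBall n p ρ := by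
  ext x
  have h : ∀ i, |(c • x) i| ^ p = c ^ p * |x i| ^ p := fun i => by
    rw [Pi.smul_apply, smul_eq_mul, abs_mul, abs_of_pos hc,
      Real.mul_rpow hc.le (abs_nonneg _)]
  simp only [lpBall, Set.mem_preimage, Set.mem_ofPred_eq, h, ← Finset.mul_sum]
  exact mul_le_mul_iff_right₀ (Real.rpow_pos_of_pos hc p)

lemma gas_lpBall_scale {n : ℕ} (β : ℕ) {p ρ σ : ℝ} (hp : 0 < p) (hρ : 0 < ρ) (hσ : 0 < σ) :
    gas β n (lpBall n p σ) =
      ENNReal.ofReal ((σ / ρ) ^ ((gasDim β n : ℝ) / p)) * gas β n (lpBall n p ρ) := by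
  have hc : 0 < (σ / ρ) ^ (1 / p) := Real.rpow_pos_of_pos (div_pos hσ hρ) _
  have h1 : ((σ / ρ) ^ (1 / p)) ^ p * ρ = σ := by
    rw [← Real.rpow_mul (div_pos hσ hρ).le, one_div_mul_cancel hp.ne', Real.rpow_one,
      div_mul_cancel₀ _ hρ.ne']
  have h2 := gas_preimage_smul β hc (measurableSet_lpBall (n := n) hp σ)
  have h3 : (fun x => ((σ / ρ) ^ (1 / p)) • x) ⁻¹' lpBall n p σ = lpBall n p ρ := by
    have := preimage_smul_lpBall (n := n) (p := p) hc ρ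
    rwa [h1] at this
  rw [h3] at h2
  rw [h2, ← Real.rpow_natCast, ← Real.rpow_mul (div_pos hσ hρ).le]
  congr 3
  ring

lemma lpBall_subset_Icc {n : ℕ} {p ρ : ℝ} (hp : 0 < p) :
    lpBall n p ρ ⊆ Set.Icc (fun _ => -(ρ ^ (1 / p))) (fun _ => ρ ^ (1 / p)) := by
  intro x hx
  have h : ∀ i, |x i| ≤ ρ ^ (1 / p) := fun i => by
    have h1 := abs_rpow_le_of_mem_lpBall hx i
    calc |x i| = (|x i| ^ p) ^ (1 / p) := by
          rw [← Real.rpow_mul (abs_nonneg _), mul_one_div_cancel hp.ne', Real.rpow_one]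
      _ ≤ _ := Real.rpow_le_rpow (Real.rpow_nonneg (abs_nonneg _) _) h1 (by positivity)
  exact ⟨fun i => (abs_le.1 (h i)).1, fun i => (abs_le.1 (h i)).2⟩

lemma gas_lt_top_of_subset_isCompact {n : ℕ} (β : ℕ) {F K : Set (Fin n → ℝ)} (hFK : F ⊆ K)
    (hK : IsCompact K) : gas β n F < ⊤ := by
  refine (measure_mono hFK).trans_lt ?_
  rw [gas_apply β hK.measurableSet]
  have h := (((continuous_vand (n := n)).pow β).continuousOn (s := K)).integrableOn_compact
    (μ := volume) hK
  exact h.lintegral_lt_top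

lemma gas_lpBall_lt_top {n : ℕ} (β : ℕ) {p : ℝ} (hp : 0 < p) (ρ : ℝ) :
    gas β n (lpBall n p ρ) < ⊤ :=
  gas_lt_top_of_subset_isCompact β (lpBall_subset_Icc hp) isCompact_Icc

lemma gas_lpBall_pos {n : ℕ} (β : ℕ) {p ρ : ℝ} (hp : 0 < p) (hρ : 0 < ρ) :
    0 < gas β n (lpBall n p ρ) := by
  set ρ₀ : ℝ := ∑ i : Fin n, |(i : ℝ)| ^ p + 1
  have hρ₀ : 0 < ρ₀ := by positivity
  rw [gas_lpBall_scale β hp hρ₀ hρ]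
  refine ENNReal.mul_pos (by
    rw [ne_eq, ENNReal.ofReal_eq_zero, not_le]; positivity) (ne_of_gt ?_)
  have ho : IsOpen (chamber n ∩ {x | ∑ i, |x i| ^ p < ρ₀}) :=
    isOpen_chamber.inter (isOpen_lt (continuous_lpSum hp) continuous_const)
  rw [gas_apply β (measurableSet_lpBall hp _), setLIntegral_pos_iff (measurable_vandDens β)]
  refine lt_of_lt_of_le (ho.measure_pos volume ⟨_, natCast_mem_chamber, (lt_add_one _ :
    ∑ i : Fin n, |(i : ℝ)| ^ p < ∑ i : Fin n, |(i : ℝ)| ^ p + 1)⟩)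
    (measure_mono fun d hd => ⟨?_, (le_of_lt hd.2 : ∑ i, |d i| ^ p ≤ ρ₀)⟩)
  simpa [vandDens] using pow_pos (vand_pos hd.1) _

/-- Splitting off one variable. -/
lemma lintegral_gas_succ {n : ℕ} (β : ℕ) {F : (Fin (n + 1) → ℝ) → ℝ≥0∞} (hF : Measurable F) :
    ∫⁻ x, F x ∂gas β (n + 1) =
      ∫⁻ y, (∫⁻ x : ℝ, ENNReal.ofReal ((∏ j, |x - y j|) ^ β) * F (Fin.cons x y)) ∂gas β n := by
  have hmp := (volume_preserving_piFinSuccAbove (fun _ : Fin (n + 1) => ℝ) 0).symm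
  have hcons : ∀ z : ℝ × (Fin n → ℝ), (MeasurableEquiv.piFinSuccAbove
      (fun _ : Fin (n + 1) => ℝ) 0).symm z = Fin.cons z.1 z.2 := fun z => by
    simp [MeasurableEquiv.piFinSuccAbove, Fin.insertNthEquiv]
  have hcm : Measurable fun z : ℝ × (Fin n → ℝ) => (Fin.cons z.1 z.2 : Fin (n + 1) → ℝ) := by
    have := (MeasurableEquiv.piFinSuccAbove (fun _ : Fin (n + 1) => ℝ) 0).symm.measurable
    simpa only [hcons, funext hcons] using this
  have hd : ∀ (x : ℝ) (y : Fin n → ℝ), vandDens β (Fin.cons x y : Fin (n + 1) → ℝ) =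
      vandDens β y * ENNReal.ofReal ((∏ j, |x - y j|) ^ β) := fun x y => by
    rw [vandDens, vand_cons, mul_pow, mul_comm, ENNReal.ofReal_mul (pow_nonneg (vand_nonneg _) _)]
    rfl
  have hprod : Measurable fun z : ℝ × (Fin n → ℝ) =>
      ENNReal.ofReal ((∏ j, |z.1 - z.2 j|) ^ β) * F (Fin.cons z.1 z.2) :=
    (by fun_prop : Measurable fun z : ℝ × (Fin n → ℝ) =>
      ENNReal.ofReal ((∏ j, |z.1 - z.2 j|) ^ β)).mul (hF.comp hcm)
  rw [gas, lintegral_withDensity_eq_lintegral_mul _ (measurable_vandDens β) hF,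
    gas, lintegral_withDensity_eq_lintegral_mul _ (measurable_vandDens β)
      hprod.lintegral_prod_left', ← hmp.lintegral_comp ((measurable_vandDens β).mul hF)]
  rw [Measure.volume_eq_prod]
  refine (lintegral_prod_symm' _ (((measurable_vandDens β).mul hF).comp hmp.measurable)).trans ?_
  refine lintegral_congr fun y => ?_
  refine Eq.trans ?_ (lintegral_const_mul _ (hprod.comp measurable_prodMk_right))
  refine lintegral_congr fun x => ?_
  rw [Function.comp_apply]
  rw [hcons, Pi.mul_apply, hd, mul_assoc]

end GasMeasure

section Slice

lemma ofReal_integral_le_lintegral_ofReal {α : Type*} [MeasurableSpace α] {μ : Measure α}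
    {f : α → ℝ} (hf : Integrable f μ) :
    ENNReal.ofReal (∫ x, f x ∂μ) ≤ ∫⁻ x, ENNReal.ofReal (f x) ∂μ := by
  have h1 : ∫ x, f x ∂μ ≤ ∫ x, max (f x) 0 ∂μ :=
    integral_mono hf hf.pos_part fun x => le_max_left _ _
  refine (ENNReal.ofReal_le_ofReal h1).trans ?_
  rw [ofReal_integral_eq_lintegral_ofReal hf.pos_part
    (Eventually.of_forall fun x => le_max_right _ _)]
  refine lintegral_mono fun x => ?_
  rcases le_total (f x) 0 with h | h
  · simp [max_eq_right h]
  · simp [max_eq_left h]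

/-- Jensen's inequality for the exponential function. -/
lemma ofReal_exp_integral_le {α : Type*} [MeasurableSpace α] {μ : Measure α}
    [IsProbabilityMeasure μ] {f : α → ℝ} (hf : Integrable f μ) :
    ENNReal.ofReal (Real.exp (∫ x, f x ∂μ)) ≤ ∫⁻ x, ENNReal.ofReal (Real.exp (f x)) ∂μ := by
  set m := ∫ x, f x ∂μ
  have hi : Integrable (fun x => Real.exp m * (1 + (f x - m))) μ :=
    ((integrable_const _).add (hf.sub (integrable_const _))).const_mul _
  have h1 : ∫ x, Real.exp m * (1 + (f x - m)) ∂μ = Real.exp m := by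
    have h2 : ∫ x, (1 + (f x - m)) ∂μ = ∫ x, (1 : ℝ) ∂μ + (∫ x, f x ∂μ - ∫ x, m ∂μ) := by
      rw [← integral_sub hf (integrable_const _)]
      exact integral_add (integrable_const _) (hf.sub (integrable_const _))
    rw [integral_const_mul, h2]
    simp [m]
  rw [← h1]
  refine (ofReal_integral_le_lintegral_ofReal hi).trans (lintegral_mono fun x => ?_)
  refine ENNReal.ofReal_le_ofReal ?_
  have h2 := Real.add_one_le_exp (f x - m)
  calc Real.exp m * (1 + (f x - m)) ≤ Real.exp m * Real.exp (f x - m) := by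
        gcongr; linarith
    _ = _ := by rw [← Real.exp_add]; congr 1; ring

/-- The absolute moments of the arcsine law. -/
def cosMoment (p : ℝ) : ℝ := ∫ ψ, |Real.cos ψ| ^ p ∂unifAngle

lemma continuous_abs_cos_rpow {p : ℝ} (hp : 0 < p) : Continuous fun ψ => |Real.cos ψ| ^ p :=
  Real.continuous_cos.abs.rpow_const fun _ => Or.inr hp.le

lemma integrable_unifAngle_of_continuous {f : ℝ → ℝ} (hf : Continuous f) :
    Integrable f unifAngle := integrable_unifAngle (hf.intervalIntegrable _ _)

lemma ae_cos_ne (c : ℝ) : ∀ᵐ ψ ∂unifAngle, Real.cos ψ ≠ c := by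
  suffices h : ∀ᵐ ψ ∂(volume : Measure ℝ), Real.cos ψ ≠ c from
    unifAngle_absolutelyContinuous.ae_le h
  set S : Set ℂ := {⟨c, √(1 - c ^ 2)⟩, ⟨c, -√(1 - c ^ 2)⟩}
  have hS : S.Countable := (Set.toFinite S).countable
  have h0 := (hS.preimage_circleMap 0 one_ne_zero).measure_zero volume
  rw [ae_iff]
  refine measure_mono_null (fun ψ hψ => ?_) h0
  simp only [ne_eq, not_not, Set.mem_ofPred_eq] at hψ
  have h1 : circleMap 0 1 ψ = ⟨Real.cos ψ, Real.sin ψ⟩ := by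
    apply Complex.ext <;> simp [circleMap, Complex.exp_ofReal_mul_I_re, Complex.exp_ofReal_mul_I_im]
  have h2 : |Real.sin ψ| = √(1 - c ^ 2) := by rw [← hψ, Real.abs_sin_eq_sqrt_one_sub_cos_sq]
  simp only [Set.mem_preimage, h1, hψ, S, Set.mem_insert_iff, Set.mem_singleton_iff,
    Complex.mk.injEq, true_and]
  rw [← h2]
  rcases abs_choice (Real.sin ψ) with h | h <;> rw [h] <;> simp

lemma norm_ofReal_sub_ofReal (a b : ℝ) : ‖(a : ℂ) - (b : ℂ)‖ = |a - b| := by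
  rw [← Complex.ofReal_sub, Complex.norm_real, Real.norm_eq_abs]

lemma integrable_log_abs_sub_cos (y : ℝ) {t : ℝ} (ht : 0 < t) :
    Integrable (fun ψ => Real.log |y - t * Real.cos ψ|) unifAngle := by
  simpa only [norm_ofReal_sub_ofReal] using integrable_log_norm_sub_cos (y : ℂ) ht

lemma log_half_le_integral_log_abs_sub_cos (y : ℝ) {t : ℝ} (ht : 0 < t) :
    Real.log (t / 2) ≤ ∫ ψ, Real.log |y - t * Real.cos ψ| ∂unifAngle := by
  simpa only [norm_ofReal_sub_ofReal] using log_half_le_integral_log_norm_sub_cos (y : ℂ) ht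

lemma log_abs_mul_sin (t ψ : ℝ) :
    Real.log |t * Real.sin ψ| =
      2⁻¹ * Real.log (|t - t * Real.cos ψ| * |-t - t * Real.cos ψ|) := by
  have h : |t - t * Real.cos ψ| * |-t - t * Real.cos ψ| = |t * Real.sin ψ| ^ 2 := by
    rw [← abs_mul, sq_abs, ← abs_neg, ← abs_of_nonneg (sq_nonneg (t * Real.sin ψ))]
    congr 1
    rw [mul_pow, Real.sin_sq]
    ring
  rw [h, Real.log_pow]
  push_cast
  ring

lemma ae_log_abs_mul_sin {t : ℝ} (ht : 0 < t) :
    (fun ψ => Real.log |t * Real.sin ψ|) =ᵐ[unifAngle] fun ψ =>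
      2⁻¹ * (Real.log |t - t * Real.cos ψ| + Real.log |-t - t * Real.cos ψ|) := by
  filter_upwards [ae_cos_ne 1, ae_cos_ne (-1)] with ψ h1 h2
  rw [log_abs_mul_sin, Real.log_mul]
  · rw [abs_ne_zero, show t - t * Real.cos ψ = t * (1 - Real.cos ψ) by ring]
    exact mul_ne_zero ht.ne' (sub_ne_zero.2 h1.symm)
  · rw [abs_ne_zero, show -t - t * Real.cos ψ = t * (-1 - Real.cos ψ) by ring]
    exact mul_ne_zero ht.ne' (sub_ne_zero.2 h2.symm)

lemma integrable_log_abs_mul_sin {t : ℝ} (ht : 0 < t) :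
    Integrable (fun ψ => Real.log |t * Real.sin ψ|) unifAngle :=
  (((integrable_log_abs_sub_cos t ht).add (integrable_log_abs_sub_cos (-t) ht)).const_mul
    2⁻¹).congr (ae_log_abs_mul_sin ht).symm

lemma log_half_le_integral_log_abs_mul_sin {t : ℝ} (ht : 0 < t) :
    Real.log (t / 2) ≤ ∫ ψ, Real.log |t * Real.sin ψ| ∂unifAngle := by
  rw [integral_congr_ae (ae_log_abs_mul_sin ht), integral_const_mul, integral_add
    (integrable_log_abs_sub_cos t ht) (integrable_log_abs_sub_cos (-t) ht)]
  linarith [log_half_le_integral_log_abs_sub_cos t ht,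
    log_half_le_integral_log_abs_sub_cos (-t) ht]

lemma pi_mul_lintegral_unifAngle (f : ℝ → ℝ≥0∞) :
    ENNReal.ofReal Real.pi * ∫⁻ ψ, f ψ ∂unifAngle =
      2⁻¹ * ((∫⁻ ψ in Set.Ioo 0 Real.pi, f ψ) +
        ∫⁻ ψ in Set.Ioo Real.pi (2 * Real.pi), f ψ) := by
  have h := Real.pi_pos
  rw [unifAngle, lintegral_smul_measure, smul_eq_mul, ← mul_assoc,
    ← ENNReal.ofReal_mul h.le]
  congr 1
  · rw [show Real.pi * (2 * Real.pi)⁻¹ = 2⁻¹ by field_simp, ENNReal.ofReal_inv_of_pos two_pos]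
    simp
  · rw [← Set.Ioc_union_Ioc_eq_Ioc h.le (by linarith : Real.pi ≤ 2 * Real.pi),
      lintegral_union measurableSet_Ioc (Set.Ioc_disjoint_Ioc_of_le le_rfl)]
    rw [setLIntegral_congr Ioo_ae_eq_Ioc, setLIntegral_congr Ioo_ae_eq_Ioc]

/-- The substitution `x = t cos ψ`. -/
lemma lintegral_Icc_ge_lintegral_cos {t : ℝ} (ht : 0 < t) (g : ℝ → ℝ≥0∞) :
    ENNReal.ofReal Real.pi *
        ∫⁻ ψ, ENNReal.ofReal |t * Real.sin ψ| * g (t * Real.cos ψ) ∂unifAngle ≤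
      ∫⁻ x in Set.Icc (-t) t, g x := by
  have hder : ∀ (s : Set ℝ), ∀ ψ ∈ s,
      HasDerivWithinAt (fun ψ => t * Real.cos ψ) (t * -Real.sin ψ) s ψ := fun s ψ _ =>
    ((Real.hasDerivAt_cos ψ).const_mul t).hasDerivWithinAt
  have hsub : ∀ s : Set ℝ, (fun ψ => t * Real.cos ψ) '' s ⊆ Set.Icc (-t) t := by
    rintro s _ ⟨ψ, -, rfl⟩
    have h1 := Real.neg_one_le_cos ψ
    have h2 := Real.cos_le_one ψ
    constructor <;> dsimp only <;> nlinarith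
  have hpart : ∀ s : Set ℝ, MeasurableSet s → Set.InjOn Real.cos s →
      ∫⁻ ψ in s, ENNReal.ofReal |t * Real.sin ψ| * g (t * Real.cos ψ) ≤
        ∫⁻ x in Set.Icc (-t) t, g x := by
    intro s hs hinj
    have h := lintegral_image_eq_lintegral_abs_deriv_mul hs (hder s)
      (fun a ha b hb hab => hinj ha hb (mul_left_cancel₀ ht.ne' hab)) g
    simp only [mul_neg, abs_neg] at h
    rw [← h]
    exact lintegral_mono_set (hsub s)
  have h1 := hpart (Set.Ioo 0 Real.pi) measurableSet_Ioo
    (Real.injOn_cos.mono Set.Ioo_subset_Icc_self)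
  have h2 := hpart (Set.Ioo Real.pi (2 * Real.pi)) measurableSet_Ioo (by
    intro a ha b hb hab
    have : 2 * Real.pi - a = 2 * Real.pi - b := Real.injOn_cos
      ⟨by linarith [ha.2], by linarith [ha.1]⟩ ⟨by linarith [hb.2], by linarith [hb.1]⟩
      (by rw [Real.cos_two_pi_sub, Real.cos_two_pi_sub, hab])
    linarith)
  rw [pi_mul_lintegral_unifAngle]
  refine (mul_le_mul_right (add_le_add h1 h2) _).trans ?_
  rw [← two_mul, ← mul_assoc, ENNReal.inv_mul_cancel two_ne_zero ofNat_ne_top, one_mul]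

lemma slice_lower {k : ℕ} (β : ℕ) (y : Fin k → ℝ) {p γ t : ℝ} (hp : 0 < p) (ht : 0 < t) :
    ENNReal.ofReal (Real.pi * Real.exp ((1 + β * k) * Real.log (t / 2) -
        γ * (t ^ p * cosMoment p))) ≤
      ∫⁻ x in Set.Icc (-t) t, ENNReal.ofReal ((∏ j, |x - y j|) ^ β * Real.exp (-(γ * |x| ^ p))) := by
  refine le_trans ?_ (lintegral_Icc_ge_lintegral_cos ht _)
  rw [ENNReal.ofReal_mul Real.pi_pos.le]
  gcongr
  set H : ℝ → ℝ := fun ψ => Real.log |t * Real.sin ψ| +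
    β * ∑ j, Real.log |y j - t * Real.cos ψ| - γ * (t ^ p * |Real.cos ψ| ^ p) with hH
  have hc := (integrable_unifAngle_of_continuous (continuous_abs_cos_rpow hp)).const_mul (t ^ p)
  have hs : Integrable (fun ψ => ∑ j, Real.log |y j - t * Real.cos ψ|) unifAngle :=
    integrable_finsetSum _ fun j _ => integrable_log_abs_sub_cos (y j) ht
  have h1 : Integrable (fun ψ => Real.log |t * Real.sin ψ| +
    β * ∑ j, Real.log |y j - t * Real.cos ψ|) unifAngle :=
    (integrable_log_abs_mul_sin ht).add (hs.const_mul _)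
  have hHi : Integrable H unifAngle := h1.sub (hc.const_mul γ)
  have hInt : (1 + β * k) * Real.log (t / 2) - γ * (t ^ p * cosMoment p) ≤
      ∫ ψ, H ψ ∂unifAngle := by
    rw [hH, integral_sub h1 (hc.const_mul γ), integral_add (integrable_log_abs_mul_sin ht)
      (hs.const_mul _), integral_const_mul, integral_const_mul, integral_const_mul,
      integral_finsetSum _ fun j _ => integrable_log_abs_sub_cos (y j) ht]
    have h2 : (k : ℝ) * Real.log (t / 2) ≤
        ∑ j, ∫ ψ, Real.log |y j - t * Real.cos ψ| ∂unifAngle := by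
      have := Finset.sum_le_sum fun (j : Fin k) (_ : j ∈ Finset.univ) =>
        log_half_le_integral_log_abs_sub_cos (y j) ht
      simpa using this
    have h3 := mul_le_mul_of_nonneg_left h2 (Nat.cast_nonneg (α := ℝ) β)
    have h4 := log_half_le_integral_log_abs_mul_sin ht
    rw [cosMoment]
    linarith
  refine (ENNReal.ofReal_le_ofReal (Real.exp_le_exp.2 hInt)).trans
    ((ofReal_exp_integral_le hHi).trans (lintegral_mono_ae ?_))
  have hy : ∀ᵐ ψ ∂unifAngle, ∀ j, Real.cos ψ ≠ y j / t := ae_all_iff.2 fun j => ae_cos_ne _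
  filter_upwards [hy, ae_cos_ne 1, ae_cos_ne (-1)] with ψ h0 h1 h2
  rw [← ENNReal.ofReal_mul (abs_nonneg _)]
  refine ENNReal.ofReal_le_ofReal (le_of_eq ?_)
  have hsin : 0 < |t * Real.sin ψ| := by
    rw [abs_pos]
    refine mul_ne_zero ht.ne' fun h => ?_
    rcases Real.sin_eq_zero_iff_cos_eq.1 h with h | h
    exacts [h1 h, h2 h]
  have hyj : ∀ j, 0 < |y j - t * Real.cos ψ| := fun j => by
    rw [abs_pos, sub_ne_zero]
    intro h
    exact h0 j (by rw [h]; field_simp)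
  have hab : |t * Real.cos ψ| ^ p = t ^ p * |Real.cos ψ| ^ p := by
    rw [abs_mul, abs_of_pos ht, Real.mul_rpow ht.le (abs_nonneg _)]
  simp only [hH]
  rw [sub_eq_add_neg, Real.exp_add, Real.exp_add, Real.exp_log hsin, Real.exp_nat_mul,
    Real.exp_sum, hab, mul_assoc]
  have hexp : ∀ j, Real.exp (Real.log |y j - t * Real.cos ψ|) = |t * Real.cos ψ - y j| := fun j => by
    rw [Real.exp_log (hyj j), abs_sub_comm]
  simp only [hexp]

end Slice

section PartitionFunction

lemma measurable_lpExp {n : ℕ} {p : ℝ} (hp : 0 < p) (γ : ℝ) :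
    Measurable fun x : Fin n → ℝ => ENNReal.ofReal (Real.exp (-(γ * ∑ i, |x i| ^ p))) :=
  (Real.continuous_exp.comp
    (continuous_const.mul (continuous_lpSum hp)).neg).measurable.ennreal_ofReal

lemma gas_zero (β : ℕ) : gas β 0 = Measure.dirac 0 := by
  have h : vandDens β (n := 0) = 1 := by
    funext d
    have : IsEmpty (LowerIdx 0) := ⟨fun ij => ij.1.1.elim0⟩
    simp [vandDens, vand]
  rw [gas, h, withDensity_one, Measure.volume_pi_eq_dirac]
  congr 1
  exact Subsingleton.elim _ _

lemma partition_lower {p γ : ℝ} (hp : 0 < p) (β n : ℕ) {t : ℕ → ℝ} (ht : ∀ k, 0 < t k) :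
    ENNReal.ofReal (∏ k ∈ Finset.range n, (Real.pi *
        Real.exp ((1 + β * k) * Real.log (t k / 2) - γ * (t k ^ p * cosMoment p)))) ≤
      ∫⁻ x, ENNReal.ofReal (Real.exp (-(γ * ∑ i, |x i| ^ p))) ∂gas β n := by
  induction n with
  | zero => simp [gas_zero]
  | succ n ih =>
    rw [lintegral_gas_succ β (measurable_lpExp hp γ), Finset.prod_range_succ,
      ENNReal.ofReal_mul (Finset.prod_nonneg fun k _ => by positivity), mul_comm]
    refine (mul_le_mul_right ih _).trans ?_
    rw [← lintegral_const_mul _ (measurable_lpExp hp γ)]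
    refine lintegral_mono fun y => ?_
    refine (mul_le_mul_left (slice_lower β y hp (ht n)) _).trans ?_
    rw [← lintegral_mul_const' _ _ ENNReal.ofReal_ne_top]
    refine (setLIntegral_le_lintegral _ _).trans (lintegral_mono fun x => le_of_eq ?_)
    dsimp only
    rw [← ENNReal.ofReal_mul (by positivity), ← ENNReal.ofReal_mul (by positivity), mul_assoc,
      ← Real.exp_add, Fin.sum_univ_succ]
    simp only [Fin.cons_zero, Fin.cons_succ]
    congr 3
    ring

lemma partition_term_le {u η z : ℝ} (hu : 0 < u) (hη : η < 1) (hz : 0 ≤ z) :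
    u ^ z * Real.exp (-(z * u)) ≤
      Real.exp (-(z * (1 + Real.log (1 - η)))) * Real.exp (-(η * (z * u))) := by
  have h1 : Real.log ((1 - η) * u) ≤ (1 - η) * u - 1 :=
    Real.log_le_sub_one_of_pos (mul_pos (by linarith) hu)
  rw [Real.log_mul (by linarith) hu.ne'] at h1
  rw [Real.rpow_def_of_pos hu, ← Real.exp_add, ← Real.exp_add, Real.exp_le_exp]
  nlinarith [mul_le_mul_of_nonneg_left h1 hz]

/-- The partition function is controlled by the volume of the ball of critical radius. -/
lemma partition_upper {p ρ η : ℝ} (hp : 0 < p) (hρ : 0 < ρ) (hη0 : 0 < η) (hη1 : η < 1)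
    {β n : ℕ} (hn : 0 < n) :
    ∫⁻ x, ENNReal.ofReal (Real.exp (-((gasDim β n : ℝ) / p / ρ * ∑ i, |x i| ^ p))) ∂gas β n ≤
      ENNReal.ofReal (Real.exp 1 / η *
        Real.exp (-((gasDim β n : ℝ) / p * (1 + Real.log (1 - η))))) *
        gas β n (lpBall n p ρ) := by
  set z : ℝ := (gasDim β n : ℝ) / p with hz
  have hN : 0 < gasDim β n := by unfold gasDim; omega
  have hz0 : 0 < z := div_pos (by exact_mod_cast hN) hp
  set δ : ℝ := ρ / z with hδ
  have hδ0 : 0 < δ := div_pos hρ hz0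
  have hpt : ∀ x : Fin n → ℝ, ENNReal.ofReal (Real.exp (-(z / ρ * ∑ i, |x i| ^ p))) ≤
      ∑' j : ℕ, (lpBall n p (δ * (j + 1))).indicator
        (fun _ => ENNReal.ofReal (Real.exp (-(j : ℝ)))) x := by
    intro x
    set S := ∑ i, |x i| ^ p with hS
    have hS0 : 0 ≤ S := Finset.sum_nonneg fun i _ => Real.rpow_nonneg (abs_nonneg _) _
    set j := ⌊S / δ⌋₊
    have hj1 : (j : ℝ) ≤ S / δ := Nat.floor_le (by positivity)
    have hj2 : S / δ < j + 1 := Nat.lt_floor_add_one _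
    refine le_trans ?_ (ENNReal.le_tsum j)
    rw [Set.indicator_of_mem]
    · refine ENNReal.ofReal_le_ofReal (Real.exp_le_exp.2 (neg_le_neg ?_))
      calc (j : ℝ) ≤ S / δ := hj1
        _ = z / ρ * S := by rw [hδ]; field_simp
    · change S ≤ _
      rw [div_lt_iff₀ hδ0] at hj2
      linarith
  refine (lintegral_mono hpt).trans ?_
  rw [lintegral_tsum fun j => ((measurable_const).indicator
    (measurableSet_lpBall hp _)).aemeasurable]
  have hterm : ∀ j : ℕ, ∫⁻ x, (lpBall n p (δ * (j + 1))).indicator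
        (fun _ => ENNReal.ofReal (Real.exp (-(j : ℝ)))) x ∂gas β n ≤
      ENNReal.ofReal (Real.exp 1 * Real.exp (-(z * (1 + Real.log (1 - η)))) *
        Real.exp (-η) ^ (j + 1)) * gas β n (lpBall n p ρ) := by
    intro j
    have hσ : 0 < δ * (j + 1) := by positivity
    rw [lintegral_indicator_const (measurableSet_lpBall hp _), gas_lpBall_scale β hp hρ hσ,
      ← mul_assoc, ← ENNReal.ofReal_mul (by positivity)]
    refine mul_le_mul_left (ENNReal.ofReal_le_ofReal ?_) _
    have h1 := partition_term_le (u := δ * (j + 1) / ρ) (by positivity) hη1 hz0.le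
    have h2 : z * (δ * (j + 1) / ρ) = j + 1 := by rw [hδ]; field_simp
    rw [h2] at h1
    have h3 : Real.exp (-(j : ℝ)) = Real.exp 1 * Real.exp (-((j : ℝ) + 1)) := by
      rw [← Real.exp_add]; congr 1; ring
    have h4 : Real.exp (-η) ^ (j + 1) = Real.exp (-(η * ((j : ℝ) + 1))) := by
      rw [← Real.exp_nat_mul]; congr 1; push_cast; ring
    rw [h3, h4, mul_assoc, mul_assoc, mul_comm (Real.exp _) (_ ^ _)]
    gcongr
  refine (ENNReal.tsum_le_tsum hterm).trans ?_
  rw [ENNReal.tsum_mul_right]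
  refine mul_le_mul_left ?_ _
  have hr : Real.exp (-η) < 1 := by
    rw [← Real.exp_zero, Real.exp_lt_exp]; linarith
  have hs := ((hasSum_geometric_of_lt_one (Real.exp_pos (-η)).le hr).mul_left
    (Real.exp 1 * Real.exp (-(z * (1 + Real.log (1 - η)))) * Real.exp (-η)))
  have hs' : ∀ j : ℕ, Real.exp 1 * Real.exp (-(z * (1 + Real.log (1 - η)))) * Real.exp (-η) ^ (j + 1)
      = Real.exp 1 * Real.exp (-(z * (1 + Real.log (1 - η)))) * Real.exp (-η) *
        Real.exp (-η) ^ j := fun j => by ring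
  simp_rw [hs']
  rw [← ENNReal.ofReal_tsum_of_nonneg (fun j => by positivity) hs.summable, hs.tsum_eq]
  refine ENNReal.ofReal_le_ofReal ?_
  have h5 : Real.exp (-η) * (1 - Real.exp (-η))⁻¹ ≤ 1 / η := by
    rw [← div_eq_mul_inv, div_le_div_iff₀ (by linarith) hη0]
    have h6 := Real.add_one_le_exp η
    have h7 : Real.exp (-η) * Real.exp η = 1 := by rw [← Real.exp_add]; simp
    nlinarith [Real.exp_pos (-η)]
  calc _ = Real.exp 1 * Real.exp (-(z * (1 + Real.log (1 - η)))) *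
        (Real.exp (-η) * (1 - Real.exp (-η))⁻¹) := by ring
    _ ≤ Real.exp 1 * Real.exp (-(z * (1 + Real.log (1 - η)))) * (1 / η) := by gcongr
    _ = _ := by ring

lemma sum_mul_log_lower (n : ℕ) :
    (n : ℝ) ^ 2 / 2 * Real.log n - (n : ℝ) ^ 2 / 4 ≤
      ∑ k ∈ Finset.range n, ((k : ℝ) + 1) * Real.log (k + 1) := by
  induction n with
  | zero => simp
  | succ n ih =>
    rw [Finset.sum_range_succ]
    refine le_trans ?_ (add_le_add_left ih _)
    push_cast
    rcases Nat.eq_zero_or_pos n with rfl | hn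
    · norm_num
    have hn' : (0 : ℝ) < n := by exact_mod_cast hn
    have h1 : Real.log (n + 1) - Real.log n ≤ 1 / n := by
      rw [← Real.log_div (by positivity) hn'.ne']
      have := Real.log_le_sub_one_of_pos (x := ((n : ℝ) + 1) / n) (by positivity)
      calc _ ≤ _ := this
        _ = 1 / (n : ℝ) := by field_simp; ring
    have h2 : (n : ℝ) ^ 2 * (Real.log (n + 1) - Real.log n) ≤ n := by
      calc _ ≤ (n : ℝ) ^ 2 * (1 / n) := by gcongr
        _ = n := by field_simp
    have h3 : 0 ≤ Real.log ((n : ℝ) + 1) := Real.log_nonneg (by linarith)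
    nlinarith

end PartitionFunction

section VolumeLower

/-- The volume of an `ℓ^p` ball for the gas measure, as a real number. -/
def gasVol (β n : ℕ) (p ρ : ℝ) : ℝ := (gas β n (lpBall n p ρ)).toReal

lemma ofReal_gasVol (β n : ℕ) {p : ℝ} (hp : 0 < p) (ρ : ℝ) :
    ENNReal.ofReal (gasVol β n p ρ) = gas β n (lpBall n p ρ) :=
  ENNReal.ofReal_toReal (gas_lpBall_lt_top β hp ρ).ne

lemma gasVol_pos (β n : ℕ) {p ρ : ℝ} (hp : 0 < p) (hρ : 0 < ρ) : 0 < gasVol β n p ρ :=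
  ENNReal.toReal_pos (gas_lpBall_pos β hp hρ).ne' (gas_lpBall_lt_top β hp ρ).ne

lemma gasVol_scale (β n : ℕ) {p ρ σ : ℝ} (hp : 0 < p) (hρ : 0 < ρ) (hσ : 0 < σ) :
    gasVol β n p σ = (σ / ρ) ^ ((gasDim β n : ℝ) / p) * gasVol β n p ρ := by
  rw [gasVol, gas_lpBall_scale β hp hρ hσ, ENNReal.toReal_mul, ENNReal.toReal_ofReal (by positivity)]
  rfl

lemma cosMoment_pos {p : ℝ} (hp : 0 < p) : 0 < cosMoment p := by
  rw [cosMoment, integral_pos_iff_support_of_nonneg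
    (fun ψ => Real.rpow_nonneg (abs_nonneg _) _)
    (integrable_unifAngle_of_continuous (continuous_abs_cos_rpow hp))]
  have h : unifAngle {ψ | Real.cos ψ = 0} = 0 := by
    have := ae_iff.1 (ae_cos_ne 0)
    simpa using this
  have h1 : unifAngle {ψ | Real.cos ψ = 0}ᶜ = 1 := by
    exact (prob_compl_eq_one_iff
      ((isClosed_singleton (x := (0 : ℝ))).preimage Real.continuous_cos).measurableSet).2 h
  have h2 : {ψ | Real.cos ψ = 0}ᶜ ⊆ Function.support fun ψ => |Real.cos ψ| ^ p := fun ψ hψ =>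
    (Real.rpow_pos_of_pos (abs_pos.2 hψ) p).ne'
  exact lt_of_lt_of_le (by rw [h1]; exact one_pos) (measure_mono h2)

lemma gasDim_eq_sum (β n : ℕ) : (gasDim β n : ℝ) = ∑ k ∈ Finset.range n, (1 + β * (k : ℝ)) := by
  rw [gasDim, ← Finset.sum_range_id, Finset.sum_add_distrib, ← Finset.mul_sum]
  simp [add_comm]

lemma gasDim_succ (β n : ℕ) : (gasDim β (n + 1) : ℝ) = gasDim β n + (1 + β * n) := by
  rw [gasDim_eq_sum, gasDim_eq_sum, Finset.sum_range_succ]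

lemma gasDim_eq (β n : ℕ) : (gasDim β n : ℝ) = β * n * (n - 1) / 2 + n := by
  induction n with
  | zero => simp [gasDim]
  | succ n ih => rw [gasDim_succ, ih]; push_cast; ring

lemma sum_succ_eq (n : ℕ) : ∑ k ∈ Finset.range n, ((k : ℝ) + 1) = n * (n + 1) / 2 := by
  induction n with
  | zero => simp
  | succ n ih => rw [Finset.sum_range_succ, ih]; push_cast; ring

lemma sum_mul_log_div_lower {β n : ℕ} (hβ : 1 ≤ β) (hn : 0 < n) :
    -(β * (n : ℝ) ^ 2 / 4) - β * n / 2 * Real.log n ≤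
      ∑ k ∈ Finset.range n, (1 + β * (k : ℝ)) * Real.log ((k + 1) / n) := by
  have hn' : (0 : ℝ) < n := by exact_mod_cast hn
  have hβ' : (1 : ℝ) ≤ β := by exact_mod_cast hβ
  have h1 : ∑ k ∈ Finset.range n, β * (((k : ℝ) + 1) * Real.log (k + 1) -
      ((k : ℝ) + 1) * Real.log n) ≤
      ∑ k ∈ Finset.range n, (1 + β * (k : ℝ)) * Real.log ((k + 1) / n) := by
    refine Finset.sum_le_sum fun k hk => ?_
    have hk' : (k : ℝ) + 1 ≤ n := by exact_mod_cast Finset.mem_range.1 hk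
    have hl : Real.log ((k + 1) / n) ≤ 0 :=
      Real.log_nonpos (by positivity) ((div_le_one hn').2 hk')
    rw [Real.log_div (by positivity) hn'.ne'] at hl ⊢
    nlinarith
  refine le_trans ?_ h1
  rw [← Finset.mul_sum, Finset.sum_sub_distrib, ← Finset.sum_mul, sum_succ_eq]
  nlinarith [sum_mul_log_lower n]

/-- The critical radius, in terms of the `p`-th powers. -/
def critRad (p : ℝ) (n : ℕ) : ℝ := cosMoment p / 2 * n

lemma critRad_pos {p : ℝ} (hp : 0 < p) {n : ℕ} (hn : 0 < n) : 0 < critRad p n := by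
  have := cosMoment_pos hp
  unfold critRad
  positivity

lemma log_gasVol_lower {p : ℝ} (hp : 0 < p) {β n : ℕ} (hβ : 1 ≤ β) (hn : 0 < n) :
    -(β * (n : ℝ) ^ 2 / (4 * p)) - β * n / (2 * p) * Real.log n - gasDim β n * Real.log 2
        - 2 * gasDim β n / (p * n) - 1 - Real.log (n + 1) ≤
      Real.log (gasVol β n p (critRad p n)) := by
  have hn' : (0 : ℝ) < n := by exact_mod_cast hn
  have hc := cosMoment_pos hp
  have hρ := critRad_pos hp hn
  have hV := gasVol_pos β n hp hρ
  have hN : (0 : ℝ) ≤ gasDim β n := Nat.cast_nonneg _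
  set z : ℝ := (gasDim β n : ℝ) / p with hz
  have hz0 : 0 ≤ z := by positivity
  set η : ℝ := 1 / ((n : ℝ) + 1) with hη
  have hη0 : 0 < η := by positivity
  have hη1 : η < 1 := by rw [hη, div_lt_one (by positivity)]; linarith
  have hlogη : -(1 / (n : ℝ)) ≤ Real.log (1 - η) := by
    have h1 : 1 - η = (((n : ℝ) + 1) / n)⁻¹ := by rw [hη]; field_simp; ring
    rw [h1, Real.log_inv, neg_le_neg_iff]
    refine (Real.log_le_sub_one_of_pos (by positivity)).trans (le_of_eq ?_)
    field_simp; ring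
  set t : ℕ → ℝ := fun k => (((k : ℝ) + 1) / n) ^ (1 / p) with ht
  have ht0 : ∀ k, 0 < t k := fun k => by positivity
  have htp : ∀ k, t k ^ p = ((k : ℝ) + 1) / n := fun k => by
    rw [ht, ← Real.rpow_mul (by positivity), one_div_mul_cancel hp.ne', Real.rpow_one]
  have hlt : ∀ k, Real.log (t k / 2) = 1 / p * Real.log (((k : ℝ) + 1) / n) - Real.log 2 :=
    fun k => by rw [Real.log_div (ht0 k).ne' two_ne_zero, ht, Real.log_rpow (by positivity)]
  set γ : ℝ := z / critRad p n with hγ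
  have h1 := (partition_lower (γ := γ) hp β n ht0).trans (partition_upper hp hρ hη0 hη1 hn)
  rw [← ofReal_gasVol β n hp, ← ENNReal.ofReal_mul (by positivity),
    ENNReal.ofReal_le_ofReal_iff (by positivity)] at h1
  have h2 := Real.log_le_log (Finset.prod_pos fun k _ => by positivity) h1
  rw [Real.log_mul (by positivity) hV.ne', Real.log_mul (by positivity) (by positivity),
    Real.log_exp, Real.log_div (by positivity) hη0.ne', Real.log_exp,
    Real.log_prod (fun k _ => by positivity)] at h2
  have h3 : ∀ k ∈ Finset.range n, Real.log (Real.pi *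
      Real.exp ((1 + β * k) * Real.log (t k / 2) - γ * (t k ^ p * cosMoment p))) =
      Real.log Real.pi + (1 / p * ((1 + β * k) * Real.log (((k : ℝ) + 1) / n)) -
        (1 + β * k) * Real.log 2 - γ * cosMoment p / n * (k + 1)) := fun k _ => by
    rw [Real.log_mul (by positivity) (by positivity), Real.log_exp, hlt, htp]
    ring
  rw [Finset.sum_congr rfl h3, Finset.sum_add_distrib, Finset.sum_sub_distrib,
    Finset.sum_sub_distrib, ← Finset.mul_sum, ← Finset.sum_mul, ← Finset.mul_sum, sum_succ_eq,
    ← gasDim_eq_sum, Finset.sum_const, Finset.card_range, nsmul_eq_mul] at h2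
  have h4 : γ * cosMoment p / n * (n * (n + 1) / 2) = z + z / n := by
    rw [hγ, critRad]; field_simp
  have h5 : Real.log η = -Real.log (n + 1) := by rw [hη, one_div, Real.log_inv]
  have h6 : 0 ≤ n * Real.log Real.pi :=
    mul_nonneg hn'.le (Real.log_nonneg (by linarith [Real.pi_gt_three]))
  have h7 := mul_le_mul_of_nonneg_left (sum_mul_log_div_lower hβ hn)
    (one_div_pos.2 hp).le
  have h8 := mul_le_mul_of_nonneg_left hlogη hz0
  have h9 : 2 * (gasDim β n : ℝ) / (p * n) = z / n + z * (1 / n) := by rw [hz]; field_simp; ring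
  have h10 : 1 / p * (-(β * (n : ℝ) ^ 2 / 4) - β * n / 2 * Real.log n) =
      -(β * (n : ℝ) ^ 2 / (4 * p)) - β * n / (2 * p) * Real.log n := by field_simp
  rw [h10] at h7
  rw [h4, h5] at h2
  rw [h9]
  linarith

end VolumeLower

section Outliers

instance gas_sFinite (β n : ℕ) : SFinite (gas β n) := by
  unfold gas vandDens
  infer_instance

lemma gas_preimage_comp_perm {n : ℕ} (β : ℕ) (σ : Equiv.Perm (Fin n)) {A : Set (Fin n → ℝ)}
    (hA : MeasurableSet A) : gas β n ((fun d => d ∘ σ) ⁻¹' A) = gas β n A := by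
  have hσ := measurePreserving_comp_perm (n := n) σ
  rw [gas_apply β hA, gas_apply β (hσ.measurable hA),
    ← hσ.setLIntegral_comp_preimage hA (measurable_vandDens β)]
  simp only [vandDens, vand_comp_perm]

lemma gas_lpBall_le_exp {n : ℕ} (β : ℕ) {p ρ : ℝ} (hp : 0 < p) (hρ : 0 < ρ) (σ : ℝ) :
    gas β n (lpBall n p σ) ≤
      ENNReal.ofReal (Real.exp ((σ / ρ - 1) * ((gasDim β n : ℝ) / p))) *
        gas β n (lpBall n p ρ) := by
  have h1 : σ ≤ ρ * Real.exp (σ / ρ - 1) := by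
    have := Real.add_one_le_exp (σ / ρ - 1)
    calc σ = ρ * (σ / ρ - 1 + 1) := by field_simp; ring
      _ ≤ _ := by gcongr
  calc gas β n (lpBall n p σ) ≤ gas β n (lpBall n p (ρ * Real.exp (σ / ρ - 1))) :=
        measure_mono fun x hx => le_trans hx h1
    _ = _ := by
        rw [gas_lpBall_scale β hp hρ (by positivity), mul_div_cancel_left₀ _ hρ.ne',
          ← Real.exp_mul]

lemma log_one_add_le {p u : ℝ} (hp : 0 < p) (hu : 0 ≤ u) :
    Real.log (1 + u) ≤ Real.log 2 + u ^ p / p := by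
  rcases le_total u 1 with h | h
  · have := Real.log_le_log (by linarith) (by linarith : 1 + u ≤ 2)
    have : 0 ≤ u ^ p / p := by positivity
    linarith
  · have h0 : 0 < u := by linarith
    have h1 : Real.log (1 + u) ≤ Real.log (2 * u) := Real.log_le_log (by linarith) (by linarith)
    rw [Real.log_mul two_ne_zero h0.ne'] at h1
    have h2 : p * Real.log u ≤ u ^ p := by
      rw [← Real.log_rpow h0]
      exact (Real.log_le_sub_one_of_pos (by positivity)).trans (by linarith)
    have : Real.log u ≤ u ^ p / p := by rw [le_div_iff₀ hp]; linarith
    linarith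

lemma prod_abs_sub_le {k : ℕ} {p x : ℝ} (hp : 0 < p) (y : Fin k → ℝ) :
    ∏ j, |x - y j| ≤ (1 + |x|) ^ k * Real.exp (k * Real.log 2 + (∑ j, |y j| ^ p) / p) := by
  have h : ∀ j, |x - y j| ≤ (1 + |x|) * Real.exp (Real.log 2 + |y j| ^ p / p) := fun j => by
    have h1 : |x - y j| ≤ (1 + |x|) * (1 + |y j|) := by
      have := abs_sub x (y j)
      nlinarith [abs_nonneg x, abs_nonneg (y j), mul_nonneg (abs_nonneg x) (abs_nonneg (y j))]
    refine h1.trans ?_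
    have h2 := Real.exp_le_exp.2 (log_one_add_le hp (abs_nonneg (y j)))
    rw [Real.exp_log (by positivity)] at h2
    gcongr
  refine (Finset.prod_le_prod (fun j _ => abs_nonneg _) fun j _ => h j).trans (le_of_eq ?_)
  rw [Finset.prod_mul_distrib, Finset.prod_const, ← Real.exp_sum, Finset.sum_add_distrib,
    ← Finset.sum_div]
  simp

lemma gas_slice_upper {k : ℕ} (β : ℕ) {p ρ R M : ℝ} (hp : 0 < p) (hρ : 0 < ρ)
    (hM : ∀ x : ℝ, R < |x| → (1 + |x|) ^ (k * β) *
      Real.exp (-(|x| ^ p / ρ * ((gasDim β k : ℝ) / p))) ≤ M) (hM0 : 0 ≤ M) :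
    gas β (k + 1) (lpBall (k + 1) p ρ ∩ {x | R < |x 0|}) ≤
      ENNReal.ofReal (2 * ρ ^ (1 / p) * (M * Real.exp (β * (k * Real.log 2 + ρ / p)))) *
        gas β k (lpBall k p ρ) := by
  have hmeas : MeasurableSet (lpBall (k + 1) p ρ ∩ {x | R < |x 0|}) :=
    (measurableSet_lpBall hp ρ).inter
      (isOpen_lt continuous_const (continuous_apply 0).abs).measurableSet
  rw [← lintegral_indicator_one hmeas, lintegral_gas_succ β (measurable_one.indicator hmeas)]
  set E := ENNReal.ofReal (Real.exp (β * (k * Real.log 2 + ρ / p)))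
  set I : Set ℝ := Set.Icc (-(ρ ^ (1 / p))) (ρ ^ (1 / p))
  set g : ℝ → ℝ≥0∞ := (I ∩ {x | R < |x|}).indicator fun x =>
    ENNReal.ofReal ((1 + |x|) ^ (k * β)) * E
  set G : (Fin k → ℝ) → ℝ → ℝ≥0∞ := fun y x =>
    {z : (Fin k → ℝ) × ℝ | z.1 ∈ lpBall k p (ρ - |z.2| ^ p)}.indicator (fun z => g z.2) (y, x)
  have hg : Measurable g := by
    refine Measurable.indicator (by fun_prop) (measurableSet_Icc.inter ?_)
    exact (isOpen_lt continuous_const continuous_abs).measurableSet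
  have hG : Measurable (Function.uncurry G) := by
    have hS : MeasurableSet {z : (Fin k → ℝ) × ℝ | z.1 ∈ lpBall k p (ρ - |z.2| ^ p)} := by
      refine measurableSet_le ((continuous_lpSum hp).measurable.comp measurable_fst) ?_
      fun_prop
    exact (hg.comp measurable_snd).indicator hS
  have hpt : ∀ (y : Fin k → ℝ) (x : ℝ), ENNReal.ofReal ((∏ j, |x - y j|) ^ β) *
      (lpBall (k + 1) p ρ ∩ {x | R < |x 0|}).indicator 1 (Fin.cons x y : Fin (k + 1) → ℝ) ≤
      G y x := by
    intro y x
    by_cases h : (Fin.cons x y : Fin (k + 1) → ℝ) ∈ lpBall (k + 1) p ρ ∩ {x | R < |x 0|}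
    swap
    · rw [Set.indicator_of_notMem h, mul_zero]; exact zero_le
    have h1 : |x| ^ p + ∑ j, |y j| ^ p ≤ ρ := by
      have := h.1
      simpa [lpBall, Fin.sum_univ_succ] using this
    have h2 : R < |x| := by simpa using h.2
    have hS0 : 0 ≤ ∑ j, |y j| ^ p :=
      Finset.sum_nonneg fun i _ => Real.rpow_nonneg (abs_nonneg _) _
    have hx0 : 0 ≤ |x| ^ p := Real.rpow_nonneg (abs_nonneg _) _
    have h3 : x ∈ I := by
      have : |x| ≤ ρ ^ (1 / p) := by
        calc |x| = (|x| ^ p) ^ (1 / p) := by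
              rw [← Real.rpow_mul (abs_nonneg _), mul_one_div_cancel hp.ne', Real.rpow_one]
          _ ≤ _ := Real.rpow_le_rpow hx0 (by linarith) (by positivity)
      exact abs_le.1 this
    have h4 : y ∈ lpBall k p (ρ - |x| ^ p) := by change ∑ j, |y j| ^ p ≤ ρ - |x| ^ p; linarith
    rw [Set.indicator_of_mem h]
    simp only [G]
    rw [Set.indicator_of_mem (by exact h4)]
    simp only [g]
    rw [Set.indicator_of_mem (by exact ⟨h3, h2⟩), Pi.one_apply, mul_one,
      ← ENNReal.ofReal_mul (by positivity)]
    refine ENNReal.ofReal_le_ofReal ?_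
    calc (∏ j, |x - y j|) ^ β ≤
          ((1 + |x|) ^ k * Real.exp (k * Real.log 2 + (∑ j, |y j| ^ p) / p)) ^ β :=
          pow_le_pow_left₀ (Finset.prod_nonneg fun j _ => abs_nonneg _) (prod_abs_sub_le hp y) β
      _ ≤ ((1 + |x|) ^ k * Real.exp (k * Real.log 2 + ρ / p)) ^ β := by
          gcongr; linarith
      _ = _ := by rw [mul_pow, ← pow_mul, ← Real.exp_nat_mul]
  refine (lintegral_mono fun y => lintegral_mono fun x => hpt y x).trans ?_
  rw [lintegral_lintegral_swap hG.aemeasurable]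
  have hx : ∀ x : ℝ, ∫⁻ y, G y x ∂gas β k ≤
      I.indicator (fun _ => ENNReal.ofReal M * E * gas β k (lpBall k p ρ)) x := by
    intro x
    have h1 : ∫⁻ y, G y x ∂gas β k = g x * gas β k (lpBall k p (ρ - |x| ^ p)) := by
      rw [← lintegral_indicator_const (measurableSet_lpBall hp _)]
      rfl
    rw [h1]
    by_cases hxI : x ∈ I ∩ {x | R < |x|}
    swap
    · simp only [g]
      rw [Set.indicator_of_notMem hxI, zero_mul]; exact zero_le
    rw [Set.indicator_of_mem hxI.1]
    simp only [g]
    rw [Set.indicator_of_mem hxI]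
    refine (mul_le_mul_right (gas_lpBall_le_exp β hp hρ _) _).trans ?_
    rw [← mul_assoc, mul_right_comm (ENNReal.ofReal ((1 + |x|) ^ (k * β))),
      ← ENNReal.ofReal_mul (by positivity)]
    have h2 : (ρ - |x| ^ p) / ρ - 1 = -(|x| ^ p / ρ) := by field_simp; ring
    rw [h2, neg_mul]
    gcongr
    exact hM x hxI.2
  refine (lintegral_mono hx).trans (le_of_eq ?_)
  rw [lintegral_indicator_const measurableSet_Icc, Real.volume_Icc, mul_right_comm, mul_comm
    (ENNReal.ofReal M * E), ← ENNReal.ofReal_mul hM0, ← ENNReal.ofReal_mul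
    (by rw [sub_neg_eq_add]; positivity)]
  congr 2
  ring

lemma gas_slice_lower {k : ℕ} (β : ℕ) {p ρ : ℝ} (hp : 0 < p) (hρ : 2 ≤ ρ) :
    ENNReal.ofReal (Real.exp (-((1 + β * k) * Real.log 2 + 2 / ρ * ((gasDim β k : ℝ) / p)))) *
        gas β k (lpBall k p ρ) ≤
      gas β (k + 1) (lpBall (k + 1) p ρ) := by
  have hρ0 : 0 < ρ := by linarith
  have hmeas := measurableSet_lpBall (n := k + 1) hp ρ
  rw [← lintegral_indicator_one hmeas, lintegral_gas_succ β (measurable_one.indicator hmeas)]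
  have h1 : ∀ y : Fin k → ℝ, (lpBall k p (ρ - 1)).indicator
      (fun _ => ENNReal.ofReal (Real.exp (-((1 + β * k) * Real.log 2)))) y ≤
      ∫⁻ x : ℝ, ENNReal.ofReal ((∏ j, |x - y j|) ^ β) *
        (lpBall (k + 1) p ρ).indicator 1 (Fin.cons x y : Fin (k + 1) → ℝ) := by
    intro y
    by_cases hy : y ∈ lpBall k p (ρ - 1)
    swap
    · rw [Set.indicator_of_notMem hy]; exact zero_le
    rw [Set.indicator_of_mem hy]
    have h2 := slice_lower (γ := 0) β y hp one_pos
    have h3 : Real.exp (-((1 + β * k) * Real.log 2)) ≤ Real.pi * Real.exp ((1 + β * (k : ℝ)) *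
        Real.log (1 / 2) - 0 * (1 ^ p * cosMoment p)) := by
      rw [one_div, Real.log_inv, zero_mul, sub_zero, mul_neg]
      refine le_mul_of_one_le_left (Real.exp_pos _).le (by linarith [Real.pi_gt_three])
    refine (ENNReal.ofReal_le_ofReal h3).trans (h2.trans ?_)
    refine le_trans (setLIntegral_mono' measurableSet_Icc fun x hx => ?_)
      (setLIntegral_le_lintegral _ _)
    have h4 : (Fin.cons x y : Fin (k + 1) → ℝ) ∈ lpBall (k + 1) p ρ := by
      have h5 : |x| ^ p ≤ 1 := Real.rpow_le_one (abs_nonneg _) (abs_le.2 hx) hp.le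
      have h6 : ∑ j, |y j| ^ p ≤ ρ - 1 := hy
      change ∑ i, |(Fin.cons x y : Fin (k + 1) → ℝ) i| ^ p ≤ ρ
      rw [Fin.sum_univ_succ]
      simp only [Fin.cons_zero, Fin.cons_succ]
      linarith
    rw [Set.indicator_of_mem h4]
    simp
  refine le_trans ?_ (lintegral_mono h1)
  rw [lintegral_indicator_const (measurableSet_lpBall hp _),
    gas_lpBall_scale β hp hρ0 (by linarith : 0 < ρ - 1), ← mul_assoc,
    ← ENNReal.ofReal_mul (by positivity)]
  gcongr
  rw [neg_add, Real.exp_add]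
  gcongr
  have h7 : 0 < (ρ - 1) / ρ := div_pos (by linarith) hρ0
  rw [Real.rpow_def_of_pos h7, Real.exp_le_exp, ← neg_mul]
  gcongr
  have h8 := Real.log_le_sub_one_of_pos (inv_pos.2 h7)
  rw [Real.log_inv, inv_div] at h8
  have h9 : ρ / (ρ - 1) - 1 ≤ 2 / ρ := by
    rw [div_sub_one (by linarith), div_le_div_iff₀ (by linarith) hρ0]
    linarith
  linarith

end Outliers

section OutlierBound

lemma gas_outlier_union {k : ℕ} (β : ℕ) {p ρ R : ℝ} (hp : 0 < p) :
    gas β (k + 1) (lpBall (k + 1) p ρ ∩ {x | ∃ i, R < |x i|}) ≤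
      ((k + 1 : ℕ) : ℝ≥0∞) * gas β (k + 1) (lpBall (k + 1) p ρ ∩ {x | R < |x 0|}) := by
  have hmeas : MeasurableSet (lpBall (k + 1) p ρ ∩ {x | R < |x 0|}) :=
    (measurableSet_lpBall hp ρ).inter
      (isOpen_lt continuous_const (continuous_apply 0).abs).measurableSet
  have h1 : lpBall (k + 1) p ρ ∩ {x | ∃ i, R < |x i|} ⊆
      ⋃ i, (fun d => d ∘ Equiv.swap 0 i) ⁻¹' (lpBall (k + 1) p ρ ∩ {x | R < |x 0|}) := by
    rintro x ⟨hx, i, hi⟩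
    refine Set.mem_iUnion.2 ⟨i, ?_, ?_⟩
    · change ∑ j, |x (Equiv.swap 0 i j)| ^ p ≤ ρ
      rwa [Equiv.sum_comp (Equiv.swap 0 i) fun j => |x j| ^ p]
    · simpa using hi
  refine (measure_mono h1).trans ((measure_iUnion_fintype_le _ _).trans (le_of_eq ?_))
  simp_rw [gas_preimage_comp_perm β _ hmeas]
  simp

lemma gasDim_bounds {β : ℕ} (hβ : 1 ≤ β) (k : ℕ) :
    (k : ℝ) * (k + 1) / 2 ≤ gasDim β k ∧ (gasDim β k : ℝ) ≤ β * k * (k + 1) := by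
  rw [gasDim_eq]
  have hβ' : (1 : ℝ) ≤ β := by exact_mod_cast hβ
  rcases Nat.eq_zero_or_pos k with rfl | hk
  · simp
  have hk' : (1 : ℝ) ≤ k := by exact_mod_cast hk
  have h1 : 0 ≤ (k : ℝ) * (k - 1) := by nlinarith
  have h2 : 0 ≤ (k : ℝ) * (k + 1) := by nlinarith
  constructor <;> nlinarith [mul_le_mul_of_nonneg_right hβ' h1, mul_le_mul_of_nonneg_right hβ' h2]

lemma gas_outlier_le {k : ℕ} {β : ℕ} (hβ : 1 ≤ β) {p a B R : ℝ} (hp : 0 < p) (ha : 0 < a)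
    (hk : 1 ≤ k) (hρ : 2 ≤ a * (k + 1))
    (hB : 2 * β * Real.log 2 + 2 * β * a / p + Real.log 2 + 2 * β / (p * a) + 1 ≤ B)
    (hR : ∀ x : ℝ, R < |x| → β * Real.log (1 + |x|) + B ≤ |x| ^ p / (2 * p * a)) :
    gas β (k + 1) (lpBall (k + 1) p (a * (k + 1)) ∩ {x | ∃ i, R < |x i|}) ≤
      ENNReal.ofReal (((k : ℝ) + 1) * (2 * (a * (k + 1)) ^ (1 / p) * Real.exp (-k))) *
        gas β (k + 1) (lpBall (k + 1) p (a * (k + 1))) := by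
  set ρ := a * ((k : ℝ) + 1) with hρdef
  have hρ0 : 0 < ρ := by linarith
  have hk' : (1 : ℝ) ≤ k := by exact_mod_cast hk
  have hβ' : (1 : ℝ) ≤ β := by exact_mod_cast hβ
  obtain ⟨hN1, hN2⟩ := gasDim_bounds hβ k
  have hz1 : k / (2 * p * a) ≤ (gasDim β k : ℝ) / p / ρ := by
    rw [hρdef, div_div, div_le_div_iff₀ (by positivity) (by positivity)]
    nlinarith [mul_le_mul_of_nonneg_right hN1 (by positivity : 0 ≤ 2 * p * a)]
  have hz2 : (gasDim β k : ℝ) / p / ρ ≤ β * k / (p * a) := by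
    rw [hρdef, div_div, div_le_div_iff₀ (by positivity) (by positivity)]
    nlinarith [mul_le_mul_of_nonneg_right hN2 (by positivity : 0 ≤ p * a)]
  have hM : ∀ x : ℝ, R < |x| → (1 + |x|) ^ (k * β) *
      Real.exp (-(|x| ^ p / ρ * ((gasDim β k : ℝ) / p))) ≤ Real.exp (-(B * k)) := by
    intro x hx
    have hx1 : 0 < 1 + |x| := by positivity
    rw [← Real.exp_log (pow_pos hx1 _), Real.log_pow, ← Real.exp_add, Real.exp_le_exp]
    have hx0 : 0 ≤ |x| ^ p := Real.rpow_nonneg (abs_nonneg _) _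
    have h1 := mul_le_mul_of_nonneg_left hz1 hx0
    have h2 := mul_le_mul_of_nonneg_left (hR x hx) (by linarith : (0 : ℝ) ≤ k)
    have h3 : |x| ^ p / ρ * ((gasDim β k : ℝ) / p) = |x| ^ p * ((gasDim β k : ℝ) / p / ρ) := by
      field_simp
    have h4 : k * (|x| ^ p / (2 * p * a)) = |x| ^ p * (k / (2 * p * a)) := by field_simp
    rw [h4] at h2
    rw [h3]
    push_cast
    nlinarith
  have h1 := gas_slice_upper β hp hρ0 hM (Real.exp_pos _).le
  have h2 := gas_slice_lower (k := k) β hp hρ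
  set L := (1 + β * (k : ℝ)) * Real.log 2 + 2 / ρ * ((gasDim β k : ℝ) / p)
  have h3 : gas β k (lpBall k p ρ) ≤
      ENNReal.ofReal (Real.exp L) * gas β (k + 1) (lpBall (k + 1) p ρ) := by
    refine le_trans (le_of_eq ?_) (mul_le_mul_right h2 _)
    rw [← mul_assoc, ← ENNReal.ofReal_mul (Real.exp_pos _).le, ← Real.exp_add]
    simp
  refine (gas_outlier_union β hp).trans ((mul_le_mul_right (h1.trans (mul_le_mul_right h3 _)) _).trans
    ?_)
  rw [← mul_assoc, ← mul_assoc, ← ENNReal.ofReal_natCast, ← ENNReal.ofReal_mul (by positivity),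
    ← ENNReal.ofReal_mul (by positivity)]
  refine mul_le_mul_left (ENNReal.ofReal_le_ofReal ?_) _
  push_cast
  rw [mul_assoc, mul_assoc (2 * ρ ^ (1 / p)), ← Real.exp_add, ← Real.exp_add]
  gcongr
  have h5 : 2 / ρ * ((gasDim β k : ℝ) / p) ≤ 2 * (β * k / (p * a)) := by
    calc 2 / ρ * ((gasDim β k : ℝ) / p) = 2 * ((gasDim β k : ℝ) / p / ρ) := by field_simp
      _ ≤ _ := by gcongr
  have h6 : ρ / p ≤ 2 * a / p * k := by
    rw [hρdef, div_mul_eq_mul_div, div_le_div_iff_of_pos_right hp]; nlinarith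
  have h7 := mul_le_mul_of_nonneg_left h6 (by linarith : (0 : ℝ) ≤ β)
  have h8 := mul_le_mul_of_nonneg_right hB (by linarith : (0 : ℝ) ≤ k)
  have h9 : 0 ≤ (k - 1 : ℝ) * Real.log 2 := mul_nonneg (by linarith) (Real.log_nonneg one_le_two)
  have h10 : 2 * (β * k / (p * a)) = 2 * β / (p * a) * k := by ring
  have h11 : β * (2 * a / p * k) = 2 * β * a / p * k := by ring
  rw [h10] at h5
  rw [h11] at h7
  simp only [L]
  nlinarith

lemma exists_outlier_radius {β : ℕ} {p a : ℝ} (hp : 0 < p) (ha : 0 < a) {B : ℝ} (hB : 0 ≤ B) :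
    ∃ R : ℝ, 2 ≤ R ∧
      ∀ x : ℝ, R < |x| → β * Real.log (1 + |x|) + B ≤ |x| ^ p / (2 * p * a) := by
  set D := 2 * β / p + β * Real.log 2 + B with hD
  have hD0 : 0 ≤ D := by have := Real.log_nonneg one_le_two; positivity
  set V := 2 * p * a * D + 1 with hV
  have hV0 : 1 ≤ V := by rw [hV]; linarith [mul_nonneg (by positivity : 0 ≤ 2 * p * a) hD0]
  refine ⟨max 2 (V ^ (2 / p)), le_max_left _ _, fun x hx => ?_⟩
  set v := |x| ^ (p / 2) with hv
  have hvV : V ≤ v := by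
    calc V = (V ^ (2 / p)) ^ (p / 2) := by
          rw [← Real.rpow_mul (by linarith), div_mul_div_comm, mul_comm, div_self (by positivity),
            Real.rpow_one]
      _ ≤ v := Real.rpow_le_rpow (by positivity) ((le_max_right _ _).trans hx.le) (by positivity)
  have h1 : |x| ^ p = v * v := by
    rw [hv, ← Real.rpow_add_of_nonneg (abs_nonneg _) (by positivity) (by positivity)]
    congr 1; ring
  have h2 := log_one_add_le (p := p / 2) (by positivity) (abs_nonneg x)
  rw [← hv] at h2
  have h3 := mul_le_mul_of_nonneg_left h2 (Nat.cast_nonneg (α := ℝ) β)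
  have h4 : β * (Real.log 2 + v / (p / 2)) = β * Real.log 2 + 2 * β / p * v := by
    field_simp
  have h5 : v * D ≤ v * v / (2 * p * a) := by
    rw [le_div_iff₀ (by positivity)]; nlinarith
  have h6 : β * Real.log 2 + B ≤ v * (β * Real.log 2 + B) :=
    le_mul_of_one_le_left (by have := Real.log_nonneg one_le_two; positivity) (by linarith)
  rw [h1]
  rw [hD] at h5
  rw [h4] at h3
  nlinarith

/-- Up to a vanishing fraction of the ball, all coordinates are uniformly bounded. -/
lemma exists_outlier_bound {β : ℕ} (hβ : 1 ≤ β) {p : ℝ} (hp : 0 < p) :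
    ∃ R : ℝ, 2 ≤ R ∧ ∃ ε : ℕ → ℝ, Tendsto ε atTop (nhds 0) ∧ ∀ᶠ n in atTop,
      gas β n (lpBall n p (critRad p n) ∩ {x | ∃ i, R < |x i|}) ≤
        ENNReal.ofReal (ε n) * gas β n (lpBall n p (critRad p n)) := by
  set a := cosMoment p / 2 with ha
  have ha0 : 0 < a := half_pos (cosMoment_pos hp)
  set B := 2 * β * Real.log 2 + 2 * β * a / p + Real.log 2 + 2 * β / (p * a) + 1 with hB
  have hB0 : 0 ≤ B := by have := Real.log_nonneg one_le_two; positivity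
  obtain ⟨R, hR2, hR⟩ := exists_outlier_radius (β := β) hp ha0 hB0
  refine ⟨R, hR2, fun n => 2 * a ^ (1 / p) * Real.exp 1 *
    ((n : ℝ) ^ (1 + 1 / p) * Real.exp (-1 * n)), ?_, ?_⟩
  · have h := (tendsto_rpow_mul_exp_neg_mul_atTop_nhds_zero (1 + 1 / p) 1 one_pos).comp
      tendsto_natCast_atTop_atTop
    simpa using h.const_mul (2 * a ^ (1 / p) * Real.exp 1)
  · have h1 : ∀ᶠ n : ℕ in atTop, 2 / a ≤ n := tendsto_natCast_atTop_atTop.eventually_ge_atTop _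
    filter_upwards [h1, eventually_ge_atTop 2] with n hn hn2
    obtain ⟨k, rfl⟩ : ∃ k, n = k + 1 := ⟨n - 1, by omega⟩
    have hρ : critRad p (k + 1) = a * (k + 1) := by rw [critRad, ha]; push_cast; ring
    rw [hρ]
    push_cast at hn
    rw [div_le_iff₀ ha0] at hn
    refine (gas_outlier_le hβ hp ha0 (by omega) (by linarith) hB.ge hR).trans (le_of_eq ?_)
    congr 2
    push_cast
    rw [Real.mul_rpow ha0.le (by positivity), Real.rpow_add (by positivity), Real.rpow_one,
      show Real.exp (-(k : ℝ)) = Real.exp 1 * Real.exp (-1 * ((k : ℝ) + 1)) by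
        rw [← Real.exp_add]; congr 1; ring]
    ring

end OutlierBound

section Arcosh

lemma measurable_arcosh : Measurable Real.arcosh := by
  unfold Real.arcosh
  fun_prop

lemma arcosh_le_log {u : ℝ} (hu : 1 ≤ u) : Real.arcosh u ≤ Real.log (2 * u) := by
  rw [Real.arcosh]
  refine Real.log_le_log (by positivity) ?_
  have : √(u ^ 2 - 1) ≤ u := by
    rw [Real.sqrt_le_left (by linarith)]; linarith
  linarith

lemma arcosh_mono {u v : ℝ} (hu : 1 ≤ u) (huv : u ≤ v) : Real.arcosh u ≤ Real.arcosh v :=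
  (Real.arcosh_le_arcosh (by linarith) (by linarith)).2 huv

lemma arcosh_add_le {u v : ℝ} (hu : 1 ≤ u) (hv : 0 ≤ v) :
    Real.arcosh (u + v) ≤ Real.arcosh u + Real.arcosh (1 + v) := by
  have h1 := Real.arcosh_nonneg hu
  have h2 := Real.arcosh_nonneg (by linarith : 1 ≤ 1 + v)
  rw [← Real.arcosh_cosh (add_nonneg h1 h2)]
  refine arcosh_mono (by linarith) ?_
  rw [Real.cosh_add, Real.cosh_arcosh hu, Real.cosh_arcosh (by linarith)]
  have h3 : 0 ≤ Real.sinh (Real.arcosh u) * Real.sinh (Real.arcosh (1 + v)) :=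
    mul_nonneg (Real.sinh_nonneg_iff.2 h1) (Real.sinh_nonneg_iff.2 h2)
  nlinarith

/-- Lebesgue measure on the unit interval. -/
def unitMeas : Measure ℝ := volume.restrict (Set.Ioc 0 1)

instance unitMeas_isProbabilityMeasure : IsProbabilityMeasure unitMeas := by
  constructor
  simp [unitMeas]

lemma ae_unitMeas : ∀ᵐ τ ∂unitMeas, τ ∈ Set.Ioc (0 : ℝ) 1 := ae_restrict_mem measurableSet_Ioc

lemma integral_unitMeas (f : ℝ → ℝ) : ∫ τ, f τ ∂unitMeas = ∫ τ in (0 : ℝ)..1, f τ := by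
  rw [unitMeas, intervalIntegral.integral_of_le zero_le_one]

lemma integrable_unitMeas_iff {f : ℝ → ℝ} :
    Integrable f unitMeas ↔ IntervalIntegrable f volume 0 1 :=
  (intervalIntegrable_iff_integrableOn_Ioc_of_le zero_le_one).symm

lemma integrable_log_unitMeas : Integrable Real.log unitMeas :=
  integrable_unitMeas_iff.2 intervalIntegral.intervalIntegrable_log'

lemma integral_log_unitMeas : ∫ τ, Real.log τ ∂unitMeas = -1 := by
  rw [integral_unitMeas, integral_log]
  simp

lemma log_rpow_inv {p τ : ℝ} (hτ : 0 < τ) : Real.log (τ ^ (1 / p)) = 1 / p * Real.log τ :=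
  Real.log_rpow hτ _

lemma abs_arcosh_le {p C τ g : ℝ} (hC : 1 ≤ C) (hτ : 0 < τ)
    (h1 : 1 ≤ g) (h2 : g ≤ C / τ ^ (1 / p)) :
    ‖Real.arcosh g‖ ≤ Real.log (2 * C) - 1 / p * Real.log τ := by
  rw [Real.norm_of_nonneg (Real.arcosh_nonneg h1)]
  have ht : 0 < τ ^ (1 / p) := by positivity
  refine (arcosh_le_log h1).trans ?_
  rw [← log_rpow_inv hτ, ← Real.log_div (by positivity) ht.ne']
  refine Real.log_le_log (by linarith) ?_
  rw [mul_div_assoc]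
  linarith

lemma integrable_arcosh_unitMeas {p C : ℝ} {g : ℝ → ℝ} (hC : 1 ≤ C)
    (hg : Measurable g) (h1 : ∀ τ ∈ Set.Ioc (0 : ℝ) 1, 1 ≤ g τ)
    (h2 : ∀ τ ∈ Set.Ioc (0 : ℝ) 1, g τ ≤ C / τ ^ (1 / p)) :
    Integrable (fun τ => Real.arcosh (g τ)) unitMeas := by
  refine Integrable.mono' ((integrable_const (Real.log (2 * C))).sub
    (integrable_log_unitMeas.const_mul (1 / p)))
    (measurable_arcosh.comp hg).aestronglyMeasurable ?_
  filter_upwards [ae_unitMeas] with τ hτ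
  exact abs_arcosh_le hC hτ.1 (h1 τ hτ) (h2 τ hτ)

lemma rpow_one_div_le_one {p τ : ℝ} (hp : 0 < p) (hτ : τ ∈ Set.Ioc (0 : ℝ) 1) :
    τ ^ (1 / p) ≤ 1 := Real.rpow_le_one hτ.1.le hτ.2 (by positivity)

lemma max_div_le {p C τ x : ℝ} (hp : 0 < p) (hC : 1 ≤ C) (hx : |x| ≤ C)
    (hτ : τ ∈ Set.Ioc (0 : ℝ) 1) : max (|x| / τ ^ (1 / p)) 1 ≤ C / τ ^ (1 / p) := by
  have ht : 0 < τ ^ (1 / p) := Real.rpow_pos_of_pos hτ.1 _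
  refine max_le (by gcongr) ?_
  rw [le_div_iff₀ ht, one_mul]
  exact (rpow_one_div_le_one hp hτ).trans hC

/-- The nontrivial part of the logarithmic potential of the equilibrium law. -/
def potFun (p x : ℝ) : ℝ := ∫ τ, Real.arcosh (max (|x| / τ ^ (1 / p)) 1) ∂unitMeas

lemma integrable_potFun {p : ℝ} (hp : 0 < p) (x : ℝ) :
    Integrable (fun τ : ℝ => Real.arcosh (max (|x| / τ ^ (1 / p)) 1)) unitMeas :=
  integrable_arcosh_unitMeas (C := max |x| 1) (p := p) (le_max_right _ _) (by fun_prop)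
    (fun τ _ => le_max_right _ _) fun τ hτ => max_div_le hp (le_max_right _ _) (le_max_left _ _) hτ

lemma potFun_eq {p : ℝ} (hp : 0 < p) {x : ℝ} (hx : x ≠ 0) :
    potFun p x = |x| ^ p * ∫ σ in (0 : ℝ)..(1 / |x| ^ p),
      Real.arcosh (max (1 / σ ^ (1 / p)) 1) := by
  have hx0 : 0 < |x| := abs_pos.2 hx
  have hy : 0 < |x| ^ p := Real.rpow_pos_of_pos hx0 p
  have h := intervalIntegral.integral_comp_div (a := 0) (b := 1)
    (fun σ : ℝ => Real.arcosh (max (1 / σ ^ (1 / p)) 1)) hy.ne'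
  rw [zero_div, smul_eq_mul] at h
  rw [potFun, integral_unitMeas, ← h]
  refine intervalIntegral.integral_congr fun τ hτ => ?_
  rw [Set.uIcc_of_le zero_le_one] at hτ
  rw [Real.div_rpow hτ.1 hy.le, ← Real.rpow_mul hx0.le, mul_one_div_cancel hp.ne', Real.rpow_one,
    one_div_div]

lemma potFun_one (p : ℝ) :
    potFun p 1 = ∫ σ in (0 : ℝ)..1, Real.arcosh (max (1 / σ ^ (1 / p)) 1) := by
  rw [potFun, integral_unitMeas, abs_one]

lemma intervalIntegrable_arcosh {p : ℝ} (hp : 0 < p) {b : ℝ} (hb : 0 < b) :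
    IntervalIntegrable (fun σ : ℝ => Real.arcosh (max (1 / σ ^ (1 / p)) 1)) volume 0 b := by
  have h1 : IntervalIntegrable (fun σ : ℝ => Real.arcosh (max (1 / σ ^ (1 / p)) 1))
      volume 0 1 := by
    have := integrable_unitMeas_iff.1 (integrable_potFun hp 1)
    simpa only [abs_one] using this
  refine h1.trans ?_
  refine ContinuousOn.intervalIntegrable ?_
  have hpos : ∀ σ ∈ Set.uIcc 1 b, 0 < σ := fun σ hσ =>
    lt_of_lt_of_le (lt_min one_pos hb) hσ.1
  refine Real.continuousOn_arcosh.comp ?_ fun σ _ => Set.mem_Ici.2 (le_max_right _ _)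
  refine ContinuousOn.sup (ContinuousOn.div continuousOn_const
    (continuousOn_id.rpow_const fun σ hσ => Or.inl (hpos σ hσ).ne')
    fun σ hσ => (Real.rpow_pos_of_pos (hpos σ hσ) _).ne') continuousOn_const

lemma potFun_zero {p : ℝ} : potFun p 0 = 0 := by
  simp [potFun, Real.arcosh_zero]

lemma potFun_of_le {p : ℝ} (hp : 0 < p) {x : ℝ} (hx : |x| ≤ 1) :
    potFun p x = potFun p 1 * |x| ^ p := by
  rcases eq_or_ne x 0 with rfl | hx0
  · rw [potFun_zero, abs_zero, Real.zero_rpow hp.ne', mul_zero]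
  have hy : 0 < |x| ^ p := Real.rpow_pos_of_pos (abs_pos.2 hx0) p
  have hy1 : 1 ≤ 1 / |x| ^ p := by
    rw [le_div_iff₀ hy, one_mul]; exact Real.rpow_le_one (abs_nonneg _) hx hp.le
  rw [potFun_eq hp hx0, potFun_one, mul_comm]
  congr 1
  have h1 := intervalIntegrable_arcosh hp one_pos
  have h2 := intervalIntegrable_arcosh hp (by linarith : 0 < 1 / |x| ^ p)
  rw [← intervalIntegral.integral_add_adjacent_intervals h1 (h1.symm.trans h2)]
  have h3 : ∫ σ in (1 : ℝ)..(1 / |x| ^ p), Real.arcosh (max (1 / σ ^ (1 / p)) 1) = 0 := by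
    rw [intervalIntegral.integral_congr (g := fun _ => 0), intervalIntegral.integral_zero]
    intro σ hσ
    rw [Set.uIcc_of_le hy1] at hσ
    have h4 : 1 ≤ σ ^ (1 / p) := Real.one_le_rpow hσ.1 (by positivity)
    have h5 : max (1 / σ ^ (1 / p)) 1 = 1 := max_eq_right ((div_le_one (by linarith)).2 h4)
    simp only [h5, Real.arcosh_zero]
  rw [h3, add_zero]

lemma potFun_le {p : ℝ} (hp : 0 < p) (x : ℝ) : potFun p x ≤ potFun p 1 * |x| ^ p := by
  rcases le_total |x| 1 with hx | hx
  · exact (potFun_of_le hp hx).le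
  have hx0 : x ≠ 0 := by rintro rfl; simp at hx; linarith
  have hy : 0 < |x| ^ p := Real.rpow_pos_of_pos (abs_pos.2 hx0) p
  have hy1 : 1 / |x| ^ p ≤ 1 := by
    rw [div_le_one hy]; exact Real.one_le_rpow hx hp.le
  rw [potFun_eq hp hx0, potFun_one, mul_comm]
  gcongr
  refine intervalIntegral.integral_mono_interval le_rfl (by positivity) hy1 ?_
    (intervalIntegrable_arcosh hp one_pos)
  exact Eventually.of_forall fun σ => Real.arcosh_nonneg (le_max_right _ _)

lemma potFun_one_nonneg (p : ℝ) : 0 ≤ potFun p 1 :=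
  integral_nonneg fun _ => Real.arcosh_nonneg (le_max_right _ _)

end Arcosh

section PotConst

lemma continuous_arcosh_comp {α : Type*} [TopologicalSpace α] {f : α → ℝ} (hf : Continuous f)
    (h : ∀ x, 1 ≤ f x) : Continuous fun x => Real.arcosh (f x) :=
  Real.continuousOn_arcosh.comp_continuous hf fun x => Set.mem_Ici.2 (h x)

lemma integrable_of_continuous_bounded {α : Type*} [TopologicalSpace α] [MeasurableSpace α]
    [OpensMeasurableSpace α] [SecondCountableTopology α] {μ : Measure α} [IsFiniteMeasure μ]
    {f : α → ℝ} (hf : Continuous f) {C : ℝ} (hC : ∀ x, |f x| ≤ C) : Integrable f μ :=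
  Integrable.of_bound hf.aestronglyMeasurable C (Eventually.of_forall hC)

lemma abs_log_le_of_mem {a b x : ℝ} (ha : 0 < a) (h1 : a ≤ x) (h2 : x ≤ b) :
    |Real.log x| ≤ |Real.log a| + |Real.log b| := by
  have h3 := Real.log_le_log ha h1
  have h4 := Real.log_le_log (ha.trans_le h1) h2
  rw [abs_le]
  constructor
  · linarith [neg_abs_le (Real.log a), abs_nonneg (Real.log b)]
  · linarith [le_abs_self (Real.log b), abs_nonneg (Real.log a)]

lemma max_div_le_joukowski_arg (w : ℂ) {t : ℝ} (ht : 0 < t) :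
    max (|w.re| / t) 1 ≤ (‖w - t‖ + ‖w + t‖) / (2 * t) := by
  refine max_le ?_ (one_le_joukowski_arg w ht)
  rw [div_le_div_iff₀ ht (by positivity)]
  have h1 : |w.re - t| ≤ ‖w - t‖ := by simpa using Complex.abs_re_le_norm (w - t)
  have h2 : |w.re + t| ≤ ‖w + t‖ := by simpa using Complex.abs_re_le_norm (w + t)
  have h3 : 2 * |w.re| ≤ |w.re - t| + |w.re + t| := by
    have := abs_add_le (w.re - t) (w.re + t)
    rwa [show w.re - t + (w.re + t) = 2 * w.re by ring, abs_mul, abs_two] at this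
  nlinarith

lemma integral_arcosh_cos_le_add {t δ : ℝ} (ht : 0 < t) (ht1 : t ≤ 1) (hδ : 0 < δ) :
    ∫ ψ, Real.arcosh (max (|Real.cos ψ| / t) 1) ∂unifAngle ≤
      -Real.log t + Real.arcosh (1 + δ) := by
  set w : ℝ → ℂ := fun ψ => (Real.cos ψ : ℂ) + δ * Complex.I with hw
  set w' : ℝ → ℂ := fun ψ => ((t * Real.cos ψ : ℝ) : ℂ) - δ * Complex.I with hw'
  set G : ℝ → ℝ → ℝ := fun ψ φ => Real.log ‖w ψ - ((t * Real.cos φ : ℝ) : ℂ)‖ with hG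
  have hG' : ∀ ψ φ, G ψ φ = Real.log ‖w' φ - ((1 * Real.cos ψ : ℝ) : ℂ)‖ := by
    intro ψ φ
    simp only [hG, hw, hw']
    rw [← norm_neg]
    congr 2
    push_cast
    ring
  have hlow : ∀ ψ φ, δ ≤ ‖w ψ - ((t * Real.cos φ : ℝ) : ℂ)‖ := by
    intro ψ φ
    have := Complex.abs_im_le_norm (w ψ - ((t * Real.cos φ : ℝ) : ℂ))
    have h2 : (w ψ - ((t * Real.cos φ : ℝ) : ℂ)).im = δ := by
      simp only [hw, Complex.sub_im, Complex.add_im, Complex.ofReal_im, Complex.mul_im,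
        Complex.ofReal_re, Complex.I_im, Complex.I_re]
      ring
    rw [h2, abs_of_pos hδ] at this
    exact this
  have hup : ∀ ψ φ, ‖w ψ - ((t * Real.cos φ : ℝ) : ℂ)‖ ≤ 2 + δ := by
    intro ψ φ
    calc ‖w ψ - ((t * Real.cos φ : ℝ) : ℂ)‖ ≤ ‖w ψ‖ + ‖((t * Real.cos φ : ℝ) : ℂ)‖ := norm_sub_le _ _
      _ ≤ (‖(Real.cos ψ : ℂ)‖ + ‖(δ : ℂ) * Complex.I‖) + ‖((t * Real.cos φ : ℝ) : ℂ)‖ := by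
          gcongr; exact norm_add_le _ _
      _ ≤ (1 + δ) + 1 := by
          rw [norm_mul, Complex.norm_I, mul_one, Complex.norm_real, Complex.norm_real,
            Complex.norm_real, Real.norm_of_nonneg hδ.le, Real.norm_eq_abs, Real.norm_eq_abs,
            abs_mul, abs_of_pos ht]
          have h1 := Real.abs_cos_le_one ψ
          have h2 := Real.abs_cos_le_one φ
          have h3 : t * |Real.cos φ| ≤ 1 * 1 := by gcongr
          linarith
      _ = 2 + δ := by ring
  have hcont : Continuous (Function.uncurry G) := by
    simp only [hG, hw, Function.uncurry_def]
    refine Continuous.log (by fun_prop) fun x => ?_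
    exact (hδ.trans_le (hlow x.1 x.2)).ne'
  have hInt : Integrable (Function.uncurry G) (unifAngle.prod unifAngle) :=
    integrable_of_continuous_bounded hcont fun x => abs_log_le_of_mem hδ (hlow x.1 x.2) (hup x.1 x.2)
  have hswap := integral_integral_swap hInt
  have hR : ∫ φ, ∫ ψ, G ψ φ ∂unifAngle ∂unifAngle ≤ Real.log (1 / 2) + Real.arcosh (1 + δ) := by
    have h1 : ∀ φ, ∫ ψ, G ψ φ ∂unifAngle ≤ Real.log (1 / 2) + Real.arcosh (1 + δ) := by
      intro φ
      simp only [hG']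
      rw [integral_log_norm_sub_cos _ one_pos]
      gcongr
      refine arcosh_mono (one_le_joukowski_arg _ one_pos) ?_
      rw [div_le_iff₀ (by norm_num)]
      have hc : |t * Real.cos φ| ≤ 1 := by
        rw [abs_mul, abs_of_pos ht]
        have h2 := Real.abs_cos_le_one φ
        have h3 : t * |Real.cos φ| ≤ 1 * 1 := by gcongr
        linarith
      have hI : ‖(δ : ℂ) * Complex.I‖ = δ := by
        rw [norm_mul, Complex.norm_I, mul_one, Complex.norm_real, Real.norm_of_nonneg hδ.le]
      have h4 : ‖w' φ - ((1 : ℝ) : ℂ)‖ ≤ (1 - t * Real.cos φ) + δ := by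
        have : w' φ - ((1 : ℝ) : ℂ) = ((t * Real.cos φ - 1 : ℝ) : ℂ) - δ * Complex.I := by
          simp only [hw']; push_cast; ring
        rw [this]
        refine (norm_sub_le _ _).trans ?_
        rw [hI, Complex.norm_real, Real.norm_eq_abs, abs_of_nonpos (by linarith [(abs_le.1 hc).2])]
        linarith
      have h5 : ‖w' φ + ((1 : ℝ) : ℂ)‖ ≤ (1 + t * Real.cos φ) + δ := by
        have : w' φ + ((1 : ℝ) : ℂ) = ((t * Real.cos φ + 1 : ℝ) : ℂ) - δ * Complex.I := by
          simp only [hw']; push_cast; ring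
        rw [this]
        refine (norm_sub_le _ _).trans ?_
        rw [hI, Complex.norm_real, Real.norm_eq_abs, abs_of_nonneg (by linarith [(abs_le.1 hc).1])]
        linarith
      linarith
    have := integral_mono hInt.integral_prod_right (integrable_const _) h1
    simpa using this
  have hL : Real.log (t / 2) + ∫ ψ, Real.arcosh (max (|Real.cos ψ| / t) 1) ∂unifAngle ≤
      ∫ ψ, ∫ φ, G ψ φ ∂unifAngle ∂unifAngle := by
    have hi : Integrable (fun ψ => Real.arcosh (max (|Real.cos ψ| / t) 1)) unifAngle :=
      integrable_unifAngle_of_continuous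
        (continuous_arcosh_comp (by fun_prop) fun _ => le_max_right _ _)
    have h1 : Real.log (t / 2) + ∫ ψ, Real.arcosh (max (|Real.cos ψ| / t) 1) ∂unifAngle =
        ∫ ψ, (Real.log (t / 2) + Real.arcosh (max (|Real.cos ψ| / t) 1)) ∂unifAngle := by
      rw [integral_add (integrable_const _) hi]; simp
    rw [h1]
    refine integral_mono ((integrable_const _).add hi) hInt.integral_prod_left fun ψ => ?_
    simp only [hG]
    rw [integral_log_norm_sub_cos _ ht]
    gcongr
    refine arcosh_mono (le_max_right _ _) ?_
    have := max_div_le_joukowski_arg (w ψ) ht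
    have hre : (w ψ).re = Real.cos ψ := by
      simp only [hw, Complex.add_re, Complex.ofReal_re, Complex.mul_re, Complex.I_re,
        Complex.ofReal_im, Complex.I_im]
      ring
    rwa [hre] at this
  rw [hswap] at hL
  rw [Real.log_div ht.ne' two_ne_zero] at hL
  rw [Real.log_div one_ne_zero two_ne_zero, Real.log_one] at hR
  linarith

lemma tendsto_arcosh_one_add : Tendsto (fun δ : ℝ => Real.arcosh (1 + δ)) (nhdsWithin 0 (Set.Ioi 0))
    (nhds 0) := by
  have h := Real.continuousOn_arcosh.continuousWithinAt (Set.mem_Ici.2 (le_refl (1 : ℝ)))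
  rw [ContinuousWithinAt, Real.arcosh_zero] at h
  refine h.comp ?_
  refine tendsto_nhdsWithin_iff.2 ⟨?_, ?_⟩
  · have : Tendsto (fun δ : ℝ => 1 + δ) (nhds 0) (nhds (1 + 0)) := by
      exact (continuous_const.add continuous_id).tendsto 0
    rw [add_zero] at this
    exact this.mono_left nhdsWithin_le_nhds
  · filter_upwards [self_mem_nhdsWithin] with δ hδ
    have : (0 : ℝ) < δ := hδ
    exact Set.mem_Ici.2 (by linarith)

lemma integral_arcosh_cos_le {t : ℝ} (ht : 0 < t) (ht1 : t ≤ 1) :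
    ∫ ψ, Real.arcosh (max (|Real.cos ψ| / t) 1) ∂unifAngle ≤ -Real.log t := by
  have h : Tendsto (fun δ : ℝ => -Real.log t + Real.arcosh (1 + δ)) (nhdsWithin 0 (Set.Ioi 0))
    (nhds (-Real.log t + 0)) := tendsto_const_nhds.add tendsto_arcosh_one_add
  rw [add_zero] at h
  refine ge_of_tendsto h ?_
  filter_upwards [self_mem_nhdsWithin] with δ hδ
  exact integral_arcosh_cos_le_add ht ht1 hδ

lemma potFun_one_mul_cosMoment_le {p : ℝ} (hp : 0 < p) :
    potFun p 1 * cosMoment p ≤ 1 / p := by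
  set F : ℝ → ℝ → ℝ := fun ψ τ => Real.arcosh (max (|Real.cos ψ| / τ ^ (1 / p)) 1) with hF
  have hmeas : Measurable (Function.uncurry F) := by
    simp only [hF, Function.uncurry_def]
    exact measurable_arcosh.comp (by fun_prop)
  have hInt : Integrable (Function.uncurry F) (unifAngle.prod unitMeas) := by
    have hb : Integrable (fun z : ℝ × ℝ => Real.log (2 * 1) - 1 / p * Real.log z.2)
        (unifAngle.prod unitMeas) :=
      (integrable_const _).sub ((integrable_log_unitMeas.comp_snd unifAngle).const_mul _)
    refine hb.mono' hmeas.aestronglyMeasurable ?_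
    have : ∀ᵐ z ∂(unifAngle.prod unitMeas), z.2 ∈ Set.Ioc (0 : ℝ) 1 :=
      Measure.quasiMeasurePreserving_snd.ae ae_unitMeas
    filter_upwards [this] with z hz
    exact abs_arcosh_le le_rfl hz.1 (le_max_right _ _)
      (max_div_le hp le_rfl (by simpa using Real.abs_cos_le_one z.1) hz)
  have hswap := integral_integral_swap hInt
  have h1 : ∫ ψ, ∫ τ, F ψ τ ∂unitMeas ∂unifAngle = potFun p 1 * cosMoment p := by
    rw [cosMoment, ← integral_const_mul]
    congr 1
    ext ψ
    exact potFun_of_le hp (Real.abs_cos_le_one ψ)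
  rw [← h1, hswap]
  have h2 : ∫ τ, -(1 / p * Real.log τ) ∂unitMeas = 1 / p := by
    rw [integral_neg, integral_const_mul, integral_log_unitMeas]; ring
  rw [← h2]
  refine integral_mono_ae hInt.integral_prod_right (integrable_log_unitMeas.const_mul _).neg ?_
  filter_upwards [ae_unitMeas] with τ hτ
  have := integral_arcosh_cos_le (Real.rpow_pos_of_pos hτ.1 (1 / p)) (rpow_one_div_le_one hp hτ)
  rwa [log_rpow_inv hτ.1] at this

end PotConst

section ChebKernel

/-- The point of the ellipse with foci `±R` above `x`, with eccentric radius `r`. -/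
def ellPt (r R x : ℝ) : ℂ :=
  (R / 2 : ℝ) * (r * Complex.exp (Real.arccos (x / R) * Complex.I) +
    (r : ℂ)⁻¹ * Complex.exp (-(Real.arccos (x / R) * Complex.I)))

/-- Rescaled Chebyshev polynomials of the first kind. -/
def cheb (R : ℝ) (k : ℕ) (x : ℝ) : ℝ := Real.cos (k * Real.arccos (x / R))

/-- A regularization of the logarithmic kernel on `[-R, R]`. -/
def chebKer (r R x y : ℝ) : ℝ := Real.log ‖ellPt r R x - (y : ℂ)‖

lemma abs_cheb_le (R : ℝ) (k : ℕ) (x : ℝ) : |cheb R k x| ≤ 1 := Real.abs_cos_le_one _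

lemma continuous_cheb (R : ℝ) (k : ℕ) : Continuous (cheb R k) := by
  unfold cheb
  have := Real.continuous_arccos
  fun_prop

lemma continuous_ellPt (r R : ℝ) : Continuous (ellPt r R) := by
  unfold ellPt
  have := Real.continuous_arccos
  fun_prop

lemma mul_cos_arccos_div {R x : ℝ} (hR : 0 < R) (hx : |x| ≤ R) :
    R * Real.cos (Real.arccos (x / R)) = x := by
  have h := abs_le.1 hx
  rw [Real.cos_arccos]
  · field_simp
  · rw [le_div_iff₀ hR]; linarith
  · rw [div_le_one hR]; linarith

lemma ellPt_sub_mul_cos {r R x : ℝ} (hr : 0 < r) (φ : ℝ) :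
    ellPt r R x - ((R * Real.cos φ : ℝ) : ℂ) =
      (R / (2 * r) : ℝ) * Complex.exp (-(Real.arccos (x / R) * Complex.I)) *
        ((1 - r * Complex.exp ((Real.arccos (x / R) + φ : ℝ) * Complex.I)) *
        (1 - r * Complex.exp ((Real.arccos (x / R) - φ : ℝ) * Complex.I))) := by
  set θ := Real.arccos (x / R) with hθ
  have hr' : (r : ℂ) ≠ 0 := by exact_mod_cast hr.ne'
  rw [ellPt, ← hθ, Complex.ofReal_mul, Complex.ofReal_cos, Complex.cos]
  push_cast
  have e1 : Complex.exp ((θ + φ : ℂ) * Complex.I) =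
      Complex.exp (θ * Complex.I) * Complex.exp (φ * Complex.I) := by
    rw [add_mul, Complex.exp_add]
  have e2 : Complex.exp ((θ - φ : ℂ) * Complex.I) =
      Complex.exp (θ * Complex.I) / Complex.exp (φ * Complex.I) := by
    rw [sub_mul, Complex.exp_sub]
  rw [e1, e2, Complex.exp_neg, neg_mul, Complex.exp_neg]
  have h1 := Complex.exp_ne_zero (θ * Complex.I)
  have h2 := Complex.exp_ne_zero (φ * Complex.I)
  field_simp
  ring

lemma norm_ellPt_sub_mul_cos {r R x : ℝ} (hr : 0 < r) (hR : 0 < R) (φ : ℝ) :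
    ‖ellPt r R x - ((R * Real.cos φ : ℝ) : ℂ)‖ =
      R / (2 * r) *
        (‖1 - r * Complex.exp ((Real.arccos (x / R) + φ : ℝ) * Complex.I)‖ *
        ‖1 - r * Complex.exp ((Real.arccos (x / R) - φ : ℝ) * Complex.I)‖) := by
  rw [ellPt_sub_mul_cos hr, norm_mul, norm_mul, norm_mul, Complex.norm_real,
    Real.norm_of_nonneg (by positivity), ← neg_mul, ← Complex.ofReal_neg,
    Complex.norm_exp_ofReal_mul_I, mul_one]

lemma norm_mul_exp {r : ℝ} (hr : 0 < r) (α : ℝ) : ‖(r : ℂ) * Complex.exp (α * Complex.I)‖ = r := by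
  rw [norm_mul, Complex.norm_exp_ofReal_mul_I, Complex.norm_real, Real.norm_of_nonneg hr.le, mul_one]

lemma one_sub_le_norm {r : ℝ} (hr : 0 < r) (α : ℝ) :
    1 - r ≤ ‖1 - (r : ℂ) * Complex.exp (α * Complex.I)‖ := by
  have := norm_sub_norm_le (1 : ℂ) ((r : ℂ) * Complex.exp (α * Complex.I))
  rwa [norm_mul_exp hr, norm_one] at this

lemma norm_le_one_add {r : ℝ} (hr : 0 < r) (α : ℝ) :
    ‖1 - (r : ℂ) * Complex.exp (α * Complex.I)‖ ≤ 1 + r := by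
  have := norm_sub_le (1 : ℂ) ((r : ℂ) * Complex.exp (α * Complex.I))
  rwa [norm_mul_exp hr, norm_one] at this

lemma le_norm_ellPt_sub {r R x y : ℝ} (hr : 0 < r) (hr1 : r < 1) (hR : 0 < R) (hy : |y| ≤ R) :
    R / (2 * r) * (1 - r) ^ 2 ≤ ‖ellPt r R x - (y : ℂ)‖ := by
  rw [← mul_cos_arccos_div hR hy, norm_ellPt_sub_mul_cos hr hR, sq]
  have h : 0 ≤ 1 - r := by linarith
  gcongr <;> exact one_sub_le_norm hr _

lemma norm_ellPt_sub_le {r R x y : ℝ} (hr : 0 < r) (hR : 0 < R) (hy : |y| ≤ R) :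
    ‖ellPt r R x - (y : ℂ)‖ ≤ R / (2 * r) * (1 + r) ^ 2 := by
  rw [← mul_cos_arccos_div hR hy, norm_ellPt_sub_mul_cos hr hR, sq]
  gcongr <;> exact norm_le_one_add hr _

lemma abs_chebKer_le {r R : ℝ} (hr : 0 < r) (hr1 : r < 1) (hR : 0 < R) :
    ∃ C, ∀ x y, |y| ≤ R → |chebKer r R x y| ≤ C := by
  refine ⟨_, fun x y hy => abs_log_le_of_mem ?_ (le_norm_ellPt_sub hr hr1 hR hy)
    (norm_ellPt_sub_le hr hR hy)⟩
  have : 0 < 1 - r := by linarith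
  positivity

lemma measurable_chebKer (r R : ℝ) : Measurable (Function.uncurry (chebKer r R)) := by
  have := (continuous_ellPt r R).measurable
  unfold chebKer Function.uncurry
  fun_prop

lemma ellPt_re {r R x : ℝ} (hR : 0 < R) (hx : |x| ≤ R) :
    (ellPt r R x).re = (r + r⁻¹) / 2 * x := by
  rw [ellPt, ← neg_mul, ← Complex.ofReal_neg, ← Complex.ofReal_inv, Complex.re_ofReal_mul,
    Complex.add_re, Complex.re_ofReal_mul, Complex.re_ofReal_mul, Complex.exp_ofReal_mul_I_re,
    Complex.exp_ofReal_mul_I_re, Real.cos_neg]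
  nth_rewrite 3 [← mul_cos_arccos_div hR hx]
  ring

lemma ellPt_im {r R x : ℝ} :
    (ellPt r R x).im = (r - r⁻¹) / 2 * (R * Real.sin (Real.arccos (x / R))) := by
  rw [ellPt, ← neg_mul, ← Complex.ofReal_neg, ← Complex.ofReal_inv, Complex.im_ofReal_mul,
    Complex.add_im, Complex.im_ofReal_mul, Complex.im_ofReal_mul, Complex.exp_ofReal_mul_I_im,
    Complex.exp_ofReal_mul_I_im, Real.sin_neg]
  ring

lemma one_le_half_add_inv {r : ℝ} (hr : 0 < r) : 1 ≤ (r + r⁻¹) / 2 := by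
  have : r * r⁻¹ = 1 := mul_inv_cancel₀ hr.ne'
  have h : 0 < r⁻¹ := inv_pos.2 hr
  nlinarith [sq_nonneg (r - r⁻¹), sq_nonneg (r + r⁻¹ - 2)]

lemma abs_sub_le_norm_ellPt_sub {r R x y : ℝ} (hr : 0 < r) (hR : 0 < R) (hx : |x| ≤ R)
    (hy : |y| ≤ R) : |x - y| ≤ ‖ellPt r R x - (y : ℂ)‖ := by
  refine abs_le_of_sq_le_sq ?_ (norm_nonneg _)
  rw [← Complex.normSq_eq_norm_sq, Complex.normSq_apply, Complex.sub_re, Complex.sub_im,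
    ellPt_re hR hx, ellPt_im, Complex.ofReal_re, Complex.ofReal_im]
  have hA := one_le_half_add_inv hr
  set A := (r + r⁻¹) / 2 with hAdef
  have hB : ((r - r⁻¹) / 2) ^ 2 = A ^ 2 - 1 := by
    rw [hAdef]; field_simp; ring
  have hs : (R * Real.sin (Real.arccos (x / R))) ^ 2 = R ^ 2 - x ^ 2 := by
    have h1 := Real.sin_sq_add_cos_sq (Real.arccos (x / R))
    have h2 := mul_cos_arccos_div hR hx
    have h3 : x ^ 2 = R ^ 2 * Real.cos (Real.arccos (x / R)) ^ 2 := by rw [← mul_pow, h2]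
    rw [h3, mul_pow, eq_sub_iff_add_eq.2 h1]
    ring
  have hxy : x * y ≤ R ^ 2 := by
    calc x * y ≤ |x * y| := le_abs_self _
      _ = |x| * |y| := abs_mul _ _
      _ ≤ R * R := by gcongr
      _ = R ^ 2 := by ring
  have e : ((r - r⁻¹) / 2 * (R * Real.sin (Real.arccos (x / R))) - 0) *
      ((r - r⁻¹) / 2 * (R * Real.sin (Real.arccos (x / R))) - 0) = (A ^ 2 - 1) * (R ^ 2 - x ^ 2) := by
    rw [← hB, ← hs]; ring
  rw [e]
  have h3 : 0 ≤ (A - 1) * ((A + 1) * R ^ 2 - 2 * (x * y)) := by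
    apply mul_nonneg (by linarith)
    nlinarith [sq_nonneg R]
  nlinarith

lemma abs_le_abs_ellPt_re {r R x : ℝ} (hr : 0 < r) (hR : 0 < R) (hx : |x| ≤ R) :
    |x| ≤ |(ellPt r R x).re| := by
  have h := one_le_half_add_inv hr
  rw [ellPt_re hR hx, abs_mul ((r + r⁻¹) / 2), abs_of_nonneg (by linarith : 0 ≤ (r + r⁻¹) / 2)]
  nlinarith [abs_nonneg x]

lemma norm_ellPt_sub_self_le {r R x : ℝ} (hr : 0 < r) (hr1 : r < 1) (hR : 0 < R) (hx : |x| ≤ R) :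
    ‖ellPt r R x - (x : ℂ)‖ ≤ R / 2 * (r⁻¹ - r) := by
  have h1 : 1 ≤ r⁻¹ := (one_le_inv₀ hr).2 hr1.le
  set θ := Real.arccos (x / R) with hθ
  have e : ellPt r R x - (x : ℂ) = (R / 2 : ℝ) * (((r - 1 : ℝ) : ℂ) * Complex.exp (θ * Complex.I) +
      ((r⁻¹ - 1 : ℝ) : ℂ) * Complex.exp ((-θ : ℝ) * Complex.I)) := by
    nth_rewrite 2 [← mul_cos_arccos_div hR hx]
    rw [ellPt, Complex.ofReal_mul, Complex.ofReal_cos, Complex.cos, ← hθ]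
    push_cast
    rw [neg_mul]
    ring
  rw [e, norm_mul, Complex.norm_real, Real.norm_of_nonneg (by positivity)]
  gcongr
  refine (norm_add_le _ _).trans ?_
  rw [norm_mul, norm_mul, Complex.norm_exp_ofReal_mul_I, Complex.norm_exp_ofReal_mul_I,
    Complex.norm_real, Complex.norm_real, Real.norm_of_nonpos (by linarith),
    Real.norm_of_nonneg (by linarith)]
  linarith

lemma hasSum_log_norm_one_sub {r : ℝ} (hr : 0 < r) (hr1 : r < 1) (α : ℝ) :
    HasSum (fun k : ℕ => r ^ k / k * Real.cos (k * α))
      (-Real.log ‖1 - (r : ℂ) * Complex.exp (α * Complex.I)‖) := by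
  have h := Complex.hasSum_taylorSeries_neg_log (z := (r : ℂ) * Complex.exp (α * Complex.I))
    (by rw [norm_mul_exp hr]; exact hr1)
  have h2 := Complex.hasSum_re h
  rw [Complex.neg_re, Complex.log_re] at h2
  refine h2.congr_fun ?_ |> fun h => h
  intro k
  rw [mul_pow, ← Complex.exp_nat_mul, ← Complex.ofReal_pow, ← Complex.ofReal_natCast, mul_div_right_comm,
    ← Complex.ofReal_div, Complex.re_ofReal_mul, ← mul_assoc, ← Complex.ofReal_mul,
    Complex.exp_ofReal_mul_I_re]

lemma hasSum_chebKer {r R x y : ℝ} (hr : 0 < r) (hr1 : r < 1) (hR : 0 < R)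
    (hy : |y| ≤ R) :
    HasSum (fun k : ℕ => 2 * (r ^ k / k) * (cheb R k x * cheb R k y))
      (Real.log (R / 2) - Real.log r - chebKer r R x y) := by
  have h1 := (hasSum_log_norm_one_sub hr hr1 (Real.arccos (x / R) + Real.arccos (y / R))).add
    (hasSum_log_norm_one_sub hr hr1 (Real.arccos (x / R) - Real.arccos (y / R)))
  have h0 : 0 < 1 - r := by linarith
  have e : chebKer r R x y = Real.log (R / 2) - Real.log r +
      (Real.log ‖1 - r * Complex.exp ((Real.arccos (x / R) + Real.arccos (y / R) : ℝ) * Complex.I)‖ +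
      Real.log ‖1 - r * Complex.exp ((Real.arccos (x / R) - Real.arccos (y / R) : ℝ) * Complex.I)‖) := by
    rw [chebKer]
    nth_rewrite 1 [← mul_cos_arccos_div hR hy]
    rw [norm_ellPt_sub_mul_cos hr hR, Real.log_mul, Real.log_mul, ← div_div,
      Real.log_div (by positivity) hr.ne']
    · exact (h0.trans_le (one_sub_le_norm hr _)).ne'
    · exact (h0.trans_le (one_sub_le_norm hr _)).ne'
    · positivity
    · exact mul_ne_zero (h0.trans_le (one_sub_le_norm hr _)).ne'
        (h0.trans_le (one_sub_le_norm hr _)).ne'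
  convert h1 using 1
  · ext k
    rw [cheb, cheb, mul_add, mul_sub, Real.cos_add, Real.cos_sub]
    ring
  · rw [e]; ring

lemma summable_two_mul_pow_div {r : ℝ} (hr : 0 < r) (hr1 : r < 1) :
    Summable fun k : ℕ => 2 * (r ^ k / k) := by
  have h := hasSum_log_norm_one_sub hr hr1 0
  simp only [mul_zero, Real.cos_zero, mul_one] at h
  exact h.summable.mul_left 2

lemma hasSum_integral_cheb {r R : ℝ} (hr : 0 < r) (hr1 : r < 1) (ν : Measure ℝ)
    [IsProbabilityMeasure ν] {a : ℕ → ℝ} {f : ℝ → ℝ} (ha : ∀ k, |a k| ≤ 1)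
    (h : ∀ᵐ y ∂ν, HasSum (fun k : ℕ => 2 * (r ^ k / k) * (a k * cheb R k y)) (f y)) :
    HasSum (fun k : ℕ => 2 * (r ^ k / k) * (a k * ∫ y, cheb R k y ∂ν)) (∫ y, f y ∂ν) := by
  have hi : ∀ k, Integrable (cheb R k) ν := fun k =>
    integrable_of_continuous_bounded (continuous_cheb R k) (abs_cheb_le R k)
  have hF : ∀ k : ℕ, Integrable (fun y => 2 * (r ^ k / k) * (a k * cheb R k y)) ν := fun k =>
    ((hi k).const_mul _).const_mul _
  have hs : Summable fun k : ℕ => ∫ y, ‖2 * (r ^ k / k) * (a k * cheb R k y)‖ ∂ν := by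
    refine Summable.of_nonneg_of_le (fun k => integral_nonneg fun _ => norm_nonneg _) (fun k => ?_)
      (summable_two_mul_pow_div hr hr1)
    have := integral_mono (hF k).norm (integrable_const (μ := ν) (2 * (r ^ k / k))) fun y => by
      rw [norm_mul (2 * (r ^ k / k)), norm_mul (a k),
        Real.norm_of_nonneg (by positivity : 0 ≤ 2 * (r ^ k / k))]
      have h2 : ‖a k‖ * ‖cheb R k y‖ ≤ 1 * 1 := by
        gcongr
        · exact ha k
        · exact abs_cheb_le R k y
      have h3 : 0 ≤ 2 * (r ^ k / k) := by positivity
      nlinarith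
    simpa using this
  have := hasSum_integral_of_summable_integral_norm hF hs
  have e : ∫ y, f y ∂ν = ∫ y, ∑' k : ℕ, 2 * (r ^ k / k) * (a k * cheb R k y) ∂ν := by
    refine integral_congr_ae ?_
    filter_upwards [h] with y hy
    exact hy.tsum_eq.symm
  rw [e]
  simpa only [integral_const_mul] using this

lemma hasSum_discrepancy {r R : ℝ} (hr : 0 < r) (hr1 : r < 1) (hR : 0 < R) (ν : Measure ℝ)
    [IsProbabilityMeasure ν] (hν : ∀ᵐ y ∂ν, |y| ≤ R) {n : ℕ} (x : Fin n → ℝ)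
    (hx : ∀ i, |x i| ≤ R) :
    HasSum (fun k : ℕ => 2 * (r ^ k / k) * (∑ i, cheb R k (x i) - n * ∫ y, cheb R k y ∂ν) ^ 2)
      (-(∑ i, ∑ j, chebKer r R (x i) (x j)) + 2 * n * ∑ i, ∫ y, chebKer r R (x i) y ∂ν -
        n ^ 2 * ∫ z, ∫ y, chebKer r R z y ∂ν ∂ν) := by
  set c := Real.log (R / 2) - Real.log r
  set b : ℕ → ℝ := fun k => ∫ y, cheb R k y ∂ν with hb
  obtain ⟨C, hC⟩ := abs_chebKer_le hr hr1 hR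
  have hKm := measurable_chebKer r R
  have hKi : ∀ x, Integrable (fun y => chebKer r R x y) ν := fun x =>
    Integrable.of_bound (hKm.comp measurable_prodMk_left).aestronglyMeasurable C
      (hν.mono fun y hy => hC x y hy)
  have hUm : StronglyMeasurable fun z => ∫ y, chebKer r R z y ∂ν :=
    hKm.stronglyMeasurable.integral_prod_right
  have hUi : Integrable (fun z => ∫ y, chebKer r R z y ∂ν) ν :=
    Integrable.of_bound hUm.aestronglyMeasurable C (Eventually.of_forall fun z => by
      have := norm_integral_le_of_norm_le_const (f := fun y => chebKer r R z y)
        (hν.mono fun y hy => hC z y hy)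
      simpa using this)
  have hU : ∀ x, HasSum (fun k : ℕ => 2 * (r ^ k / k) * (cheb R k x * b k))
      (c - ∫ y, chebKer r R x y ∂ν) := by
    intro x
    have := hasSum_integral_cheb hr hr1 ν (a := fun k => cheb R k x)
      (f := fun y => c - chebKer r R x y) (fun k => abs_cheb_le R k x)
      (hν.mono fun y hy => hasSum_chebKer hr hr1 hR hy)
    rwa [integral_sub (integrable_const _) (hKi x), integral_const, probReal_univ, one_smul] at this
  have hb1 : ∀ k, |b k| ≤ 1 := fun k => by
    have := norm_integral_le_of_norm_le_const (μ := ν) (C := 1) (f := cheb R k)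
      (Eventually.of_forall fun y => abs_cheb_le R k y)
    simpa using this
  have hI : HasSum (fun k : ℕ => 2 * (r ^ k / k) * (b k * b k))
      (c - ∫ z, ∫ y, chebKer r R z y ∂ν ∂ν) := by
    have := hasSum_integral_cheb hr hr1 ν (a := b)
      (f := fun z => c - ∫ y, chebKer r R z y ∂ν) hb1
      (Eventually.of_forall fun z => by
        have := hU z
        simpa only [mul_comm (b _)] using this)
    rwa [integral_sub (integrable_const _) hUi, integral_const, probReal_univ, one_smul] at this
  have hK : HasSum (fun k : ℕ => ∑ i, ∑ j, 2 * (r ^ k / k) * (cheb R k (x i) * cheb R k (x j)))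
      (∑ i, ∑ j, (c - chebKer r R (x i) (x j))) :=
    hasSum_sum fun i _ => hasSum_sum fun j _ => hasSum_chebKer hr hr1 hR (hx j)
  have hU2 : HasSum (fun k : ℕ => ∑ i, 2 * (r ^ k / k) * (cheb R k (x i) * b k))
      (∑ i, (c - ∫ y, chebKer r R (x i) y ∂ν)) :=
    hasSum_sum fun i _ => hU (x i)
  have htot := (hK.sub (hU2.mul_left (2 * (n : ℝ)))).add (hI.mul_left ((n : ℝ) ^ 2))
  have e : -(∑ i, ∑ j, chebKer r R (x i) (x j)) + 2 * n * ∑ i, ∫ y, chebKer r R (x i) y ∂ν -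
      n ^ 2 * ∫ z, ∫ y, chebKer r R z y ∂ν ∂ν =
      ∑ i, ∑ j, (c - chebKer r R (x i) (x j)) -
        2 * n * ∑ i, (c - ∫ y, chebKer r R (x i) y ∂ν) +
        n ^ 2 * (c - ∫ z, ∫ y, chebKer r R z y ∂ν ∂ν) := by
    simp only [Finset.sum_sub_distrib, Finset.sum_const, Finset.card_univ, Fintype.card_fin,
      nsmul_eq_mul]
    ring
  rw [e]
  have e' : ∀ k : ℕ, 2 * (r ^ k / k) * (∑ i, cheb R k (x i) - n * b k) ^ 2 =
      ∑ i, ∑ j, 2 * (r ^ k / k) * (cheb R k (x i) * cheb R k (x j)) -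
          2 * n * ∑ i, 2 * (r ^ k / k) * (cheb R k (x i) * b k) +
        n ^ 2 * (2 * (r ^ k / k) * (b k * b k)) := by
    intro k
    simp only [← Finset.mul_sum, ← Finset.sum_mul]
    ring
  change HasSum (fun k : ℕ => 2 * (r ^ k / k) * (∑ i, cheb R k (x i) - n * b k) ^ 2) _
  rw [funext e']
  exact htot

end ChebKernel

section EqLaw

/-- The law of `τ ^ (1 / p) * cos ψ` with `τ` uniform on `[0, 1]` and `ψ` a uniform angle: the
limiting eigenvalue distribution, up to scaling. -/
def eqLaw (p : ℝ) : Measure ℝ :=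
  (unitMeas.prod unifAngle).map fun z => z.1 ^ (1 / p) * Real.cos z.2

lemma measurable_eqLaw_map (p : ℝ) :
    Measurable fun z : ℝ × ℝ => z.1 ^ (1 / p) * Real.cos z.2 := by fun_prop

instance eqLaw_isProbabilityMeasure (p : ℝ) : IsProbabilityMeasure (eqLaw p) :=
  Measure.isProbabilityMeasure_map (measurable_eqLaw_map p).aemeasurable

lemma ae_unitMeas_prod :
    ∀ᵐ z ∂(unitMeas.prod unifAngle), z.1 ∈ Set.Ioc (0 : ℝ) 1 :=
  Measure.quasiMeasurePreserving_fst.ae ae_unitMeas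

lemma abs_rpow_mul_cos_le {p τ : ℝ} (hp : 0 < p) (hτ : τ ∈ Set.Ioc (0 : ℝ) 1) (ψ : ℝ) :
    |τ ^ (1 / p) * Real.cos ψ| ≤ 1 := by
  have h := rpow_one_div_le_one hp hτ
  have h0 : 0 < τ ^ (1 / p) := Real.rpow_pos_of_pos hτ.1 _
  rw [abs_mul, abs_of_pos h0]
  exact mul_le_one₀ h (abs_nonneg _) (Real.abs_cos_le_one ψ)

lemma ae_eqLaw {p : ℝ} (hp : 0 < p) : ∀ᵐ y ∂(eqLaw p), |y| ≤ 1 := by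
  rw [eqLaw, ae_map_iff (measurable_eqLaw_map p).aemeasurable
    (measurableSet_le (by fun_prop) measurable_const)]
  filter_upwards [ae_unitMeas_prod] with z hz
  exact abs_rpow_mul_cos_le hp hz z.2

lemma integral_eqLaw {p C : ℝ} (hp : 0 < p) {f : ℝ → ℝ} (hf : Measurable f)
    (hC : ∀ y, |y| ≤ 1 → |f y| ≤ C) :
    Integrable (fun τ => ∫ ψ, f (τ ^ (1 / p) * Real.cos ψ) ∂unifAngle) unitMeas ∧
    ∫ y, f y ∂(eqLaw p) =
      ∫ τ, ∫ ψ, f (τ ^ (1 / p) * Real.cos ψ) ∂unifAngle ∂unitMeas := by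
  have hi : Integrable (fun z : ℝ × ℝ => f (z.1 ^ (1 / p) * Real.cos z.2))
      (unitMeas.prod unifAngle) :=
    Integrable.of_bound (hf.comp (measurable_eqLaw_map p)).aestronglyMeasurable C
      (ae_unitMeas_prod.mono fun z hz => hC _ (abs_rpow_mul_cos_le hp hz z.2))
  refine ⟨hi.integral_prod_left, ?_⟩
  rw [eqLaw, integral_map (measurable_eqLaw_map p).aemeasurable hf.aestronglyMeasurable,
    integral_prod _ hi]

lemma integral_abs_rpow_eqLaw {p q : ℝ} (hp : 0 < p) (hq : 0 < q) :
    ∫ y, |y| ^ q ∂(eqLaw p) = p / (p + q) * cosMoment q := by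
  have h := (integral_eqLaw hp (f := fun y => |y| ^ q) (C := 1) (by fun_prop) fun y hy => by
    rw [abs_of_nonneg (by positivity)]
    exact Real.rpow_le_one (abs_nonneg _) hy hq.le).2
  rw [h]
  have h1 : ∫ τ, ∫ ψ, |τ ^ (1 / p) * Real.cos ψ| ^ q ∂unifAngle ∂unitMeas =
      ∫ τ, τ ^ (q / p) * cosMoment q ∂unitMeas := by
    refine integral_congr_ae ?_
    filter_upwards [ae_unitMeas] with τ hτ
    rw [cosMoment, ← integral_const_mul]
    congr 1
    ext ψ
    have h0 : 0 < τ ^ (1 / p) := Real.rpow_pos_of_pos hτ.1 _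
    rw [abs_mul, abs_of_pos h0, Real.mul_rpow h0.le (abs_nonneg _), ← Real.rpow_mul hτ.1.le]
    congr 2
    ring
  rw [h1, integral_mul_const, integral_unitMeas,
    integral_rpow (Or.inl (by have : 0 < q / p := by positivity
                              linarith))]
  have h2 : q / p + 1 ≠ 0 := by positivity
  rw [Real.one_rpow, Real.zero_rpow h2]
  field_simp
  ring

/-- The potential of the equilibrium law with respect to the regularized kernel. -/
def chebPot (p r R x : ℝ) : ℝ := ∫ y, chebKer r R x y ∂(eqLaw p)

/-- The regularization error of the potential. -/
def potErr (p δ : ℝ) : ℝ := ∫ τ, Real.arcosh (1 + δ / τ ^ (1 / p)) ∂unitMeas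

lemma integrable_potErr {p δ : ℝ} (hp : 0 < p) (hδ : 0 ≤ δ) :
    Integrable (fun τ : ℝ => Real.arcosh (1 + δ / τ ^ (1 / p))) unitMeas := by
  refine integrable_arcosh_unitMeas (C := 1 + δ) (p := p) (by linarith) (by fun_prop)
    (fun τ hτ => ?_) fun τ hτ => ?_
  · have h0 : 0 < τ ^ (1 / p) := Real.rpow_pos_of_pos hτ.1 _
    have : 0 ≤ δ / τ ^ (1 / p) := by positivity
    linarith
  · have h0 : 0 < τ ^ (1 / p) := Real.rpow_pos_of_pos hτ.1 _
    rw [add_div]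
    gcongr
    rw [le_div_iff₀ h0, one_mul]
    exact rpow_one_div_le_one hp hτ

lemma tendsto_potErr {p : ℝ} (hp : 0 < p) :
    Tendsto (potErr p) (nhdsWithin 0 (Set.Ioi 0)) (nhds 0) := by
  have h : Tendsto (potErr p) (nhdsWithin 0 (Set.Ioi 0)) (nhds (∫ τ, (0 : ℝ) ∂unitMeas)) := by
    refine tendsto_integral_filter_of_dominated_convergence
      (fun τ => Real.log (2 * 2) - 1 / p * Real.log τ) ?_ ?_ ?_ ?_
    · exact Eventually.of_forall fun δ =>
        (measurable_arcosh.comp (by fun_prop)).aestronglyMeasurable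
    · have h1 : ∀ᶠ δ : ℝ in nhdsWithin 0 (Set.Ioi 0), δ < 1 :=
        nhdsWithin_le_nhds (gt_mem_nhds one_pos)
      filter_upwards [self_mem_nhdsWithin, h1] with δ hδ hδ1
      have hδ0 : 0 < δ := hδ
      filter_upwards [ae_unitMeas] with τ hτ
      have h0 : 0 < τ ^ (1 / p) := Real.rpow_pos_of_pos hτ.1 _
      have h2 : 0 ≤ δ / τ ^ (1 / p) := by positivity
      refine abs_arcosh_le (by norm_num) hτ.1 (by linarith) ?_
      rw [show (2 : ℝ) = 1 + 1 by norm_num, add_div]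
      gcongr
      rw [le_div_iff₀ h0, one_mul]
      exact rpow_one_div_le_one hp hτ
    · exact (integrable_const _).sub (integrable_log_unitMeas.const_mul _)
    · filter_upwards [ae_unitMeas] with τ hτ
      have h0 : 0 < τ ^ (1 / p) := Real.rpow_pos_of_pos hτ.1 _
      refine tendsto_arcosh_one_add.comp (tendsto_nhdsWithin_iff.2 ⟨?_, ?_⟩)
      · have : Tendsto (fun δ : ℝ => δ / τ ^ (1 / p)) (nhds 0) (nhds (0 / τ ^ (1 / p))) :=
          tendsto_id.div_const _
        rw [zero_div] at this
        exact this.mono_left nhdsWithin_le_nhds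
      · filter_upwards [self_mem_nhdsWithin] with δ hδ
        have : (0 : ℝ) < δ := hδ
        exact Set.mem_Ioi.2 (by positivity)
  simpa using h

lemma integral_chebKer_cos (r R x : ℝ) {t : ℝ} (ht : 0 < t) :
    ∫ ψ, chebKer r R x (t * Real.cos ψ) ∂unifAngle = Real.log (t / 2) +
      Real.arcosh ((‖ellPt r R x - (t : ℂ)‖ + ‖ellPt r R x + (t : ℂ)‖) / (2 * t)) := by
  unfold chebKer
  exact integral_log_norm_sub_cos (ellPt r R x) ht

lemma integral_chebPot {p r R : ℝ} (hp : 0 < p) (hr : 0 < r) (hr1 : r < 1) (hR : 1 ≤ R) (x : ℝ) :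
    Integrable (fun τ => ∫ ψ, chebKer r R x (τ ^ (1 / p) * Real.cos ψ) ∂unifAngle) unitMeas ∧
    chebPot p r R x =
      ∫ τ, ∫ ψ, chebKer r R x (τ ^ (1 / p) * Real.cos ψ) ∂unifAngle ∂unitMeas := by
  obtain ⟨C, hC⟩ := abs_chebKer_le hr hr1 (by linarith : 0 < R)
  have hm : Measurable (chebKer r R x) := by
    unfold chebKer
    fun_prop
  exact integral_eqLaw hp hm (C := C) fun y hy => hC x y (hy.trans hR)

lemma chebPot_eq {p r R : ℝ} (hp : 0 < p) (hr : 0 < r) (hr1 : r < 1) (hR : 1 ≤ R) (x : ℝ) :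
    Integrable (fun τ : ℝ => Real.log (τ ^ (1 / p) / 2) + Real.arcosh
      ((‖ellPt r R x - ((τ ^ (1 / p) : ℝ) : ℂ)‖ + ‖ellPt r R x + ((τ ^ (1 / p) : ℝ) : ℂ)‖) /
        (2 * τ ^ (1 / p)))) unitMeas ∧
    chebPot p r R x = ∫ τ : ℝ, (Real.log (τ ^ (1 / p) / 2) + Real.arcosh
      ((‖ellPt r R x - ((τ ^ (1 / p) : ℝ) : ℂ)‖ + ‖ellPt r R x + ((τ ^ (1 / p) : ℝ) : ℂ)‖) /
        (2 * τ ^ (1 / p)))) ∂unitMeas := by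
  have h := integral_chebPot hp hr hr1 hR x
  have e := ae_unitMeas.mono fun τ hτ =>
    integral_chebKer_cos r R x (Real.rpow_pos_of_pos hτ.1 (1 / p))
  exact ⟨h.1.congr e, h.2.trans (integral_congr_ae e)⟩

lemma log_rpow_div_two {p τ : ℝ} (hτ : 0 < τ) :
    Real.log (τ ^ (1 / p) / 2) = 1 / p * Real.log τ - Real.log 2 := by
  rw [Real.log_div (Real.rpow_pos_of_pos hτ _).ne' two_ne_zero, log_rpow_inv hτ]

lemma integral_log_rpow_div_two_add {p : ℝ} {f : ℝ → ℝ} (hf : Integrable f unitMeas) :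
    ∫ τ, (1 / p * Real.log τ - Real.log 2 + f τ) ∂unitMeas =
      -(1 / p) - Real.log 2 + ∫ τ, f τ ∂unitMeas := by
  have h1 : Integrable (fun τ => 1 / p * Real.log τ) unitMeas := integrable_log_unitMeas.const_mul _
  have h2 : Integrable (fun τ => 1 / p * Real.log τ - Real.log 2) unitMeas :=
    h1.sub (integrable_const _)
  rw [integral_add h2 hf, integral_sub h1 (integrable_const _),
    integral_const_mul, integral_log_unitMeas]
  simp

lemma le_chebPot {p r R x : ℝ} (hp : 0 < p) (hr : 0 < r) (hr1 : r < 1) (hR : 1 ≤ R)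
    (hx : |x| ≤ R) : -(1 / p) - Real.log 2 + potFun p x ≤ chebPot p r R x := by
  obtain ⟨h1, h2⟩ := chebPot_eq hp hr hr1 hR x
  rw [h2, potFun, ← integral_log_rpow_div_two_add (integrable_potFun hp x)]
  refine integral_mono_ae (((integrable_log_unitMeas.const_mul _).sub (integrable_const _)).add
    (integrable_potFun hp x)) h1 ?_
  filter_upwards [ae_unitMeas] with τ hτ
  have h0 : 0 < τ ^ (1 / p) := Real.rpow_pos_of_pos hτ.1 _
  rw [log_rpow_div_two hτ.1]
  gcongr
  refine arcosh_mono (le_max_right _ _) (le_trans ?_ (max_div_le_joukowski_arg _ h0))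
  have := abs_le_abs_ellPt_re hr (by linarith : 0 < R) hx
  gcongr

lemma chebPot_le {p r R x : ℝ} (hp : 0 < p) (hr : 0 < r) (hr1 : r < 1) (hR : 1 ≤ R)
    (hx : |x| ≤ R) :
    chebPot p r R x ≤ -(1 / p) - Real.log 2 + potFun p x + potErr p (R / 2 * (r⁻¹ - r)) := by
  obtain ⟨h1, h2⟩ := chebPot_eq hp hr hr1 hR x
  have hr2 : 1 ≤ r⁻¹ := (one_le_inv₀ hr).2 hr1.le
  set δ := R / 2 * (r⁻¹ - r) with hδ
  have hδ0 : 0 ≤ δ := mul_nonneg (by linarith) (by linarith)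
  have hi : Integrable (fun τ : ℝ => Real.arcosh (max (|x| / τ ^ (1 / p)) 1) +
      Real.arcosh (1 + δ / τ ^ (1 / p))) unitMeas := (integrable_potFun hp x).add (integrable_potErr hp hδ0)
  rw [h2, add_assoc, potFun, potErr, ← integral_add (integrable_potFun hp x)
    (integrable_potErr hp hδ0), ← integral_log_rpow_div_two_add hi]
  refine integral_mono_ae h1 (((integrable_log_unitMeas.const_mul _).sub (integrable_const _)).add
    hi) ?_
  filter_upwards [ae_unitMeas] with τ hτ
  have h0 : 0 < τ ^ (1 / p) := Real.rpow_pos_of_pos hτ.1 _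
  rw [log_rpow_div_two hτ.1]
  gcongr
  refine le_trans ?_ (arcosh_add_le (le_max_right _ _) (by positivity))
  refine arcosh_mono (one_le_joukowski_arg _ h0) ?_
  set t := τ ^ (1 / p) with ht
  have hd := norm_ellPt_sub_self_le hr hr1 (by linarith : 0 < R) hx
  rw [← hδ] at hd
  have h3 : ‖ellPt r R x - (t : ℂ)‖ ≤ δ + |x - t| := by
    rw [← norm_ofReal_sub_ofReal]
    exact (norm_sub_le_norm_sub_add_norm_sub _ (x : ℂ) _).trans (by gcongr)
  have h4 : ‖ellPt r R x + (t : ℂ)‖ ≤ δ + |x + t| := by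
    have e : ellPt r R x + (t : ℂ) = (ellPt r R x - x) + ((x + t : ℝ) : ℂ) := by push_cast; ring
    rw [e]
    refine (norm_add_le _ _).trans ?_
    rw [Complex.norm_real, Real.norm_eq_abs]
    gcongr
  have h5 : |x - t| + |x + t| ≤ 2 * (t * max (|x| / t) 1) := by
    rw [mul_max_of_nonneg _ _ h0.le, mul_div_cancel₀ _ h0.ne', mul_one]
    have m1 := le_max_left |x| t
    have m2 := le_max_right |x| t
    rcases abs_cases (x - t) with h | h <;> rcases abs_cases (x + t) with h' | h' <;>
      rcases abs_cases x with h'' | h'' <;> linarith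
  rw [div_le_iff₀ (by positivity)]
  have e : (max (|x| / t) 1 + δ / t) * (2 * t) = 2 * (t * max (|x| / t) 1) + 2 * δ := by
    field_simp
  rw [e]
  linarith

end EqLaw

section Energy

lemma chebKer_comm {r R x y : ℝ} (hr : 0 < r) (hr1 : r < 1) (hR : 0 < R) (hx : |x| ≤ R)
    (hy : |y| ≤ R) : chebKer r R x y = chebKer r R y x := by
  have h1 := hasSum_chebKer (x := x) hr hr1 hR hy
  have h2 := hasSum_chebKer (x := y) hr hr1 hR hx
  simp only [mul_comm (cheb R _ y)] at h2
  have := h1.unique h2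
  linarith

lemma sum_lowerIdx_symm {n : ℕ} (f : Fin n → Fin n → ℝ) (hf : ∀ i j, f i j = f j i) :
    ∑ i, ∑ j, f i j = 2 * ∑ ij : LowerIdx n, f ij.1.1 ij.1.2 + ∑ i, f i i := by
  have h1 : ∀ g : Fin n → Fin n → ℝ, ∑ ij : LowerIdx n, g ij.1.1 ij.1.2 =
      ∑ i, ∑ j, if j < i then g i j else 0 := by
    intro g
    rw [← Finset.sum_subtype (p := fun ij : Fin n × Fin n => ij.2 < ij.1)
      (Finset.univ.filter fun ij : Fin n × Fin n => ij.2 < ij.1) (by simp)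
      (fun ij => g ij.1 ij.2), Finset.sum_filter, Fintype.sum_prod_type]
  have h2 : ∑ i, ∑ j, (if j < i then f i j else 0) = ∑ i, ∑ j, (if i < j then f i j else 0) := by
    rw [Finset.sum_comm]
    refine Finset.sum_congr rfl fun i _ => Finset.sum_congr rfl fun j _ => ?_
    rw [hf]
  have h3 : ∑ i, f i i = ∑ i, ∑ j, if i = j then f i j else 0 := by simp
  rw [two_mul, h1]
  nth_rewrite 2 [h2]
  rw [h3, ← Finset.sum_add_distrib, ← Finset.sum_add_distrib]
  refine Finset.sum_congr rfl fun i _ => ?_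
  rw [← Finset.sum_add_distrib, ← Finset.sum_add_distrib]
  refine Finset.sum_congr rfl fun j _ => ?_
  rcases lt_trichotomy i j with h | h | h
  · simp [h, h.not_gt, h.ne]
  · simp [h]
  · simp [h, h.not_gt, h.ne']

lemma vand_le_exp {r R : ℝ} (hr : 0 < r) (hr1 : r < 1) (hR : 0 < R) {n : ℕ} {x : Fin n → ℝ}
    (hx : ∀ i, |x i| ≤ R) :
    vand x ≤ Real.exp (∑ ij : LowerIdx n, chebKer r R (x ij.1.1) (x ij.1.2)) := by
  rw [vand, Real.exp_sum]
  refine Finset.prod_le_prod (fun _ _ => abs_nonneg _) fun ij _ => ?_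
  have h0 : 0 < 1 - r := by linarith
  have h1 : 0 < R / (2 * r) * (1 - r) ^ 2 := by positivity
  rw [chebKer, Real.exp_log (h1.trans_le (le_norm_ellPt_sub hr hr1 hR (hx _))), abs_sub_comm]
  exact abs_sub_le_norm_ellPt_sub hr hR (hx _) (hx _)

lemma measurable_chebPot (p r R : ℝ) : Measurable (chebPot p r R) :=
  (StronglyMeasurable.integral_prod_right (measurable_chebKer r R).stronglyMeasurable).measurable

lemma integrable_chebPot {p r R : ℝ} (hp : 0 < p) (hr : 0 < r) (hr1 : r < 1) (hR : 1 ≤ R) :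
    Integrable (chebPot p r R) (eqLaw p) := by
  obtain ⟨C, hC⟩ := abs_chebKer_le hr hr1 (by linarith : 0 < R)
  refine Integrable.of_bound (measurable_chebPot p r R).aestronglyMeasurable C
    (Eventually.of_forall fun z => ?_)
  have := norm_integral_le_of_norm_le_const (f := fun y => chebKer r R z y)
    ((ae_eqLaw hp).mono fun y hy => hC z y (hy.trans hR))
  simpa [chebPot] using this

lemma le_integral_chebPot {p r R : ℝ} (hp : 0 < p) (hr : 0 < r) (hr1 : r < 1) (hR : 1 ≤ R) :
    -(1 / p) - Real.log 2 + potFun p 1 * (cosMoment p / 2) ≤ ∫ z, chebPot p r R z ∂(eqLaw p) := by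
  have hi : Integrable (fun y : ℝ => |y| ^ p) (eqLaw p) :=
    Integrable.of_bound (measurable_id.abs.pow_const p).aestronglyMeasurable 1 ((ae_eqLaw hp).mono fun y hy => by
      rw [Real.norm_of_nonneg (by positivity)]
      exact Real.rpow_le_one (abs_nonneg _) hy hp.le)
  have e : ∫ y, (-(1 / p) - Real.log 2 + potFun p 1 * |y| ^ p) ∂(eqLaw p) =
      -(1 / p) - Real.log 2 + potFun p 1 * (cosMoment p / 2) := by
    rw [integral_add (integrable_const _) (hi.const_mul _), integral_const, probReal_univ, one_smul,
      integral_const_mul, integral_abs_rpow_eqLaw hp hp]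
    congr 2
    field_simp
    ring
  rw [← e]
  refine integral_mono_ae ((integrable_const _).add (hi.const_mul _))
    (integrable_chebPot hp hr hr1 hR) ?_
  filter_upwards [ae_eqLaw hp] with y hy
  rw [← potFun_of_le hp hy]
  exact le_chebPot hp hr hr1 hR (hy.trans hR)

lemma sum_chebPot_le {p r R : ℝ} (hp : 0 < p) (hr : 0 < r) (hr1 : r < 1) (hR : 1 ≤ R) {n : ℕ}
    {x : Fin n → ℝ} (hx : ∀ i, |x i| ≤ R) (hxp : x ∈ lpBall n p (critRad p n)) :
    ∑ i, chebPot p r R (x i) ≤ n * (-(1 / p) - Real.log 2 + potErr p (R / 2 * (r⁻¹ - r)) +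
      potFun p 1 * (cosMoment p / 2)) := by
  set E := potErr p (R / 2 * (r⁻¹ - r))
  calc ∑ i, chebPot p r R (x i)
      ≤ ∑ i, (-(1 / p) - Real.log 2 + E + potFun p 1 * |x i| ^ p) := by
        refine Finset.sum_le_sum fun i _ => ?_
        have h1 := chebPot_le hp hr hr1 hR (hx i)
        have h2 := potFun_le hp (x i)
        linarith
    _ = n * (-(1 / p) - Real.log 2 + E) + potFun p 1 * ∑ i, |x i| ^ p := by
        rw [Finset.sum_add_distrib, Finset.sum_const, Finset.card_univ, Fintype.card_fin,
          nsmul_eq_mul, Finset.mul_sum]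
    _ ≤ n * (-(1 / p) - Real.log 2 + E) + potFun p 1 * (cosMoment p / 2 * n) := by
        have := potFun_one_nonneg p
        gcongr
        exact hxp
    _ = _ := by ring

/-- Upper bound for the Coulomb gas density with a quantitative penalty for deviating from the
equilibrium law. -/
lemma vand_pow_le {p r R : ℝ} (hp : 0 < p) (hr : 0 < r) (hr1 : r < 1) (hR : 1 ≤ R) {n : ℕ}
    {x : Fin n → ℝ} (hx : ∀ i, |x i| ≤ R) (hxp : x ∈ lpBall n p (critRad p n)) (β K : ℕ) :
    vand x ^ β ≤ Real.exp (β / 2 * (n ^ 2 * (-(1 / (2 * p)) - Real.log 2 +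
      2 * potErr p (R / 2 * (r⁻¹ - r))) - n * Real.log (R / (2 * r) * (1 - r) ^ 2) -
      ∑ k ∈ Finset.range K, 2 * (r ^ k / k) *
        (∑ i, cheb R k (x i) - n * ∫ y, cheb R k y ∂(eqLaw p)) ^ 2)) := by
  have hR0 : 0 < R := by linarith
  have h0 : 0 < 1 - r := by linarith
  set E := potErr p (R / 2 * (r⁻¹ - r))
  set D := ∑ k ∈ Finset.range K, 2 * (r ^ k / k) *
        (∑ i, cheb R k (x i) - n * ∫ y, cheb R k y ∂(eqLaw p)) ^ 2 with hD
  have hdisc := hasSum_discrepancy hr hr1 hR0 (eqLaw p)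
    ((ae_eqLaw hp).mono fun y hy => hy.trans hR) x hx
  have hle := sum_le_hasSum (Finset.range K) (fun k _ => by positivity) hdisc
  rw [← hD] at hle
  have hsum := sum_lowerIdx_symm (fun i j => chebKer r R (x i) (x j))
    fun i j => chebKer_comm hr hr1 hR0 (hx i) (hx j)
  have hdiag : n * Real.log (R / (2 * r) * (1 - r) ^ 2) ≤ ∑ i, chebKer r R (x i) (x i) := by
    have : ∑ i : Fin n, Real.log (R / (2 * r) * (1 - r) ^ 2) =
        n * Real.log (R / (2 * r) * (1 - r) ^ 2) := by simp
    rw [← this]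
    refine Finset.sum_le_sum fun i _ => Real.log_le_log (by positivity)
      (le_norm_ellPt_sub hr hr1 hR0 (hx i))
  have hU := sum_chebPot_le hp hr hr1 hR hx hxp
  have hI := le_integral_chebPot hp hr hr1 hR
  have hk := potFun_one_mul_cosMoment_le hp
  simp only [chebPot] at hU hI
  set I := ∫ z, ∫ y, chebKer r R z y ∂(eqLaw p) ∂(eqLaw p)
  set S := ∑ i, ∫ y, chebKer r R (x i) y ∂(eqLaw p)
  set L := ∑ ij : LowerIdx n, chebKer r R (x ij.1.1) (x ij.1.2)
  have hn : (0 : ℝ) ≤ n := Nat.cast_nonneg n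
  have hmain : 2 * L ≤ n ^ 2 * (-(1 / (2 * p)) - Real.log 2 + 2 * E) -
      n * Real.log (R / (2 * r) * (1 - r) ^ 2) - D := by
    have a1 := mul_le_mul_of_nonneg_left hU hn
    have a2 := mul_le_mul_of_nonneg_left hI (sq_nonneg (n : ℝ))
    have a3 := mul_le_mul_of_nonneg_left hk (sq_nonneg (n : ℝ))
    have e1 : 1 / (2 * p) = 1 / p / 2 := by field_simp
    rw [e1]
    nlinarith
  calc vand x ^ β ≤ Real.exp L ^ β := by
        gcongr
        · exact vand_nonneg x
        · exact vand_le_exp hr hr1 hR0 hx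
    _ = Real.exp (β / 2 * (2 * L)) := by
        rw [← Real.exp_nat_mul]
        congr 1
        ring
    _ ≤ _ := by gcongr

end Energy

section Concentration

lemma exists_sum_cos_eq_eval_cos (P : Polynomial ℝ) :
    ∃ (K : ℕ) (c : ℕ → ℝ), ∀ θ : ℝ, P.eval (Real.cos θ) =
      ∑ k ∈ Finset.range K, c k * Real.cos (k * θ) := by
  set v : ℕ → ℝ → ℝ := fun k θ => Real.cos (k * θ) with hv
  set V := Submodule.span ℝ (Set.range v) with hV
  have hmul : ∀ f ∈ V, (fun θ => Real.cos θ * f θ) ∈ V := by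
    intro f hf
    induction hf using Submodule.span_induction with
    | mem f hf =>
      obtain ⟨k, rfl⟩ := hf
      rcases k with _ | k
      · have : (fun θ => Real.cos θ * v 0 θ) = v 1 := by ext θ; simp [hv]
        rw [this]
        exact Submodule.subset_span ⟨1, rfl⟩
      · have : (fun θ => Real.cos θ * v (k + 1) θ) = (1 / 2 : ℝ) • (v (k + 2) + v k) := by
          ext θ
          simp only [hv, Pi.smul_apply, Pi.add_apply, smul_eq_mul, Nat.cast_add, Nat.cast_one,
            Nat.cast_ofNat]
          rw [show ((k : ℝ) + 2) * θ = (k + 1) * θ + θ by ring,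
            show (k : ℝ) * θ = (k + 1) * θ - θ by ring, Real.cos_add, Real.cos_sub]
          ring
        rw [this]
        exact V.smul_mem _ (V.add_mem (Submodule.subset_span ⟨_, rfl⟩)
          (Submodule.subset_span ⟨_, rfl⟩))
    | zero =>
      have : (fun θ => Real.cos θ * (0 : ℝ → ℝ) θ) = 0 := by ext θ; simp
      rw [this]
      exact V.zero_mem
    | add f g _ _ hf hg =>
      have := V.add_mem hf hg
      convert this using 1
      ext θ
      simp [mul_add]
    | smul a f _ hf =>
      have := V.smul_mem a hf
      convert this using 1
      ext θ
      simp only [Pi.smul_apply, smul_eq_mul]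
      ring
  have hpow : ∀ m : ℕ, (fun θ => Real.cos θ ^ m) ∈ V := by
    intro m
    induction m with
    | zero =>
      have : (fun θ : ℝ => Real.cos θ ^ 0) = v 0 := by ext θ; simp [hv]
      rw [this]
      exact Submodule.subset_span ⟨0, rfl⟩
    | succ m ih =>
      have := hmul _ ih
      convert this using 1
      ext θ
      ring
  have hP : (fun θ => P.eval (Real.cos θ)) ∈ V := by
    have : (fun θ => P.eval (Real.cos θ)) =
        ∑ m ∈ Finset.range (P.natDegree + 1), P.coeff m • fun θ => Real.cos θ ^ m := by
      ext θ
      simp [Polynomial.eval_eq_sum_range]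
    rw [this]
    exact V.sum_mem fun m _ => V.smul_mem _ (hpow m)
  obtain ⟨c, hc⟩ := Finsupp.mem_span_range_iff_exists_finsupp.1 hP
  obtain ⟨K, hK⟩ := c.support.exists_nat_subset_range
  refine ⟨K, c, fun θ => ?_⟩
  have := congrFun hc θ
  rw [← this, Finsupp.sum_of_support_subset c hK _ (by simp)]
  simp [hv]

lemma exists_cheb_approx {R q ε : ℝ} (hR : 0 < R) (hq : 0 < q) (hε : 0 < ε) :
    ∃ (K : ℕ) (c : ℕ → ℝ), ∀ x : ℝ, |x| ≤ R →
      |∑ k ∈ Finset.range K, c k * cheb R k x - |x| ^ q| ≤ ε := by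
  have hc : Continuous fun u : ℝ => |R * u| ^ q :=
    (continuous_const.mul continuous_id).abs.rpow_const fun _ => Or.inr hq.le
  obtain ⟨P, hP⟩ := exists_polynomial_near_of_continuousOn (-1) 1 _ hc.continuousOn ε hε
  obtain ⟨K, c, hKc⟩ := exists_sum_cos_eq_eval_cos P
  refine ⟨K, c, fun x hx => ?_⟩
  have h1 := mul_cos_arccos_div hR hx
  have h2 := hP (Real.cos (Real.arccos (x / R))) ⟨Real.neg_one_le_cos _, Real.cos_le_one _⟩
  rw [h1, hKc] at h2
  exact h2.le

lemma exists_penalty {p q R ε : ℝ} (hp : 0 < p) (hq : 0 < q) (hR : 1 ≤ R) (hε : 0 < ε) :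
    ∃ (K : ℕ) (δ : ℝ), 0 < δ ∧ ∀ r : ℝ, 1 / 2 ≤ r → r < 1 → ∀ (n : ℕ) (x : Fin n → ℝ),
      (∀ i, |x i| ≤ R) → ε * n ≤ |∑ i, |x i| ^ q - n * (p / (p + q) * cosMoment q)| →
      δ * n ^ 2 ≤ ∑ k ∈ Finset.range K, 2 * (r ^ k / k) *
        (∑ i, cheb R k (x i) - n * ∫ y, cheb R k y ∂(eqLaw p)) ^ 2 := by
  have hR0 : 0 < R := by linarith
  obtain ⟨K, c, hKc⟩ := exists_cheb_approx hR0 hq (by positivity : 0 < ε / 4)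
  set b : ℕ → ℝ := fun k => ∫ y, cheb R k y ∂(eqLaw p) with hb
  set A := ∑ k ∈ Finset.range K, c k ^ 2 * (k * 2 ^ k) with hA
  have hA0 : 0 ≤ A := Finset.sum_nonneg fun k _ => by positivity
  have hci : ∀ k : ℕ, Integrable (cheb R k) (eqLaw p) := fun k =>
    integrable_of_continuous_bounded (continuous_cheb R k) (abs_cheb_le R k)
  have hqi : Integrable (fun y : ℝ => |y| ^ q) (eqLaw p) :=
    Integrable.of_bound (measurable_id.abs.pow_const q).aestronglyMeasurable 1
      ((ae_eqLaw hp).mono fun y hy => by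
        rw [Real.norm_of_nonneg (by positivity)]
        exact Real.rpow_le_one (abs_nonneg _) hy hq.le)
  have hInt : |∑ k ∈ Finset.range K, c k * b k - p / (p + q) * cosMoment q| ≤ ε / 4 := by
    have e : ∑ k ∈ Finset.range K, c k * b k - p / (p + q) * cosMoment q =
        ∫ y, (∑ k ∈ Finset.range K, c k * cheb R k y - |y| ^ q) ∂(eqLaw p) := by
      rw [integral_sub (integrable_finsetSum _ fun k _ => (hci k).const_mul _) hqi,
        integral_finsetSum _ fun k _ => (hci k).const_mul _, integral_abs_rpow_eqLaw hp hq]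
      simp only [integral_const_mul, hb]
    rw [e]
    have := norm_integral_le_of_norm_le_const (μ := eqLaw p)
      (f := fun y => ∑ k ∈ Finset.range K, c k * cheb R k y - |y| ^ q) (C := ε / 4)
      ((ae_eqLaw hp).mono fun y hy => hKc y (hy.trans hR))
    simpa using this
  refine ⟨K, ε ^ 2 / (4 * (A + 1)), by positivity, fun r hr hr1 n x hx hdev => ?_⟩
  have hr0 : 0 < r := by linarith
  set D : ℕ → ℝ := fun k => ∑ i, cheb R k (x i) - n * b k with hD
  set W := ∑ k ∈ Finset.range K, 2 * (r ^ k / k) * D k ^ 2 with hW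
  change _ ≤ W
  have hW0 : 0 ≤ W := Finset.sum_nonneg fun k _ => by positivity
  have hD0 : D 0 = 0 := by simp [hD, hb, cheb]
  have hsum : ∑ k ∈ Finset.range K, c k * D k =
      ∑ i, ∑ k ∈ Finset.range K, c k * cheb R k (x i) -
        n * ∑ k ∈ Finset.range K, c k * b k := by
    simp only [hD, mul_sub, Finset.sum_sub_distrib, Finset.mul_sum]
    rw [Finset.sum_comm]
    congr 1
    exact Finset.sum_congr rfl fun k _ => by ring
  have h1 : |∑ i, ∑ k ∈ Finset.range K, c k * cheb R k (x i) - ∑ i, |x i| ^ q| ≤ n * (ε / 4) := by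
    rw [← Finset.sum_sub_distrib]
    refine (Finset.abs_sum_le_sum_abs _ _).trans ?_
    refine (Finset.sum_le_sum fun i _ => hKc (x i) (hx i)).trans ?_
    simp
  have h2 : |n * ∑ k ∈ Finset.range K, c k * b k - n * (p / (p + q) * cosMoment q)| ≤
      n * (ε / 4) := by
    rw [← mul_sub, abs_mul, Nat.abs_cast]
    gcongr
  have h3 : ε / 2 * n ≤ |∑ k ∈ Finset.range K, c k * D k| := by
    rw [hsum]
    rw [abs_le] at h1 h2
    rcases le_abs.1 hdev with h | h
    · exact le_abs.2 (Or.inl (by linarith))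
    · exact le_abs.2 (Or.inr (by linarith))
  have h4 : (∑ k ∈ Finset.range K, c k * D k) ^ 2 ≤ A * W := by
    have hg : ∀ k, D k ^ 2 / (k * 2 ^ k) ≤ 2 * (r ^ k / k) * D k ^ 2 := by
      intro k
      rcases Nat.eq_zero_or_pos k with rfl | hk
      · simp
      have hk' : (0 : ℝ) < k := by exact_mod_cast hk
      have h5 : (1 / 2 : ℝ) ^ k ≤ r ^ k := by gcongr
      have h6 : (1 / 2 : ℝ) ^ k / k * D k ^ 2 ≤ r ^ k / k * D k ^ 2 := by gcongr
      have h7 : 0 ≤ r ^ k / k * D k ^ 2 := by positivity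
      have h8 : D k ^ 2 / (k * 2 ^ k) = (1 / 2 : ℝ) ^ k / k * D k ^ 2 := by
        rw [one_div, inv_pow]
        field_simp
      rw [h8]
      linarith
    calc (∑ k ∈ Finset.range K, c k * D k) ^ 2
        ≤ A * ∑ k ∈ Finset.range K, D k ^ 2 / (k * 2 ^ k) := by
          refine Finset.sum_sq_le_sum_mul_sum_of_sq_le_mul _ (fun k _ => by positivity)
            (fun k _ => by positivity) fun k _ => le_of_eq ?_
          rcases Nat.eq_zero_or_pos k with rfl | hk
          · simp [hD0]
          have hk' : (0 : ℝ) < k := by exact_mod_cast hk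
          field_simp
      _ ≤ A * W := by
          exact mul_le_mul_of_nonneg_left (Finset.sum_le_sum fun k _ => hg k) hA0
  clear_value A W
  have h9 : (ε / 2 * n) ^ 2 ≤ (A + 1) * W := by
    calc (ε / 2 * n) ^ 2 ≤ |∑ k ∈ Finset.range K, c k * D k| ^ 2 :=
          pow_le_pow_left₀ (by positivity) h3 2
      _ = (∑ k ∈ Finset.range K, c k * D k) ^ 2 := sq_abs _
      _ ≤ A * W := h4
      _ ≤ (A + 1) * W := by linarith
  rw [div_mul_eq_mul_div, div_le_iff₀ (by positivity)]
  nlinarith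

lemma exists_gas_le {p R η : ℝ} (hp : 0 < p) (hR : 1 ≤ R) (hη : 0 < η) (β : ℕ) :
    ∃ r : ℝ, 1 / 2 ≤ r ∧ r < 1 ∧ ∃ C : ℝ, ∀ (n K : ℕ) (δ : ℝ) (F : Set (Fin n → ℝ)),
      MeasurableSet F → F ⊆ lpBall n p (critRad p n) → (∀ x ∈ F, ∀ i, |x i| ≤ R) →
      (∀ x ∈ F, δ * n ^ 2 ≤ ∑ k ∈ Finset.range K, 2 * (r ^ k / k) *
        (∑ i, cheb R k (x i) - n * ∫ y, cheb R k y ∂(eqLaw p)) ^ 2) →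
      gas β n F ≤ ENNReal.ofReal (Real.exp (β / 2 * (-(1 / (2 * p)) - Real.log 2 - δ + η) *
        n ^ 2 + C * n)) := by
  have hR0 : 0 < R := by linarith
  obtain ⟨r, ⟨hr, hr1⟩, hE⟩ : ∃ r : ℝ, (1 / 2 ≤ r ∧ r < 1) ∧
      potErr p (R / 2 * (r⁻¹ - r)) < η / 2 := by
    have h1 : Tendsto (fun r : ℝ => R / 2 * (r⁻¹ - r)) (nhdsWithin 1 (Set.Iio 1))
        (nhdsWithin 0 (Set.Ioi 0)) := by
      refine tendsto_nhdsWithin_iff.2 ⟨?_, ?_⟩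
      · have : ContinuousAt (fun r : ℝ => R / 2 * (r⁻¹ - r)) 1 :=
          continuousAt_const.mul ((continuousAt_inv₀ one_ne_zero).sub continuousAt_id)
        have h := this.tendsto.mono_left (nhdsWithin_le_nhds (s := Set.Iio (1 : ℝ)))
        simpa using h
      · filter_upwards [Ioo_mem_nhdsLT (show (1 / 2 : ℝ) < 1 by norm_num)] with r hr
        have h0 : 0 < r := by linarith [hr.1]
        have : 1 < r⁻¹ := (one_lt_inv₀ h0).2 hr.2
        have h3 : 0 < r⁻¹ - r := by linarith [hr.2]
        exact Set.mem_Ioi.2 (by positivity)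
    have h2 := ((tendsto_potErr hp).comp h1).eventually (gt_mem_nhds (half_pos hη))
    obtain ⟨r, hr', hr⟩ := (h2.and (Ioo_mem_nhdsLT (show (1 / 2 : ℝ) < 1 by norm_num))).exists
    exact ⟨r, ⟨hr.1.le, hr.2⟩, hr'⟩
  have hr0 : 0 < r := by linarith
  set L := Real.log (R / (2 * r) * (1 - r) ^ 2) with hL
  refine ⟨r, hr, hr1, -(β / 2 * L) + Real.log (2 * R), fun n K δ F hF hFp hFR hpen => ?_⟩
  set B := β / 2 * (-(1 / (2 * p)) - Real.log 2 - δ + η) * n ^ 2 - β / 2 * L * n with hB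
  have hv : ∀ x ∈ F, vandDens β x ≤ ENNReal.ofReal (Real.exp B) := by
    intro x hx
    refine ENNReal.ofReal_le_ofReal ((vand_pow_le hp hr0 hr1 hR (hFR x hx) (hFp hx) β K).trans ?_)
    refine Real.exp_le_exp.2 ?_
    have h1 := hpen x hx
    have h2 : (n : ℝ) ^ 2 * (2 * potErr p (R / 2 * (r⁻¹ - r))) ≤ n ^ 2 * η := by
      gcongr
      linarith
    have h3 : n ^ 2 * (-(1 / (2 * p)) - Real.log 2 + 2 * potErr p (R / 2 * (r⁻¹ - r))) -
        n * L - ∑ k ∈ Finset.range K, 2 * (r ^ k / k) *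
        (∑ i, cheb R k (x i) - n * ∫ y, cheb R k y ∂(eqLaw p)) ^ 2 ≤
        (-(1 / (2 * p)) - Real.log 2 - δ + η) * n ^ 2 - n * L := by linarith
    refine (mul_le_mul_of_nonneg_left h3 (by positivity : (0 : ℝ) ≤ β / 2)).trans (le_of_eq ?_)
    rw [hB]
    ring
  have hbox : F ⊆ Set.Icc (fun _ => -R) (fun _ => R) := fun x hx =>
    ⟨fun i => (abs_le.1 (hFR x hx i)).1, fun i => (abs_le.1 (hFR x hx i)).2⟩
  calc gas β n F = ∫⁻ x in F, vandDens β x := gas_apply β hF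
    _ ≤ ∫⁻ _ in F, ENNReal.ofReal (Real.exp B) := setLIntegral_mono measurable_const hv
    _ = ENNReal.ofReal (Real.exp B) * volume F := setLIntegral_const _ _
    _ ≤ ENNReal.ofReal (Real.exp B) * volume (Set.Icc (fun _ : Fin n => -R) (fun _ => R)) := by
        gcongr
    _ = ENNReal.ofReal (Real.exp B) * ENNReal.ofReal (Real.exp (Real.log (2 * R) * n)) := by
        rw [Real.volume_Icc_pi, Finset.prod_const, Finset.card_univ, Fintype.card_fin,
          ← ENNReal.ofReal_pow (by linarith), mul_comm (Real.log _), Real.exp_nat_mul,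
          Real.exp_log (by positivity)]
        congr 3
        ring
    _ = _ := by
        rw [← ENNReal.ofReal_mul (Real.exp_pos _).le, ← Real.exp_add, hB]
        congr 2
        ring

end Concentration

section Limits

lemma tendsto_quadratic_atTop {a : ℝ} (ha : 0 < a) (C : ℝ) :
    Tendsto (fun n : ℕ => a * (n : ℝ) ^ 2 - C * n) atTop atTop := by
  have h1 : Tendsto (fun n : ℕ => (n : ℝ) * (a * n - C)) atTop atTop :=
    tendsto_natCast_atTop_atTop.atTop_mul_atTop₀
      (tendsto_atTop_add_const_right _ (-C) (tendsto_natCast_atTop_atTop.const_mul_atTop ha))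
  refine h1.congr fun n => ?_
  ring

lemma tendsto_gasDim_div (β : ℕ) :
    Tendsto (fun n : ℕ => (gasDim β n : ℝ) / n ^ 2) atTop (nhds (β / 2)) := by
  have h1 : Tendsto (fun n : ℕ => (β / 2 : ℝ) + (1 - β / 2) * (1 / (n : ℝ))) atTop
      (nhds (β / 2 + (1 - β / 2) * 0)) :=
    tendsto_const_nhds.add (tendsto_one_div_atTop_nhds_zero_nat.const_mul _)
  simp only [mul_zero, add_zero] at h1
  refine h1.congr' ?_
  filter_upwards [eventually_gt_atTop 0] with n hn
  have : (n : ℝ) ≠ 0 := by positivity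
  rw [gasDim_eq]
  field_simp
  ring

lemma eventually_exp_le_gasVol {p η : ℝ} (hp : 0 < p) {β : ℕ} (hβ : 1 ≤ β) (hη : 0 < η) :
    ∀ᶠ n : ℕ in atTop, Real.exp ((β / 2 * (-(1 / (2 * p)) - Real.log 2) - η) * n ^ 2) ≤
      gasVol β n p (critRad p n) := by
  have hlog : Tendsto (fun n : ℕ => Real.log n / n) atTop (nhds 0) :=
    Real.isLittleO_log_id_atTop.tendsto_div_nhds_zero.comp tendsto_natCast_atTop_atTop
  have hinv : Tendsto (fun n : ℕ => 1 / (n : ℝ)) atTop (nhds 0) :=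
    tendsto_one_div_atTop_nhds_zero_nat
  have hdim := tendsto_gasDim_div β
  have hlim : Tendsto (fun n : ℕ => -(β / (4 * p) : ℝ) - β / (2 * p) * (Real.log n / n) -
      gasDim β n / (n : ℝ) ^ 2 * Real.log 2 - 2 / p * (gasDim β n / (n : ℝ) ^ 2) * (1 / n) -
      1 / n * (1 / n) - 1 / n) atTop
      (nhds (-(β / (4 * p) : ℝ) - β / (2 * p) * 0 - β / 2 * Real.log 2 -
        2 / p * (β / 2) * 0 - 0 * 0 - 0)) :=
    (((((tendsto_const_nhds.sub (hlog.const_mul _)).sub (hdim.mul_const _)).sub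
      ((hdim.const_mul _).mul hinv)).sub (hinv.mul hinv)).sub hinv)
  have hlt : β / 2 * (-(1 / (2 * p)) - Real.log 2) - η <
      -(β / (4 * p) : ℝ) - β / (2 * p) * 0 - β / 2 * Real.log 2 -
        2 / p * (β / 2) * 0 - 0 * 0 - 0 := by
    have : β / 2 * (-(1 / (2 * p)) - Real.log 2) = -(β / (4 * p) : ℝ) - β / 2 * Real.log 2 := by
      field_simp
      ring
    linarith
  filter_upwards [hlim.eventually (lt_mem_nhds hlt), eventually_gt_atTop 0] with n h1 hn
  have hn' : (0 : ℝ) < n := by exact_mod_cast hn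
  rw [← Real.le_log_iff_exp_le (gasVol_pos β n hp (critRad_pos hp hn))]
  refine le_trans ?_ (log_gasVol_lower hp hβ hn)
  have h2 : Real.log (n + 1) ≤ n := by
    have := Real.log_le_sub_one_of_pos (by linarith : (0 : ℝ) < n + 1)
    linarith
  have h3 := mul_le_mul_of_nonneg_right h1.le (by positivity : (0 : ℝ) ≤ n ^ 2)
  have h4 : (-(β / (4 * p) : ℝ) - β / (2 * p) * (Real.log n / n) -
      gasDim β n / (n : ℝ) ^ 2 * Real.log 2 - 2 / p * (gasDim β n / (n : ℝ) ^ 2) * (1 / n) -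
      1 / n * (1 / n) - 1 / n) * (n : ℝ) ^ 2 = -(β * (n : ℝ) ^ 2 / (4 * p)) -
      β * n / (2 * p) * Real.log n - gasDim β n * Real.log 2 - 2 * gasDim β n / (p * n) - 1 - n := by
    field_simp
  linarith

lemma gas_lpBall_inter_le {n β : ℕ} {p ρ R e : ℝ} {Bad : Set (Fin n → ℝ)}
    (h : gas β n (lpBall n p ρ ∩ {x | ∃ i, R < |x i|}) ≤
      ENNReal.ofReal e * gas β n (lpBall n p ρ)) :
    gas β n (lpBall n p ρ ∩ Bad) ≤ ENNReal.ofReal e * gas β n (lpBall n p ρ) +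
      gas β n (lpBall n p ρ ∩ Bad ∩ {x | ∀ i, |x i| ≤ R}) := by
  refine le_trans (measure_mono ?_) ((measure_union_le _ _).trans (add_le_add_left h _))
  rintro x ⟨hx, hb⟩
  by_cases hR : ∀ i, |x i| ≤ R
  · exact Or.inr ⟨⟨hx, hb⟩, hR⟩
  · push Not at hR
    exact Or.inl ⟨hx, hR⟩

lemma measurableSet_box (n : ℕ) (R : ℝ) : MeasurableSet {x : Fin n → ℝ | ∀ i, |x i| ≤ R} := by
  have : {x : Fin n → ℝ | ∀ i, |x i| ≤ R} = ⋂ i, {x | |x i| ≤ R} := by ext; simp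
  rw [this]
  exact MeasurableSet.iInter fun i => measurableSet_le (measurable_pi_apply i).abs measurable_const

lemma eventually_gasVol_le_exp {p η : ℝ} (hp : 0 < p) {β : ℕ} (hβ : 1 ≤ β) (hη : 0 < η) :
    ∀ᶠ n : ℕ in atTop, gasVol β n p (critRad p n) ≤
      Real.exp ((β / 2 * (-(1 / (2 * p)) - Real.log 2) + η) * n ^ 2) := by
  obtain ⟨R, hR, e, he, hout⟩ := exists_outlier_bound hβ hp
  have hβ' : (0 : ℝ) < β := by exact_mod_cast hβ
  obtain ⟨r, -, -, C, hC⟩ := exists_gas_le (η := η / β) hp (by linarith : 1 ≤ R) (by positivity) β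
  filter_upwards [hout, he.eventually (gt_mem_nhds (show (0 : ℝ) < 1 / 2 by norm_num)),
    (tendsto_quadratic_atTop (half_pos hη) C).eventually_ge_atTop (Real.log 2)] with n h1 h2 h3
  have h4 := gas_lpBall_inter_le (Bad := Set.univ) h1
  rw [Set.inter_univ] at h4
  have h5 := hC n 0 0 (lpBall n p (critRad p n) ∩ {x | ∀ i, |x i| ≤ R})
    ((measurableSet_lpBall hp _).inter (measurableSet_box n R)) Set.inter_subset_left
    (fun x hx => hx.2) (by simp)
  have h6 := h4.trans (add_le_add (mul_le_mul_left (ENNReal.ofReal_le_ofReal h2.le) _) h5)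
  have hV : 0 ≤ gasVol β n p (critRad p n) := ENNReal.toReal_nonneg
  rw [← ofReal_gasVol β n hp, ← ENNReal.ofReal_mul (by norm_num),
    ← ENNReal.ofReal_add (by positivity) (Real.exp_pos _).le,
    ENNReal.ofReal_le_ofReal_iff (by positivity)] at h6
  have h7 : 2 * Real.exp (β / 2 * (-(1 / (2 * p)) - Real.log 2 - 0 + η / β) * n ^ 2 + C * n) ≤
      Real.exp ((β / 2 * (-(1 / (2 * p)) - Real.log 2) + η) * n ^ 2) := by
    nth_rewrite 1 [← Real.exp_log (by norm_num : (0 : ℝ) < 2)]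
    rw [← Real.exp_add, Real.exp_le_exp]
    have h8 : β / 2 * (-(1 / (2 * p)) - Real.log 2 - 0 + η / β) =
      β / 2 * (-(1 / (2 * p)) - Real.log 2) + η / 2 := by
      field_simp
      ring
    rw [h8]
    linarith
  linarith

lemma tendsto_log_gasVol_div {p : ℝ} (hp : 0 < p) {β : ℕ} (hβ : 1 ≤ β) :
    Tendsto (fun n : ℕ => Real.log (gasVol β n p (critRad p n)) / n ^ 2) atTop
      (nhds (β / 2 * (-(1 / (2 * p)) - Real.log 2))) := by
  rw [Metric.tendsto_nhds]
  intro η hη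
  filter_upwards [eventually_exp_le_gasVol hp hβ (half_pos hη),
    eventually_gasVol_le_exp hp hβ (half_pos hη), eventually_gt_atTop 0] with n h1 h2 hn
  have hn' : (0 : ℝ) < n ^ 2 := by positivity
  have hV := gasVol_pos β n hp (critRad_pos hp hn)
  rw [← Real.le_log_iff_exp_le hV, ← le_div_iff₀ hn'] at h1
  rw [← Real.log_le_iff_le_exp hV, ← div_le_iff₀ hn'] at h2
  rw [Real.dist_eq, abs_lt]
  constructor <;> linarith

/-- Under the gas measure restricted to the critical `ℓ^p` ball the `q`-moments concentrate. -/
lemma exists_moment_concentration {p q ε : ℝ} (hp : 0 < p) (hq : 0 < q) {β : ℕ} (hβ : 1 ≤ β)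
    (hε : 0 < ε) : ∃ e : ℕ → ℝ, Tendsto e atTop (nhds 0) ∧ ∀ᶠ n : ℕ in atTop,
      gas β n (lpBall n p (critRad p n) ∩
        {x | ε * n ≤ |∑ i, |x i| ^ q - n * (p / (p + q) * cosMoment q)|}) ≤
      ENNReal.ofReal (e n) * gas β n (lpBall n p (critRad p n)) := by
  obtain ⟨R, hR, e, he, hout⟩ := exists_outlier_bound hβ hp
  have hR1 : 1 ≤ R := by linarith
  have hβ' : (0 : ℝ) < β := by exact_mod_cast hβ
  obtain ⟨K, δ, hδ, hpen⟩ := exists_penalty hp hq hR1 hε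
  obtain ⟨r, hr, hr1, C, hC⟩ := exists_gas_le (η := δ / 4) hp hR1 (by positivity) β
  have hlim : Tendsto (fun n : ℕ => Real.exp (-(β * δ / 4 * (n : ℝ) ^ 2 - C * n))) atTop
      (nhds 0) :=
    Real.tendsto_exp_neg_atTop_nhds_zero.comp (tendsto_quadratic_atTop (by positivity) C)
  refine ⟨fun n => max (e n) 0 + Real.exp (-(β * δ / 4 * (n : ℝ) ^ 2 - C * n)), ?_, ?_⟩
  · simpa using (he.max (tendsto_const_nhds (x := (0 : ℝ)))).add hlim
  filter_upwards [hout, eventually_exp_le_gasVol hp hβ (show 0 < β * δ / 8 by positivity)]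
    with n h1 h2
  have hm : Measurable fun x : Fin n → ℝ => |∑ i, |x i| ^ q - n * (p / (p + q) * cosMoment q)| :=
    ((continuous_lpSum hq).measurable.sub_const _).abs
  have h3 := gas_lpBall_inter_le
    (Bad := {x | ε * n ≤ |∑ i, |x i| ^ q - n * (p / (p + q) * cosMoment q)|}) h1
  have h4 := hC n K δ (lpBall n p (critRad p n) ∩
    {x | ε * n ≤ |∑ i, |x i| ^ q - n * (p / (p + q) * cosMoment q)|} ∩ {x | ∀ i, |x i| ≤ R})
    (((measurableSet_lpBall hp _).inter (measurableSet_le measurable_const hm)).inter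
      (measurableSet_box n R)) (fun x hx => hx.1.1) (fun x hx => hx.2)
    (fun x hx => hpen r hr hr1 n x hx.2 hx.1.2)
  have h5 : ENNReal.ofReal (Real.exp (β / 2 * (-(1 / (2 * p)) - Real.log 2 - δ + δ / 4) *
      n ^ 2 + C * n)) ≤ ENNReal.ofReal (Real.exp (-(β * δ / 4 * (n : ℝ) ^ 2 - C * n))) *
      gas β n (lpBall n p (critRad p n)) := by
    rw [← ofReal_gasVol β n hp, ← ENNReal.ofReal_mul (Real.exp_pos _).le]
    refine ENNReal.ofReal_le_ofReal ?_
    refine le_trans (le_of_eq ?_) (mul_le_mul_of_nonneg_left h2 (Real.exp_pos _).le)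
    rw [← Real.exp_add]
    congr 1
    ring
  refine (h3.trans (add_le_add_right (h4.trans h5) _)).trans ?_
  rw [← add_mul, ENNReal.ofReal_add (le_max_right _ _) (Real.exp_pos _).le]
  gcongr
  exact le_max_left _ _

end Limits

section Transport

variable {𝕜 : Type} [RCLike 𝕜] {n : ℕ}

lemma sum_abs_eigs_smul (A : HMat 𝕜 n) {c : ℝ} (hc : 0 < c) (p : ℝ) :
    ∑ j, |eigs (c • A) j| ^ p = c ^ p * ∑ j, |eigs A j| ^ p := by
  have key : ∀ B : HMat 𝕜 n, ∃ U ∈ unitaryGroup (Fin n) 𝕜, B.1 = U * realDiag (eigs B) * Uᴴ := by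
    intro B
    have hB : B.1.IsHermitian := B.2
    have := hB.spectral_theorem
    rw [Unitary.conjStarAlgAut_apply] at this
    exact ⟨_, hB.eigenvectorUnitary.2, this⟩
  obtain ⟨U, hU, h1⟩ := key A
  obtain ⟨V, hV, h2⟩ := key (c • A)
  have h3 : V * realDiag (eigs (c • A)) * Vᴴ = U * realDiag (c • eigs A) * Uᴴ := by
    rw [← h2, selfAdjoint.val_smul, map_smul, Matrix.mul_smul, Matrix.smul_mul, ← h1]
  obtain ⟨σ, hσ⟩ := exists_perm_of_map_eq (map_eq_of_diag_conj_eq hV hU h3)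
  rw [← Equiv.sum_comp σ, Finset.mul_sum]
  refine Finset.sum_congr rfl fun j _ => ?_
  have h4 := congrFun hσ j
  rw [Function.comp_apply] at h4
  rw [h4, Pi.smul_apply, smul_eq_mul, abs_mul, abs_of_pos hc,
    Real.mul_rpow hc.le (abs_nonneg _)]

lemma smul_matBall {c : ℝ} (hc : 0 < c) (p : ℝ) :
    c • matBall 𝕜 n p = {A | eigs A ∈ lpBall n p (c ^ p)} := by
  ext A
  have h := Real.rpow_pos_of_pos hc p
  rw [Set.mem_smul_set_iff_inv_smul_mem₀ hc.ne', matBall, Set.mem_ofPred_eq,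
    sum_abs_eigs_smul A (inv_pos.2 hc), Set.mem_ofPred_eq, lpBall, Set.mem_ofPred_eq,
    Real.inv_rpow hc.le, inv_mul_le_iff₀ h, mul_one]

lemma comp_perm_mem_lpBall (p ρ : ℝ) (d : Fin n → ℝ) (σ : Equiv.Perm (Fin n)) :
    d ∘ σ ∈ lpBall n p ρ ↔ d ∈ lpBall n p ρ := by
  rw [lpBall, Set.mem_ofPred_eq, Set.mem_ofPred_eq]
  simp only [Function.comp_apply]
  rw [Equiv.sum_comp σ fun i => |d i| ^ p]

/-- The normalizing radius, expressed through the volume of the critical `ℓ^p` ball. -/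
lemma gasVol_one_rpow (β : ℕ) {p c : ℝ} (hp : 0 < p) (hc : 0 < c) (hn : 0 < n) :
    (c * gasVol β n p 1) ^ (-(1 : ℝ) / (gasDim β n : ℝ)) =
      critRad p n ^ (1 / p) * (c * gasVol β n p (critRad p n)) ^ (-(1 : ℝ) / (gasDim β n : ℝ)) := by
  have hκ := critRad_pos hp hn
  have hg := gasVol_pos β n hp hκ
  have hN : (gasDim β n : ℝ) ≠ 0 := by
    have : 0 < gasDim β n := Nat.add_pos_right _ hn
    positivity
  rw [gasVol_scale β n hp hκ one_pos, mul_left_comm, Real.mul_rpow (by positivity) (by positivity),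
    ← Real.rpow_mul (by positivity), one_div (critRad p n), Real.inv_rpow hκ.le,
    ← Real.rpow_neg hκ.le]
  congr 2
  field_simp

variable [MeasurableSpace 𝕜] [BorelSpace 𝕜]

lemma measure_matDBall_inter (β : ℕ) (hβ : Module.finrank ℝ 𝕜 = β) {p q t : ℝ} (hp : 0 < p)
    (hq : 0 < q) (ht : 0 < t) (hn : 0 < n) (μ : Measure (HMat 𝕜 n))
    (T : EuclideanSpace ℝ (Fin (gasDim β n)) ≃ₗ[ℝ] HMat 𝕜 n) (hμ : μ = Measure.map T volume) :
    μ (matDBall 𝕜 n β p μ ∩ t • matDBall 𝕜 n β q μ) =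
      gas β n (lpBall n p (critRad p n) ∩ lpBall n q (t ^ q * critRad q n *
        (gasVol β n p (critRad p n) / gasVol β n q (critRad q n)) ^ (q / gasDim β n))) /
      gas β n (lpBall n p (critRad p n)) := by
  obtain ⟨C, hC0, hCt, hC⟩ := exists_map_volume_eigs β hβ T
  rw [← hμ] at hC
  set c := C.toReal with hc
  have hc0 : 0 < c := ENNReal.toReal_pos hC0 hCt
  have hCc : C = ENNReal.ofReal c := (ENNReal.ofReal_toReal hCt).symm
  set N : ℝ := (gasDim β n : ℝ) with hN
  have hN0 : N ≠ 0 := by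
    have : 0 < gasDim β n := Nat.add_pos_right _ hn
    positivity
  have hκp := critRad_pos hp hn
  have hκq := critRad_pos hq hn
  set gp := gasVol β n p (critRad p n)
  set gq := gasVol β n q (critRad q n)
  have hgp : 0 < gp := gasVol_pos β n hp hκp
  have hgq : 0 < gq := gasVol_pos β n hq hκq
  set sp := (c * gp) ^ (-(1 : ℝ) / N) with hsp
  set sq := (c * gq) ^ (-(1 : ℝ) / N) with hsq
  have hsp0 : 0 < sp := by positivity
  have hsq0 : 0 < sq := by positivity
  have hball : ∀ {p : ℝ}, 0 < p → (μ (matBall 𝕜 n p)).toReal = c * gasVol β n p 1 := by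
    intro p hp
    have h := hC (lpBall n p 1) (measurableSet_lpBall hp 1) (comp_perm_mem_lpBall p 1)
    rw [← gas_apply β (measurableSet_lpBall hp 1)] at h
    have h' : μ (matBall 𝕜 n p) = C * gas β n (lpBall n p 1) := h
    rw [h', ENNReal.toReal_mul]
    rfl
  have hDp : matDBall 𝕜 n β p μ = {A | eigs A ∈ lpBall n p (sp ^ p * critRad p n)} := by
    have h := gasVol_one_rpow β hp hc0 hn
    have h1 : matDBall 𝕜 n β p μ = (critRad p n ^ (1 / p) * sp) • matBall 𝕜 n p := by
      rw [matDBall, hball hp, ← gasDim, h]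
    rw [h1, smul_matBall (by positivity), Real.mul_rpow (by positivity) hsp0.le,
      ← Real.rpow_mul hκp.le, one_div_mul_cancel hp.ne', Real.rpow_one, mul_comm]
  have hDq : t • matDBall 𝕜 n β q μ = {A | eigs A ∈ lpBall n q (sp ^ q * (t ^ q * critRad q n *
      (gp / gq) ^ (q / N)))} := by
    have h := gasVol_one_rpow β hq hc0 hn
    have h1 : matDBall 𝕜 n β q μ = (critRad q n ^ (1 / q) * sq) • matBall 𝕜 n q := by
      rw [matDBall, hball hq, ← gasDim, h]
    have h2 : sq ^ q = sp ^ q * (gp / gq) ^ (q / N) := by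
      rw [hsp, hsq, ← Real.rpow_mul (by positivity), ← Real.rpow_mul (by positivity),
        Real.div_rpow hgp.le hgq.le, Real.mul_rpow hc0.le hgp.le, Real.mul_rpow hc0.le hgq.le,
        show -1 / N * q = -(q / N) by ring, Real.rpow_neg hgp.le, Real.rpow_neg hgq.le]
      have := Real.rpow_pos_of_pos hgp (q / N)
      field_simp
    rw [h1, smul_smul, smul_matBall (by positivity), Real.mul_rpow ht.le (by positivity),
      Real.mul_rpow (by positivity) hsq0.le, ← Real.rpow_mul hκq.le, one_div_mul_cancel hq.ne',
      Real.rpow_one, h2, show t ^ q * (critRad q n * (sp ^ q * (gp / gq) ^ (q / N))) =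
        sp ^ q * (t ^ q * critRad q n * (gp / gq) ^ (q / N)) by ring]
  set τ := t ^ q * critRad q n * (gp / gq) ^ (q / N)
  have hmeas := (measurableSet_lpBall (n := n) hp (sp ^ p * critRad p n)).inter
    (measurableSet_lpBall hq (sp ^ q * τ))
  have h := hC _ hmeas fun d σ => by
    rw [Set.mem_inter_iff, Set.mem_inter_iff, comp_perm_mem_lpBall, comp_perm_mem_lpBall]
  rw [← gas_apply β hmeas, gas_preimage_smul β hsp0 hmeas, Set.preimage_inter,
    preimage_smul_lpBall hsp0, preimage_smul_lpBall hsp0] at h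
  have hinter : matDBall 𝕜 n β p μ ∩ t • matDBall 𝕜 n β q μ = {A | eigs A ∈
      lpBall n p (sp ^ p * critRad p n) ∩ lpBall n q (sp ^ q * τ)} := by
    rw [hDp, hDq]
    rfl
  rw [hinter, h, ← mul_assoc, ENNReal.div_eq_inv_mul, ← ofReal_gasVol β n hp (critRad p n)]
  congr 1
  rw [hCc, ← ENNReal.ofReal_mul hc0.le, ← ENNReal.ofReal_inv_of_pos hgp]
  congr 1
  have h3 : sp ^ gasDim β n = (c * gp)⁻¹ := by
    rw [hsp, ← Real.rpow_natCast, ← Real.rpow_mul (by positivity), ← hN,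
      div_mul_cancel₀ _ hN0, Real.rpow_neg_one]
  rw [h3]
  field_simp

end Transport

section Threshold

/-- The rescaled radius of the second ball, relative to the dimension. -/
lemma tendsto_radius_div {p q t : ℝ} (hp : 0 < p) (hq : 0 < q) {β : ℕ} (hβ : 1 ≤ β) :
    Tendsto (fun n : ℕ => t ^ q * critRad q n *
      (gasVol β n p (critRad p n) / gasVol β n q (critRad q n)) ^ (q / gasDim β n) / n) atTop
      (nhds (t ^ q * (cosMoment q / 2) * Real.exp (q * (1 / (2 * q) - 1 / (2 * p))))) := by
  have hβ' : (0 : ℝ) < β := by exact_mod_cast hβ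
  have h1 := ((tendsto_log_gasVol_div hp hβ).sub (tendsto_log_gasVol_div hq hβ)).div
    (tendsto_gasDim_div β) (by positivity)
  have h2 := ((Real.continuous_exp.tendsto _).comp (h1.const_mul q)).const_mul
    (t ^ q * (cosMoment q / 2))
  have e : q * ((β / 2 * (-(1 / (2 * p)) - Real.log 2) - β / 2 * (-(1 / (2 * q)) - Real.log 2)) /
      (β / 2)) = q * (1 / (2 * q) - 1 / (2 * p)) := by
    field_simp
    ring
  rw [e] at h2
  refine h2.congr' ?_
  filter_upwards [eventually_gt_atTop 0] with n hn
  have hgp := gasVol_pos β n hp (critRad_pos hp hn)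
  have hgq := gasVol_pos β n hq (critRad_pos hq hn)
  have hn' : (n : ℝ) ≠ 0 := by positivity
  have hκ : critRad q n = cosMoment q / 2 * n := rfl
  simp only [Function.comp_apply, Pi.div_apply]
  set gp := gasVol β n p (critRad p n)
  set gq := gasVol β n q (critRad q n)
  rw [Real.rpow_def_of_pos (div_pos hgp hgq), Real.log_div hgp.ne' hgq.ne', hκ, ← sub_div, div_div_div_cancel_right₀ (by positivity)]
  have e2 : ∀ a N : ℝ, q * (a / N) = a * (q / N) := fun a N => by ring
  rw [e2]
  field_simp

lemma threshold_rpow {p q : ℝ} (hp : 0 < p) (hq : 0 < q) :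
    (Real.exp (1 / (2 * p) - 1 / (2 * q)) * (2 * p / (p + q)) ^ (1 / q)) ^ q *
      Real.exp (q * (1 / (2 * q) - 1 / (2 * p))) = 2 * p / (p + q) := by
  rw [Real.mul_rpow (Real.exp_pos _).le (by positivity), ← Real.rpow_mul (by positivity),
    one_div_mul_cancel hq.ne', Real.rpow_one, ← Real.exp_mul, mul_right_comm, ← Real.exp_add,
    show (1 / (2 * p) - 1 / (2 * q)) * q + q * (1 / (2 * q) - 1 / (2 * p)) = 0 by ring,
    Real.exp_zero, one_mul]

lemma limit_strictMono (p : ℝ) {q s t : ℝ} (hq : 0 < q) (hs : 0 < s) (hst : s < t) :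
    s ^ q * (cosMoment q / 2) * Real.exp (q * (1 / (2 * q) - 1 / (2 * p))) <
      t ^ q * (cosMoment q / 2) * Real.exp (q * (1 / (2 * q) - 1 / (2 * p))) := by
  have h1 := Real.rpow_lt_rpow hs.le hst hq
  have h2 := cosMoment_pos hq
  have h3 := Real.exp_pos (q * (1 / (2 * q) - 1 / (2 * p)))
  gcongr

lemma threshold_limit {p q : ℝ} (hp : 0 < p) (hq : 0 < q) :
    (Real.exp (1 / (2 * p) - 1 / (2 * q)) * (2 * p / (p + q)) ^ (1 / q)) ^ q *
      (cosMoment q / 2) * Real.exp (q * (1 / (2 * q) - 1 / (2 * p))) =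
      p / (p + q) * cosMoment q := by
  rw [mul_right_comm, threshold_rpow hp hq]
  ring


lemma tendsto_ratio_zero {p q : ℝ} (hp : 0 < p) (hq : 0 < q) {β : ℕ} (hβ : 1 ≤ β) {τ : ℕ → ℝ}
    {L : ℝ} (hτ : Tendsto (fun n => τ n / n) atTop (nhds L))
    (hL : L < p / (p + q) * cosMoment q) :
    Tendsto (fun n => gas β n (lpBall n p (critRad p n) ∩ lpBall n q (τ n)) /
      gas β n (lpBall n p (critRad p n))) atTop (nhds 0) := by
  set M := p / (p + q) * cosMoment q
  obtain ⟨e, he, hconc⟩ := exists_moment_concentration hp hq hβ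
    (by linarith : 0 < (M - L) / 2)
  have he' : Tendsto (fun n => ENNReal.ofReal (e n)) atTop (nhds 0) := by
    simpa using ENNReal.tendsto_ofReal he
  refine tendsto_of_tendsto_of_tendsto_of_le_of_le' tendsto_const_nhds he'
    (Eventually.of_forall fun n => zero_le) ?_
  filter_upwards [hconc, hτ.eventually (gt_mem_nhds (by linarith : L < (M + L) / 2)),
    eventually_gt_atTop 0] with n h1 h2 hn
  have hn' : (0 : ℝ) < n := by exact_mod_cast hn
  rw [div_lt_iff₀ hn'] at h2
  refine ENNReal.div_le_of_le_mul (le_trans (measure_mono ?_) h1)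
  rintro x ⟨hx, hxq⟩
  refine ⟨hx, ?_⟩
  rw [Set.mem_ofPred_eq]
  refine le_abs.2 (Or.inr ?_)
  have : ∑ i, |x i| ^ q ≤ τ n := hxq
  linarith

lemma tendsto_ratio_one {p q : ℝ} (hp : 0 < p) (hq : 0 < q) {β : ℕ} (hβ : 1 ≤ β) {τ : ℕ → ℝ}
    {L : ℝ} (hτ : Tendsto (fun n => τ n / n) atTop (nhds L))
    (hL : p / (p + q) * cosMoment q < L) :
    Tendsto (fun n => gas β n (lpBall n p (critRad p n) ∩ lpBall n q (τ n)) /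
      gas β n (lpBall n p (critRad p n))) atTop (nhds 1) := by
  set M := p / (p + q) * cosMoment q
  obtain ⟨e, he, hconc⟩ := exists_moment_concentration hp hq hβ
    (by linarith : 0 < (L - M) / 2)
  have he' : Tendsto (fun n => 1 - ENNReal.ofReal (e n)) atTop (nhds 1) := by
    have h := ENNReal.Tendsto.sub (tendsto_const_nhds (x := (1 : ℝ≥0∞)))
      (ENNReal.tendsto_ofReal he) (Or.inl ENNReal.one_ne_top)
    simpa using h
  refine tendsto_of_tendsto_of_tendsto_of_le_of_le' he' tendsto_const_nhds ?_
    (Eventually.of_forall fun n => ENNReal.div_le_of_le_mul ?_)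
  · filter_upwards [hconc, hτ.eventually (lt_mem_nhds (by linarith : (M + L) / 2 < L)),
      eventually_gt_atTop 0] with n h1 h2 hn
    have hn' : (0 : ℝ) < n := by exact_mod_cast hn
    have hκ := critRad_pos hp hn
    rw [lt_div_iff₀ hn'] at h2
    have hG0 := (gas_lpBall_pos (n := n) β hp hκ).ne'
    have hGt := (gas_lpBall_lt_top (n := n) β hp (critRad p n)).ne
    rw [tsub_le_iff_right, ← ENNReal.div_self hG0 hGt]
    refine ENNReal.div_le_of_le_mul ?_
    rw [add_mul, ENNReal.div_mul_cancel hG0 hGt]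
    refine le_trans (measure_mono ?_) ((measure_union_le _ _).trans (add_le_add_right h1 _))
    intro x hx
    by_cases hxq : x ∈ lpBall n q (τ n)
    · exact Or.inl ⟨hx, hxq⟩
    · refine Or.inr ⟨hx, ?_⟩
      rw [Set.mem_ofPred_eq]
      refine le_abs.2 (Or.inl ?_)
      have : τ n < ∑ i, |x i| ^ q := not_le.1 hxq
      linarith
  · rw [one_mul]
    exact measure_mono Set.inter_subset_left

end Threshold

theorem stmt0 (𝕜 : Type) [RCLike 𝕜] [MeasurableSpace 𝕜] [BorelSpace 𝕜]
    (β : ℕ) (hβ : Module.finrank ℝ 𝕜 = β)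
    (p q : ℝ) (hp : 0 < p) (hq : 0 < q) (hpq : p ≠ q)
    -- `vol n` is the Lebesgue volume on `H_n(F_β)` induced by the inner product
    -- `⟨A,B⟩ = Re Tr (A Bᴴ)`, i.e. the pushforward of the Lebesgue measure on the
    -- Euclidean space of dimension `N = β n(n-1)/2 + n` under any linear isometry `T n`.
    (vol : ∀ n : ℕ, Measure (HMat 𝕜 n))
    (T : ∀ n : ℕ, EuclideanSpace ℝ (Fin (β * (n * (n - 1) / 2) + n)) ≃ₗ[ℝ] HMat 𝕜 n)
    (hT : ∀ n x y, ⟪x, y⟫ = RCLike.re (Matrix.trace ((T n x).val * ((T n y).val)ᴴ)))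
    (hvol : ∀ n, vol n = Measure.map (T n) volume)
    (t : ℝ) (ht : 0 < t) :
    (t < Real.exp (1 / (2 * p) - 1 / (2 * q)) * (2 * p / (p + q)) ^ (1 / q) →
      Tendsto
        (fun n : ℕ =>
          (vol n) (matDBall 𝕜 n β p (vol n) ∩ t • matDBall 𝕜 n β q (vol n)))
        atTop (nhds 0)) ∧
    (Real.exp (1 / (2 * p) - 1 / (2 * q)) * (2 * p / (p + q)) ^ (1 / q) < t →
      Tendsto
        (fun n : ℕ =>
          (vol n) (matDBall 𝕜 n β p (vol n) ∩ t • matDBall 𝕜 n β q (vol n)))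
        atTop (nhds 1)) := by
  have hβ1 : 1 ≤ β := hβ ▸ Module.finrank_pos
  have key : ∀ᶠ n : ℕ in atTop, gas β n (lpBall n p (critRad p n) ∩ lpBall n q (t ^ q *
      critRad q n * (gasVol β n p (critRad p n) / gasVol β n q (critRad q n)) ^
        (q / gasDim β n))) / gas β n (lpBall n p (critRad p n)) =
      (vol n) (matDBall 𝕜 n β p (vol n) ∩ t • matDBall 𝕜 n β q (vol n)) := by
    filter_upwards [eventually_gt_atTop 0] with n hn
    exact (measure_matDBall_inter β hβ hp hq ht hn (vol n) (T n) (hvol n)).symm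
  have hthr : 0 < Real.exp (1 / (2 * p) - 1 / (2 * q)) * (2 * p / (p + q)) ^ (1 / q) := by
    positivity
  have hlim := tendsto_radius_div (t := t) hp hq hβ1
  refine ⟨fun h => ?_, fun h => ?_⟩
  · have hlt := limit_strictMono p hq ht h
    rw [threshold_limit hp hq] at hlt
    exact (tendsto_ratio_zero hp hq hβ1 hlim hlt).congr' key
  · have hlt := limit_strictMono p hq hthr h
    rw [threshold_limit hp hq] at hlt
    exact (tendsto_ratio_one hp hq hβ1 hlim hlt).congr' key

end
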